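/- arXiv:math/0108057 — 3 statements merged into one kernel-verified Lean document; each statement's English description precedes it below -/
import Mathlib

section
/- Let X and Y be complex Banach spaces with X infinite dimensional, let 𝒜 ⊆ B(X) and ℬ ⊆ B(Y) be standard operator algebras, and let φ : 𝒜 → ℬ be a bijective transformation satisfying φ((1/2)(AB+BA)) = (1/2)(φ(A)φ(B)+φ(B)φ(A)) for all A, B ∈ 𝒜. Then one of the following holds: (i) there exists an invertible bounded linear operator T : X → Y such that φ(A) = T A T⁻¹ for all A ∈ 𝒜; (ii) there exists an invertible bounded conjugate-linear operator T : X → Y such that φ(A) = T A T⁻¹ for all A ∈ 𝒜; (iii) there exists an invertible bounded linear operator T : X' → Y such that φ(A) = T A' T⁻¹ for all A ∈ 𝒜; (iv) there exists an invertible bounded conjugate-linear operator T : X' → Y such that φ(A) = T A' T⁻¹ for all A ∈ 𝒜. -/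
set_option linter.unusedSectionVars false
set_option linter.unusedVariables false

structure JSetup {R S : Type*} [NonUnitalRing R] [Module ℂ R]
    [NonUnitalRing S] [Module ℂ S] (φ : R → S) (e : R) : Prop where
  bij : Function.Bijective φ
  jord : ∀ a b : R, φ (((1:ℂ)/2) • (a * b + b * a)) = ((1:ℂ)/2) • (φ a * φ b + φ b * φ a)
  idem : e * e = e
  prime : ∀ a b : R, (∀ r, a * r * b = 0) → a = 0 ∨ b = 0
  ne : e ≠ 0
  nt : ∃ b : R, b ≠ 0 ∧ e * b = 0 ∧ b * e = 0
  lu12 : ∀ a, e * a = a → a * e = 0 → ∃ q, e * q = 0 ∧ q * e = 0 ∧ a * q = a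
  lu21 : ∀ a, e * a = 0 → a * e = a → ∃ q, e * q = 0 ∧ q * e = 0 ∧ q * a = a

namespace JSetup

theorem two_tf {R : Type*} [NonUnitalRing R] [Module ℂ R] {x : R} (h : x + x = 0) : x = 0 := by
  rw [← two_smul ℂ x] at h
  simpa using h

section
variable {R S : Type*} [NonUnitalRing R] [Module ℂ R] [IsScalarTower ℂ R R] [SMulCommClass ℂ R R]
    [NonUnitalRing S] [Module ℂ S] [IsScalarTower ℂ S S] [SMulCommClass ℂ S S]
    {φ : R → S} {e : R}

theorem mz {a b : R} (h : a * e = 0) (h' : e * b = b) : a * b = 0 := by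
  rw [← h', ← mul_assoc, h, zero_mul]

theorem mz' {a b : R} (h : a * e = a) (h' : e * b = 0) : a * b = 0 := by
  rw [← h, mul_assoc, h', mul_zero]

theorem el {a b : R} {c : R} (h : e * a = c) : e * (a * b) = c * b := by
  rw [← mul_assoc, h]

theorem er {a b : R} {c : R} (h : b * e = c) : (a * b) * e = a * c := by
  rw [mul_assoc, h]

theorem map_zero' (h : JSetup φ e) : φ 0 = 0 := by
  obtain ⟨a, ha⟩ := h.bij.2 0
  have := h.jord 0 a
  simpa [ha] using this

theorem jord2 (h : JSetup φ e) (a b : R) :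
    φ (a * b + b * a) = ((1:ℂ)/2) • (φ a * φ ((2:ℂ) • b) + φ ((2:ℂ) • b) * φ a) := by
  rw [← h.jord]
  congr 1
  simp [mul_smul_comm, smul_mul_assoc, smul_smul, ← smul_add]

theorem key0 (h : JSetup φ e) {s a b : R} (hs : φ s = φ a + φ b) (t : R) :
    φ (s * t + t * s) = φ (a * t + t * a) + φ (b * t + t * b) := by
  rw [h.jord2, h.jord2, h.jord2, hs, ← smul_add]
  congr 1
  simp only [add_mul, mul_add]
  abel

theorem key (h : JSetup φ e) {s a b : R} (hs : φ s = φ a + φ b) (t : R)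
    (ht : φ ((a * t + t * a) + (b * t + t * b)) = φ (a * t + t * a) + φ (b * t + t * b)) :
    (s - (a + b)) * t + t * (s - (a + b)) = 0 := by
  have h1 := h.key0 hs t
  rw [← ht] at h1
  have h2 := h.bij.1 h1
  calc _ = (s * t + t * s) - ((a * t + t * a) + (b * t + t * b)) := by
        simp only [sub_mul, mul_sub, add_mul, mul_add]; abel
    _ = 0 := by rw [h2, sub_self]

theorem t22 (h : JSetup φ e) {d : R}
    (hd : ∀ t, e * t = 0 → t * e = 0 → d * t + t * d = 0) : e * d = d ∧ d * e = d := by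
  obtain ⟨b, hb0, hb1, hb2⟩ := h.nt
  have hi := h.idem
  have T1 : ∀ r, e * (r * b - e * (r * b)) = 0 ∧ (r * b - e * (r * b)) * e = 0 := by
    intro r
    constructor
    · rw [mul_sub, ← mul_assoc e e, hi, sub_self]
    · simp [sub_mul, mul_assoc, hb2]
  have T2 : ∀ r, e * (b * r - b * r * e) = 0 ∧ (b * r - b * r * e) * e = 0 := by
    intro r
    constructor
    · simp [mul_sub, ← mul_assoc, hb1]
    · rw [sub_mul, mul_assoc (b * r) e e, hi, sub_self]
  have h1 : e * d - e * d * e = 0 := by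
    refine (h.prime _ b fun r => ?_).resolve_right hb0
    have := hd _ (T1 r).1 (T1 r).2
    have h2 := congrArg (e * ·) this
    simp only [mul_add, mul_zero] at h2
    rw [← mul_assoc e _ d, (T1 r).1, zero_mul, add_zero] at h2
    rw [← h2]
    simp only [mul_sub, sub_mul, mul_assoc]
  have h2 : d * e - e * d * e = 0 := by
    refine (h.prime b _ fun r => ?_).resolve_left hb0
    have := hd _ (T2 r).1 (T2 r).2
    have h2 := congrArg (· * e) this
    simp only [add_mul, zero_mul] at h2
    rw [mul_assoc d _ e, (T2 r).2, mul_zero, zero_add] at h2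
    rw [← h2]
    simp only [mul_sub, sub_mul, mul_assoc]
  have h3 : e * d = d * e := by
    rw [sub_eq_zero] at h1 h2
    rw [h1, ← h2]
  set f := d - e * d with hf
  have fe : f * e = 0 := by
    rw [hf, sub_mul, h3, mul_assoc, hi, sub_self]
  have ef : e * f = 0 := by
    rw [hf, mul_sub, ← mul_assoc, hi, sub_self]
  have hF : ∀ t, e * t = 0 → t * e = 0 → f * t = - (t * f) := by
    intro t h1 h2
    have := hd t h1 h2
    rw [hf, sub_mul, mul_sub, ← mul_assoc t e, h2, h3, mul_assoc, h1]
    simpa using eq_neg_of_add_eq_zero_left this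
  have hF2 : ∀ t s, e * t = 0 → t * e = 0 → e * s = 0 → s * e = 0 → f * t * s = 0 := by
    intro t s t1 t2 s1 s2
    apply two_tf
    have a1 := hF (t * s) (by rw [← mul_assoc, t1, zero_mul]) (by rw [mul_assoc, s2, mul_zero])
    have a2 := hF t t1 t2
    have a3 := hF s s1 s2
    have : f * t * s = - (f * t * s) := by
      conv_lhs => rw [mul_assoc, a1, mul_assoc, ← neg_eq_iff_eq_neg.2 a3, mul_neg, neg_neg,
        ← mul_assoc, ← neg_eq_iff_eq_neg.2 a2, neg_mul]
    nth_rewrite 1 [this]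
    simp
  have hf0 : f = 0 := by
    by_contra hne
    have : ∀ r', b * r' * b = 0 := by
      intro r'
      refine (h.prime f _ fun r => ?_).resolve_left hne
      have := hF2 _ _ (T1 r).1 (T1 r).2 (T1 r').1 (T1 r').2
      rw [mul_sub f, ← mul_assoc f e, fe, zero_mul, sub_zero] at this
      rw [← this]
      simp only [mul_sub, ← mul_assoc]
      simp [mul_assoc f r b, mul_assoc r b e, hb2, mul_assoc]
      
    exact (h.prime b b this).elim hb0 hb0
  have : e * d = d := by
    rw [hf, sub_eq_zero] at hf0
    exact hf0.symm
  exact ⟨this, by rw [← h3, this]⟩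

theorem t11 (h : JSetup φ e) {d : R} (hd : d * e + e * d = 0) : e * d = 0 ∧ d * e = 0 := by
  have hi := h.idem
  have h1 := congrArg (e * ·) hd
  have h2 := congrArg (· * e) hd
  simp only [mul_add, add_mul, mul_zero, zero_mul] at h1 h2
  rw [← mul_assoc e e d, hi] at h1
  rw [mul_assoc d e e, hi] at h2
  have h3 : e * d = d * e := by
    have a1 := eq_neg_of_add_eq_zero_right h1
    have a2 := eq_neg_of_add_eq_zero_left h2
    rw [mul_assoc] at a2
    exact a1.trans a2.symm
  rw [← h3] at hd
  have := two_tf hd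
  exact ⟨this, h3 ▸ this⟩

theorem r12 (h : JSetup φ e) {d : R} (h1 : e * d = d) (h2 : d * e = d)
    (hd : ∀ t, e * t = t → t * e = 0 → d * t + t * d = 0) : d = 0 := by
  obtain ⟨b, hb0, hb1, hb2⟩ := h.nt
  refine (h.prime d b fun r => ?_).resolve_right hb0
  have he : (e * (r * b)) * e = 0 := by simp [mul_assoc, hb2]
  have := hd (e * (r * b)) (by rw [← mul_assoc, h.idem]) he
  rw [mz he h1, add_zero, ← mul_assoc, h2] at this
  rw [mul_assoc, this]

theorem r12' (h : JSetup φ e) {d : R} (h1 : e * d = 0) (h2 : d * e = 0)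
    (hd : ∀ t, e * t = t → t * e = 0 → d * t + t * d = 0) : d = 0 := by
  refine (h.prime e d fun r => ?_).resolve_left h.ne
  have hi := h.idem
  have he : e * (e * r - e * r * e) = (e * r - e * r * e) := by simp [mul_sub, ← mul_assoc, hi]
  have := hd (e * r - e * r * e) he (by rw [sub_mul, mul_assoc (e * r), hi, sub_self])
  rw [mz h2 he, zero_add, sub_mul, mul_assoc (e * r), h1, mul_zero, sub_zero] at this
  exact this

/-- additivity on 11 + 22 -/
theorem s1 (h : JSetup φ e) {a b : R} (ha : e * a = a) (ha' : a * e = a)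
    (hb : e * b = 0) (hb' : b * e = 0) : φ (a + b) = φ a + φ b := by
  obtain ⟨s, hs⟩ := h.bij.2 (φ a + φ b)
  have z := h.map_zero'
  have h1 := h.key hs e (by simp [hb, hb', z])
  have h2 := h.t11 h1
  have h3 := h.t22 (d := s - (a + b)) fun t t1 t2 => h.key hs t (by simp [mz' ha' t1, mz t2 ha, z])
  rw [← hs]; congr 1
  rw [h2.1] at h3
  exact (sub_eq_zero.1 h3.1.symm).symm

/-- 11 + 12 -/
theorem s2 (h : JSetup φ e) {a b : R} (ha : e * a = a) (ha' : a * e = a)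
    (hb : e * b = b) (hb' : b * e = 0) : φ (a + b) = φ a + φ b := by
  obtain ⟨s, hs⟩ := h.bij.2 (φ a + φ b)
  have z := h.map_zero'
  have h3 := h.t22 (d := s - (a + b)) fun t t1 t2 => h.key hs t (by simp [mz' ha' t1, mz t2 ha, z])
  have h4 := h.r12 h3.1 h3.2 fun t t1 t2 => h.key hs t (by simp [mz hb' t1, mz t2 hb, z])
  rw [← hs]; congr 1
  exact (sub_eq_zero.1 h4).symm

/-- 22 + 12 -/
theorem s3 (h : JSetup φ e) {a b : R} (ha : e * a = 0) (ha' : a * e = 0)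
    (hb : e * b = b) (hb' : b * e = 0) : φ (a + b) = φ a + φ b := by
  obtain ⟨s, hs⟩ := h.bij.2 (φ a + φ b)
  have z := h.map_zero'
  have h3 := h.t11 (h.key hs e (by simp [ha, ha', z]))
  have h4 := h.r12' h3.1 h3.2 fun t t1 t2 => h.key hs t (by simp [mz hb' t1, mz t2 hb, z])
  rw [← hs]; congr 1
  exact (sub_eq_zero.1 h4).symm

/-- 12 + 21 -/
theorem s4 (h : JSetup φ e) {a b : R} (ha : e * a = a) (ha' : a * e = 0)
    (hb : e * b = 0) (hb' : b * e = b) : φ (a + b) = φ a + φ b := by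
  obtain ⟨s, hs⟩ := h.bij.2 (φ a + φ b)
  have z := h.map_zero'
  have hi := h.idem
  have A : ∀ s, φ s = φ a + φ b → ∀ t, e * t = t → t * e = 0 →
      (s - (a + b)) * t + t * (s - (a + b)) = 0 := fun s hs t t1 t2 =>
    h.key hs t (by simp [mz ha' t1, mz t2 ha, z])
  have B : ∀ t, e * t = 0 → t * e = t →
      (s - (a + b)) * t + t * (s - (a + b)) = 0 := fun t t1 t2 =>
    h.key hs t (by simp [mz' hb' t1, mz' t2 hb, z])
  have C := A _ (by simpa [ha, ha', hb, hb'] using h.key0 hs e)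
  have A' := A s hs
  have hC : s * e + e * s - (a + b) = (s - (a + b)) * e + e * (s - (a + b)) := by
    simp only [mul_sub, sub_mul, mul_add, add_mul, ha, ha', hb, hb']; abel
  rw [hC] at C
  set d := s - (a + b)
  -- d21 = 0
  have d21 : d * e - e * d * e = 0 := by
    refine (h.prime e _ fun r => ?_).resolve_left h.ne
    have he : e * (e * r - e * r * e) = (e * r - e * r * e) := by simp [mul_sub, ← mul_assoc, hi]
    have he' : (e * r - e * r * e) * e = 0 := by rw [sub_mul, mul_assoc (e * r), hi, sub_self]
    have := congrArg (· * e) (A' _ he he')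
    simp only [add_mul, zero_mul] at this
    rw [mul_assoc d, he', mul_zero, zero_add] at this
    rw [← this]
    simp only [mul_sub, sub_mul, mul_assoc]
  have d12 : e * d - e * d * e = 0 := by
    refine (h.prime _ e fun r => ?_).resolve_right h.ne
    have he : e * (r * e - e * r * e) = 0 := by simp [mul_sub, ← mul_assoc, hi]
    have he' : (r * e - e * r * e) * e = (r * e - e * r * e) := by simp [sub_mul, mul_assoc, hi]
    have := congrArg (e * ·) (B _ he he')
    simp only [mul_add, mul_zero] at this
    rw [← mul_assoc e _ d, he, zero_mul, add_zero] at this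
    rw [← this]
    simp only [mul_sub, sub_mul, mul_assoc]
  have h3 : e * d = d * e := by
    rw [sub_eq_zero] at d12 d21
    rw [d12, ← d21]
  rw [h3] at C
  have h4 : d * e + d * e = 0 := h.r12 (by rw [mul_add, ← mul_assoc, h3, mul_assoc, hi])
    (by rw [add_mul, mul_assoc, hi]) C
  have h5 := two_tf h4
  have h6 := h.r12' (h3.trans h5) h5 A'
  rw [← hs]; congr 1
  exact (sub_eq_zero.1 h6).symm

/-- 11 + 12 + 22 -/
theorem s5 (h : JSetup φ e) {a b c : R} (ha : e * a = a) (ha' : a * e = a)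
    (hb : e * b = b) (hb' : b * e = 0) (hc : e * c = 0) (hc' : c * e = 0) :
    φ (a + b + c) = φ a + φ b + φ c := by
  obtain ⟨s, hs⟩ := h.bij.2 (φ a + φ b + φ c)
  have z := h.map_zero'
  have hs1 : φ s = φ (a + b) + φ c := by rw [hs, h.s2 ha ha' hb hb']
  have hs2 : φ s = φ a + φ (c + b) := by rw [hs, h.s3 hc hc' hb hb']; abel
  have h3 := h.t11 (h.key hs1 e (by simp [hc, hc', z]))
  have h4 := h.t22 (d := s - (a + (c + b))) fun t t1 t2 =>
    h.key hs2 t (by simp [mz' ha' t1, mz t2 ha, z])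
  have : a + (c + b) = a + b + c := by abel
  rw [this, h3.1] at h4
  rw [← hs]; congr 1
  exact (sub_eq_zero.1 h4.1.symm).symm

theorem s6 (h : JSetup φ e) {a b c : R} (ha : e * a = a) (ha' : a * e = a)
    (hb : e * b = b) (hb' : b * e = 0) (hc : e * c = 0) (hc' : c * e = c) :
    φ (a + (b + c)) = φ a + φ (b + c) := by
  obtain ⟨s, hs⟩ := h.bij.2 (φ a + φ (b + c))
  have z := h.map_zero'
  have h3 := h.t22 (d := s - (a + (b + c))) fun t t1 t2 =>
    h.key hs t (by simp [mz' ha' t1, mz t2 ha, z])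
  have h4 := h.r12 h3.1 h3.2 fun t t1 t2 => h.key hs t (by
    have e1 : a * t + t * a = a * t := by rw [mz t2 ha, add_zero]
    have e2 : (b + c) * t + t * (b + c) = t * c + c * t := by
      rw [add_mul, mul_add, mz hb' t1, mz t2 hb]; abel
    rw [e1, e2, h.s1 (a := t * c) (b := c * t) (el t1) (er hc') (by simp [el hc]) (by simp [er t2])]
    rw [← add_assoc, add_comm (a * t), h.s5 (a := t * c) (b := a * t) (c := c * t)
      (el t1) (er hc') (el ha) (by simp [er t2]) (by simp [el hc]) (by simp [er t2])]
    abel)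
  rw [← hs]; congr 1
  exact (sub_eq_zero.1 h4).symm

theorem s6' (h : JSetup φ e) {a b c : R} (ha : e * a = 0) (ha' : a * e = 0)
    (hb : e * b = b) (hb' : b * e = 0) (hc : e * c = 0) (hc' : c * e = c) :
    φ (a + (b + c)) = φ a + φ (b + c) := by
  obtain ⟨s, hs⟩ := h.bij.2 (φ a + φ (b + c))
  have z := h.map_zero'
  have h3 := h.t11 (h.key hs e (by simp [ha, ha', z]))
  have h4 := h.r12' h3.1 h3.2 fun t t1 t2 => h.key hs t (by
    have e1 : a * t + t * a = t * a := by rw [mz ha' t1, zero_add]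
    have e2 : (b + c) * t + t * (b + c) = t * c + c * t := by
      rw [add_mul, mul_add, mz hb' t1, mz t2 hb]; abel
    rw [e1, e2, h.s1 (a := t * c) (b := c * t) (el t1) (er hc') (by simp [el hc]) (by simp [er t2])]
    rw [← add_assoc, add_comm (t * a), h.s5 (a := t * c) (b := t * a) (c := c * t)
      (el t1) (er hc') (el t1) (by simp [er ha']) (by simp [el hc]) (by simp [er t2])]
    abel)
  rw [← hs]; congr 1
  exact (sub_eq_zero.1 h4).symm

theorem s7 (h : JSetup φ e) {a b c d : R} (ha : e * a = a) (ha' : a * e = a)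
    (hb : e * b = b) (hb' : b * e = 0) (hc : e * c = 0) (hc' : c * e = c)
    (hd : e * d = 0) (hd' : d * e = 0) :
    φ (a + b + c + d) = φ a + φ b + φ c + φ d := by
  obtain ⟨s, hs⟩ := h.bij.2 (φ a + φ b + φ c + φ d)
  have z := h.map_zero'
  have hs1 : φ s = φ (a + (b + c)) + φ d := by
    rw [hs, h.s6 ha ha' hb hb' hc hc', h.s4 hb hb' hc hc']; abel
  have hs2 : φ s = φ a + φ (d + (b + c)) := by
    rw [hs, h.s6' hd hd' hb hb' hc hc', h.s4 hb hb' hc hc']; abel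
  have h3 := h.t11 (h.key hs1 e (by simp [hd, hd', z]))
  have h4 := h.t22 (d := s - (a + (d + (b + c)))) fun t t1 t2 =>
    h.key hs2 t (by simp [mz' ha' t1, mz t2 ha, z])
  have e1 : a + (d + (b + c)) = a + b + c + d := by abel
  have e2 : a + (b + c) + d = a + b + c + d := by abel
  rw [e2] at h3
  rw [e1, h3.1] at h4
  rw [← hs]; congr 1
  exact (sub_eq_zero.1 h4.1.symm).symm

theorem s8 (h : JSetup φ e) {a b : R} (ha : e * a = a) (ha' : a * e = 0)
    (hb : e * b = b) (hb' : b * e = 0) : φ (a + b) = φ a + φ b := by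
  obtain ⟨q, q1, q2, q3⟩ := h.lu12 a ha ha'
  have z := h.map_zero'
  have e1 : a + b = (e + a) * (q + b) + (q + b) * (e + a) := by
    simp only [add_mul, mul_add, q1, q2, q3, hb, hb', mz ha' hb, mz hb' ha, mz q2 ha]; abel
  have e2 : (2:ℂ) • (q + b) = (2:ℂ) • q + (2:ℂ) • b := smul_add _ _ _
  rw [e1, h.jord2, h.s2 h.idem h.idem ha ha', e2,
    h.s3 (a := (2:ℂ) • q) (b := (2:ℂ) • b) (by simp [mul_smul_comm, q1]) (by simp [smul_mul_assoc, q2])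
     (by simp [mul_smul_comm, hb]) (by simp [smul_mul_assoc, hb'])]
  have f1 := h.jord2 e q
  have f2 := h.jord2 e b
  have f3 := h.jord2 a q
  have f4 := h.jord2 a b
  rw [q1, q2, add_zero, z] at f1
  rw [hb, hb', add_zero] at f2
  rw [q3, mz q2 ha, add_zero] at f3
  rw [mz ha' hb, mz hb' ha, add_zero, z] at f4
  calc _ = ((1:ℂ)/2) • (φ e * φ ((2:ℂ) • q) + φ ((2:ℂ) • q) * φ e)
    + ((1:ℂ)/2) • (φ e * φ ((2:ℂ) • b) + φ ((2:ℂ) • b) * φ e)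
    + ((1:ℂ)/2) • (φ a * φ ((2:ℂ) • q) + φ ((2:ℂ) • q) * φ a)
    + ((1:ℂ)/2) • (φ a * φ ((2:ℂ) • b) + φ ((2:ℂ) • b) * φ a) := by
        simp only [← smul_add]; congr 1; simp only [add_mul, mul_add]; abel
    _ = _ := by rw [← f1, ← f2, ← f3, ← f4]; abel

theorem s8' (h : JSetup φ e) {a b : R} (ha : e * a = 0) (ha' : a * e = a)
    (hb : e * b = 0) (hb' : b * e = b) : φ (a + b) = φ a + φ b := by
  obtain ⟨q, q1, q2, q3⟩ := h.lu21 a ha ha'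
  have z := h.map_zero'
  have e1 : a + b = (e + a) * (q + b) + (q + b) * (e + a) := by
    simp only [add_mul, mul_add, q1, q2, q3, hb, hb', mz' ha' hb, mz' hb' ha, mz' ha' q1]; abel
  have e2 : (2:ℂ) • (q + b) = (2:ℂ) • q + (2:ℂ) • b := smul_add _ _ _
  have e3 := h.s7 (a := e) (b := 0) (c := a) (d := 0) h.idem h.idem (by simp) (by simp) ha ha'
    (by simp) (by simp)
  have e4 := h.s7 (a := 0) (b := 0) (c := (2:ℂ) • b) (d := (2:ℂ) • q) (by simp) (by simp) (by simp)
    (by simp) (by simp [mul_smul_comm, hb]) (by simp [smul_mul_assoc, hb'])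
    (by simp [mul_smul_comm, q1]) (by simp [smul_mul_assoc, q2])
  simp only [add_zero, zero_add, z] at e3 e4
  rw [e1, h.jord2, e2, e3, add_comm ((2:ℂ) • q), e4]
  have f1 := h.jord2 e q
  have f2 := h.jord2 e b
  have f3 := h.jord2 a q
  have f4 := h.jord2 a b
  rw [q1, q2, add_zero, z] at f1
  rw [hb, hb', zero_add] at f2
  rw [q3, mz' ha' q1, zero_add] at f3
  rw [mz' ha' hb, mz' hb' ha, add_zero, z] at f4
  calc _ = ((1:ℂ)/2) • (φ e * φ ((2:ℂ) • q) + φ ((2:ℂ) • q) * φ e)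
    + ((1:ℂ)/2) • (φ e * φ ((2:ℂ) • b) + φ ((2:ℂ) • b) * φ e)
    + ((1:ℂ)/2) • (φ a * φ ((2:ℂ) • q) + φ ((2:ℂ) • q) * φ a)
    + ((1:ℂ)/2) • (φ a * φ ((2:ℂ) • b) + φ ((2:ℂ) • b) * φ a) := by
        simp only [← smul_add]; congr 1; simp only [add_mul, mul_add]; abel
    _ = _ := by rw [← f1, ← f2, ← f3, ← f4]; abel

theorem s9 (h : JSetup φ e) {a b : R} (ha : e * a = a) (ha' : a * e = a)
    (hb : e * b = b) (hb' : b * e = b) : φ (a + b) = φ a + φ b := by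
  obtain ⟨s, hs⟩ := h.bij.2 (φ a + φ b)
  have z := h.map_zero'
  have h3 := h.t22 (d := s - (a + b)) fun t t1 t2 =>
    h.key hs t (by simp [mz' ha' t1, mz t2 ha, z])
  have h4 := h.r12 h3.1 h3.2 fun t t1 t2 => h.key hs t (by
    rw [mz t2 ha, mz t2 hb, add_zero, add_zero]
    exact h.s8 (el ha) (by simp [er t2]) (el hb) (by simp [er t2]))
  rw [← hs]; congr 1
  exact (sub_eq_zero.1 h4).symm

theorem s9' (h : JSetup φ e) {a b : R} (ha : e * a = 0) (ha' : a * e = 0)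
    (hb : e * b = 0) (hb' : b * e = 0) : φ (a + b) = φ a + φ b := by
  obtain ⟨s, hs⟩ := h.bij.2 (φ a + φ b)
  have z := h.map_zero'
  have h3 := h.t11 (h.key hs e (by simp [ha, ha', z]))
  have h4 := h.r12' h3.1 h3.2 fun t t1 t2 => h.key hs t (by
    rw [mz ha' t1, mz hb' t1, zero_add, zero_add]
    exact h.s8 (el t1) (by simp [er ha']) (el t1) (by simp [er hb']))
  rw [← hs]; congr 1
  exact (sub_eq_zero.1 h4).symm

/-- Peirce decomposition -/
theorem peirce (h : e * e = e) (r : R) : ∃ a b c d : R, r = a + b + c + d ∧ e * a = a ∧ a * e = a ∧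
    e * b = b ∧ b * e = 0 ∧ e * c = 0 ∧ c * e = c ∧ e * d = 0 ∧ d * e = 0 := by
  have k : ∀ x, e * (e * x) = e * x := fun x => by rw [← mul_assoc, h]
  refine ⟨e * r * e, e * r - e * r * e, r * e - e * r * e, r - e * r - r * e + e * r * e,
    by abel, ?_, ?_, ?_, ?_, ?_, ?_, ?_, ?_⟩ <;>
  simp only [mul_sub, sub_mul, mul_add, add_mul, mul_assoc, h, k] <;> abel

theorem additive (h : JSetup φ e) (r s : R) : φ (r + s) = φ r + φ s := by
  obtain ⟨a, b, c, d, rfl, h1, h2, h3, h4, h5, h6, h7, h8⟩ := peirce h.idem r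
  obtain ⟨a', b', c', d', rfl, h1', h2', h3', h4', h5', h6', h7', h8'⟩ := peirce h.idem s
  have : a + b + c + d + (a' + b' + c' + d') = (a + a') + (b + b') + (c + c') + (d + d') := by abel
  rw [this, h.s7 h1 h2 h3 h4 h5 h6 h7 h8, h.s7 h1' h2' h3' h4' h5' h6' h7' h8',
    h.s7 (by rw [mul_add, h1, h1']) (by rw [add_mul, h2, h2']) (by rw [mul_add, h3, h3'])
    (by rw [add_mul, h4, h4', add_zero]) (by rw [mul_add, h5, h5', add_zero])
    (by rw [add_mul, h6, h6']) (by rw [mul_add, h7, h7', add_zero])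
    (by rw [add_mul, h8, h8', add_zero]),
    h.s9 h1 h2 h1' h2', h.s8 h3 h4 h3' h4', h.s8' h5 h6 h5' h6', h.s9' h7 h8 h7' h8']
  abel

end
end JSetup

/-- additive Jordan homomorphisms together with a minimal idempotent -/
structure J2 {R S : Type*} [NonUnitalRing R] [Module ℂ R]
    [NonUnitalRing S] [Module ℂ S] (φ : R → S) (e : R) : Prop where
  inj : Function.Injective φ
  add : ∀ a b : R, φ (a + b) = φ a + φ b
  jord : ∀ a b : R, φ (a * b + b * a) = φ a * φ b + φ b * φ a
  idem : e * e = e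
  ne : e ≠ 0
  min : ∀ r, ∃ c : ℂ, e * r * e = c • e
  qmin : ∀ s, ∃ c : ℂ, φ e * s * φ e = c • φ e

namespace J2
section
variable {R S : Type*} [NonUnitalRing R] [Module ℂ R] [IsScalarTower ℂ R R] [SMulCommClass ℂ R R]
    [NonUnitalRing S] [Module ℂ S] [IsScalarTower ℂ S S] [SMulCommClass ℂ S S]
    {φ : R → S} {e : R}

theorem zero (h : J2 φ e) : φ 0 = 0 := by
  have := h.add 0 0
  simpa using this

theorem half {x y : S} (h : x + x = y + y) : x = y := by
  rw [← sub_eq_zero]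
  apply JSetup.two_tf
  rw [sub_add_sub_comm, h, sub_self]

theorem qidem (h : J2 φ e) : φ e * φ e = φ e := by
  have := h.jord e e
  rw [h.idem, h.add] at this
  exact (half this).symm

theorem qne (h : J2 φ e) : φ e ≠ 0 := fun hh => h.ne (h.inj (hh.trans h.zero.symm))

theorem j11 (h : J2 φ e) {a : R} (h1 : e * a = a) (h2 : a * e = a) :
    φ e * φ a = φ a ∧ φ a * φ e = φ a := by
  have hj := h.jord a e
  rw [h1, h2, h.add] at hj
  have hq := h.qidem
  have k1 := congrArg (φ e * ·) hj
  have k2 := congrArg (· * φ e) hj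
  simp only [mul_add, add_mul, ← mul_assoc, hq] at k1 k2
  rw [mul_assoc (φ a), hq] at k2
  have k1' := add_right_cancel k1
  have k2' := add_left_cancel k2
  have k3 : φ e * φ a = φ a * φ e := by rw [k1', ← k2']
  rw [← k3] at hj
  have := (half hj).symm
  exact ⟨this, k3 ▸ this⟩

theorem j22 (h : J2 φ e) {a : R} (h1 : e * a = 0) (h2 : a * e = 0) :
    φ e * φ a = 0 ∧ φ a * φ e = 0 := by
  have hj := h.jord a e
  rw [h1, h2, add_zero, h.zero] at hj
  have hq := h.qidem
  have k1 := congrArg (φ e * ·) hj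
  have k2 := congrArg (· * φ e) hj
  simp only [mul_add, add_mul, ← mul_assoc, hq, mul_zero, zero_mul] at k1 k2
  rw [mul_assoc (φ a), hq] at k2
  have k3 : φ e * φ a = φ a * φ e := by
    rw [add_comm] at k1
    exact add_right_cancel (k1.symm.trans k2)
  rw [← k3] at hj
  have := JSetup.two_tf hj.symm
  exact ⟨this, k3 ▸ this⟩

/-- square-zero half elements are one sided -/
theorem jhalf (h : J2 φ e) (hp : ∀ a b : S, (∀ r, a * r * b = 0) → a = 0 ∨ b = 0)
    {x : S} (h1 : φ e * x + x * φ e = x) (h2 : x * x = 0) :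
    (φ e * x = x ∧ x * φ e = 0) ∨ (φ e * x = 0 ∧ x * φ e = x) := by
  have hq := h.qidem
  set q := φ e
  have k : q * x * q = 0 := by
    have := congrArg (q * ·) h1
    simp only [mul_add, ← mul_assoc, hq] at this
    simpa using this
  have k2 : x * q * x = 0 := by
    have : x * x = (q * x + x * q) * (q * x + x * q) := by rw [h1]
    rw [h2] at this
    have e2 : (q * x + x * q) * (q * x + x * q) =
      (q * x * q) * x + q * (x * x) * q + x * (q * q) * x + x * (q * x * q) := by
      simp only [mul_add, add_mul, mul_assoc]; abel
    rw [e2, k, h2, hq] at this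
    simpa using this.symm
  have := hp (x * q) (q * x) fun r => by
    obtain ⟨c, hc⟩ := h.qmin r
    calc x * q * r * (q * x) = x * (q * r * q) * x := by simp only [mul_assoc]
      _ = 0 := by rw [hc, mul_smul_comm, smul_mul_assoc, k2, smul_zero]
  rcases this with h0 | h0
  · left; rw [h0, add_zero] at h1; exact ⟨h1, h0⟩
  · right; rw [h0, zero_add] at h1; exact ⟨h0, h1⟩

theorem j12 (h : J2 φ e) (hp : ∀ a b : S, (∀ r, a * r * b = 0) → a = 0 ∨ b = 0)
    {a : R} (h1 : e * a + a * e = a) (h2 : a * a = 0) :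
    (φ e * φ a = φ a ∧ φ a * φ e = 0) ∨ (φ e * φ a = 0 ∧ φ a * φ e = φ a) := by
  apply h.jhalf hp
  · rw [← h.jord, h1]
  · have := h.jord a a
    rw [h2, add_zero, h.zero] at this
    exact JSetup.two_tf this.symm

theorem jall (h : J2 φ e) (hp : ∀ a b : S, (∀ r, a * r * b = 0) → a = 0 ∨ b = 0)
    (U : Set R) (hU : ∀ a ∈ U, ∀ b ∈ U, a + b ∈ U) (h1 : ∀ a ∈ U, e * a + a * e = a)
    (h2 : ∀ a ∈ U, a * a = 0) :
    (∀ a ∈ U, φ e * φ a = φ a ∧ φ a * φ e = 0) ∨ (∀ a ∈ U, φ e * φ a = 0 ∧ φ a * φ e = φ a) := by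
  by_contra! hc
  obtain ⟨⟨a, ha, ha'⟩, ⟨b, hb, hb'⟩⟩ := hc
  have a1 := (h.j12 hp (h1 a ha) (h2 a ha)).resolve_left (fun h => ha' h.1 h.2)
  have b1 := (h.j12 hp (h1 b hb) (h2 b hb)).resolve_right (fun h => hb' h.1 h.2)
  have hab := hU a ha b hb
  rcases h.j12 hp (h1 _ hab) (h2 _ hab) with k | k
  · have := k.2
    rw [h.add, add_mul, b1.2, add_zero, a1.2] at this
    exact ha' (by rw [this, mul_zero]) (by rw [this, zero_mul])
  · have := k.1
    rw [h.add, mul_add, a1.1, zero_add, b1.1] at this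
    exact hb' (by rw [this, mul_zero]) (by rw [this, zero_mul])

theorem dich (h : J2 φ e) (hp : ∀ a b : S, (∀ r, a * r * b = 0) → a = 0 ∨ b = 0)
    (hnz : ∃ a b, e * a = a ∧ a * e = 0 ∧ e * b = 0 ∧ b * e = b ∧ a * b ≠ 0) :
    ((∀ a, e * a = a → a * e = 0 → φ e * φ a = φ a ∧ φ a * φ e = 0) ∧
     (∀ a, e * a = 0 → a * e = a → φ e * φ a = 0 ∧ φ a * φ e = φ a)) ∨
    ((∀ a, e * a = a → a * e = 0 → φ e * φ a = 0 ∧ φ a * φ e = φ a) ∧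
     (∀ a, e * a = 0 → a * e = a → φ e * φ a = φ a ∧ φ a * φ e = 0)) := by
  have A := h.jall hp {a | e * a = a ∧ a * e = 0}
    (by rintro a ⟨h1, h2⟩ b ⟨h3, h4⟩; exact ⟨by rw [mul_add, h1, h3], by rw [add_mul, h2, h4, add_zero]⟩)
    (by rintro a ⟨h1, h2⟩; rw [h1, h2, add_zero])
    (by rintro a ⟨h1, h2⟩; exact JSetup.mz h2 h1)
  have B := h.jall hp {a | e * a = 0 ∧ a * e = a}
    (by rintro a ⟨h1, h2⟩ b ⟨h3, h4⟩; exact ⟨by rw [mul_add, h1, h3, add_zero], by rw [add_mul, h2, h4]⟩)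
    (by rintro a ⟨h1, h2⟩; rw [h1, h2, zero_add])
    (by rintro a ⟨h1, h2⟩; exact JSetup.mz' h2 h1)
  obtain ⟨a, b, a1, a2, b1, b2, hab⟩ := hnz
  have hne : φ a * φ b + φ b * φ a ≠ 0 := by
    rw [← h.jord, ← h.zero]
    intro hh
    have := congrArg (e * ·) (h.inj hh)
    simp only [mul_add, ← mul_assoc, a1, b1, mul_zero] at this
    simp at this
    exact hab this
  rcases A with A | A <;> rcases B with B | B
  · refine absurd ?_ hne
    have x := A a ⟨a1, a2⟩
    have y := B b ⟨b1, b2⟩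
    rw [JSetup.mz x.2 y.1, JSetup.mz y.2 x.1, add_zero]
  · exact Or.inl ⟨fun a h1 h2 => A a ⟨h1, h2⟩, fun a h1 h2 => B a ⟨h1, h2⟩⟩
  · exact Or.inr ⟨fun a h1 h2 => A a ⟨h1, h2⟩, fun a h1 h2 => B a ⟨h1, h2⟩⟩
  · refine absurd ?_ hne
    have x := A a ⟨a1, a2⟩
    have y := B b ⟨b1, b2⟩
    rw [JSetup.mz' x.2 y.1, JSetup.mz' y.2 x.1, add_zero]

theorem exists_hom (h : J2 φ e) : ∃ k : ℂ →+* ℂ, ∀ c : ℂ, φ (c • e) = k c • φ e := by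
  have : ∀ c : ℂ, ∃ d : ℂ, φ (c • e) = d • φ e := by
    intro c
    obtain ⟨d, hd⟩ := h.qmin (φ (c • e))
    have := h.j11 (a := c • e) (by rw [mul_smul_comm, h.idem]) (by rw [smul_mul_assoc, h.idem])
    rw [this.1, this.2] at hd
    exact ⟨d, hd⟩
  choose k hk using this
  have inj : ∀ {c d : ℂ}, c • φ e = d • φ e → c = d := fun hcd => smul_left_injective ℂ h.qne hcd
  refine ⟨{ toFun := k, map_one' := inj ?_, map_mul' := fun c d => inj ?_, map_zero' := inj ?_, map_add' := fun c d => inj ?_}, hk⟩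
  · rw [← hk, one_smul, one_smul]
  · have := h.jord (c • e) (d • e)
    rw [hk, hk] at this
    simp only [smul_mul_assoc, mul_smul_comm, h.idem, h.qidem, smul_smul, mul_comm d c,
      mul_comm (k d) (k c), h.add, hk] at this
    exact half this
  · rw [← hk, zero_smul, zero_smul, h.zero]
  · rw [← hk, add_smul, h.add, hk, hk, add_smul]

theorem proj (h : J2 φ e)
    (H1 : ∀ a, e * a = a → a * e = 0 → φ e * φ a = φ a ∧ φ a * φ e = 0)
    (H2 : ∀ a, e * a = 0 → a * e = a → φ e * φ a = 0 ∧ φ a * φ e = φ a) (r : R) :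
    φ (r * e) = φ r * φ e := by
  obtain ⟨a, b, c, d, rfl, h1, h2, h3, h4, h5, h6, h7, h8⟩ := JSetup.peirce h.idem r
  simp only [add_mul, h2, h4, h6, h8, h.add, h.zero, (h.j11 h1 h2).2, (h.j22 h7 h8).2, (H1 b h3 h4).2,
    (H2 c h5 h6).2]

theorem semi (h : J2 φ e) {k : ℂ →+* ℂ} (hk : ∀ c : ℂ, φ (c • e) = k c • φ e)
    (H2 : ∀ a, e * a = 0 → a * e = a → φ e * φ a = 0 ∧ φ a * φ e = φ a) (r : R) (hr : r * e = r)
    (z : ℂ) : φ (z • r) = k z • φ r := by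
  have e1 : r = e * r * e + (r - e * r * e) := by abel
  obtain ⟨c, hc⟩ := h.min r
  set s := r - e * r * e with hs
  have s1 : e * s = 0 := by
    rw [hs, mul_sub, ← mul_assoc, ← mul_assoc, h.idem, mul_assoc, hr, sub_self]
  have s2 : s * e = s := by
    rw [hs, sub_mul, hr, mul_assoc _ e e, h.idem]
  rw [e1, hc, smul_add, h.add, h.add, smul_smul, hk, hk, map_mul, smul_add, smul_smul]
  congr 1
  have := h.jord s (z • e)
  rw [hk] at this
  simpa [smul_mul_assoc, mul_smul_comm, s1, s2, H2 s s1 s2] using this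

theorem mul (h : J2 φ e) {k : ℂ →+* ℂ} (hk : ∀ c : ℂ, φ (c • e) = k c • φ e)
    (H1 : ∀ a, e * a = a → a * e = 0 → φ e * φ a = φ a ∧ φ a * φ e = 0)
    (H2 : ∀ a, e * a = 0 → a * e = a → φ e * φ a = 0 ∧ φ a * φ e = φ a) (a c : R) (hc : c * e = c) :
    φ (a * c) = φ a * φ c := by
  have pr := h.proj H1 H2
  have hc' : φ c * φ e = φ c := by rw [← pr, hc]
  have step : ∀ d, d * e = d → φ (c * d) = φ c * φ d := by
    intro d hd
    obtain ⟨m, hm⟩ := h.min d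
    have e1 : c * d = m • c := by
      calc c * d = c * (e * d * e) := by rw [mul_assoc e, hd, ← mul_assoc, hc]
        _ = _ := by rw [hm, mul_smul_comm, hc]
    have hd' : φ d * φ e = φ d := by rw [← pr, hd]
    have e2 : φ e * φ d = k m • φ e := by
      rw [← hk, ← hm, mul_assoc, hd]
      have q1 : e * (e * d) = e * d := by rw [← mul_assoc, h.idem]
      have q2 : (e * d) * e = e * d := by rw [mul_assoc, hd]
      have q3 : e * (d - e * d) = 0 := by rw [mul_sub, q1, sub_self]
      have q4 : (d - e * d) * e = d - e * d := by rw [sub_mul, q2, hd]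
      have : φ d = φ (e * d) + φ (d - e * d) := by rw [← h.add]; congr 1; abel
      rw [this, mul_add, (h.j11 q1 q2).1, (H2 _ q3 q4).1, add_zero]
    rw [e1, h.semi hk H2 c hc, ← hc', mul_assoc, e2, mul_smul_comm, hc']
  have e3 := congrArg φ (show (a * c + c * a) * e = a * c + c * (a * e) by
    rw [add_mul, mul_assoc, hc, mul_assoc])
  rw [pr, h.jord, h.add, step _ (by rw [mul_assoc, h.idem]), pr, add_mul, mul_assoc, hc',
    mul_assoc] at e3
  exact (add_right_cancel e3).symm

theorem op (h : J2 φ e) : J2 (fun r : Rᵐᵒᵖ => φ r.unop) (MulOpposite.op e) where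
  inj := fun a b hab => MulOpposite.unop_injective (h.inj hab)
  add := fun a b => h.add _ _
  jord := fun a b => by
    simp only [MulOpposite.unop_add, MulOpposite.unop_mul]
    rw [h.jord]; abel
  idem := by rw [← MulOpposite.op_mul, h.idem]
  ne := by simpa using h.ne
  min := fun r => by
    obtain ⟨c, hc⟩ := h.min r.unop
    refine ⟨c, ?_⟩
    apply MulOpposite.unop_injective
    simpa [mul_assoc] using hc
  qmin := h.qmin

end

/-- Summary of the algebraic part. -/
theorem main {R S : Type*} [NonUnitalRing R] [Module ℂ R] [IsScalarTower ℂ R R] [SMulCommClass ℂ R R]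
    [NonUnitalRing S] [Module ℂ S] [IsScalarTower ℂ S S] [SMulCommClass ℂ S S]
    {φ : R → S} {e : R} (h : J2 φ e) (hp : ∀ a b : S, (∀ r, a * r * b = 0) → a = 0 ∨ b = 0)
    (hnz : ∃ a b, e * a = a ∧ a * e = 0 ∧ e * b = 0 ∧ b * e = b ∧ a * b ≠ 0) :
    ∃ k : ℂ →+* ℂ,
    ((∀ r, φ (r * e) = φ r * φ e) ∧ (∀ r, r * e = r → ∀ z : ℂ, φ (z • r) = k z • φ r) ∧
      ∀ a c, c * e = c → φ (a * c) = φ a * φ c) ∨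
    ((∀ r, φ (e * r) = φ r * φ e) ∧ (∀ r, e * r = r → ∀ z : ℂ, φ (z • r) = k z • φ r) ∧
      ∀ a c, e * c = c → φ (c * a) = φ a * φ c) := by
  obtain ⟨k, hk⟩ := h.exists_hom
  refine ⟨k, ?_⟩
  rcases h.dich hp hnz with ⟨A, B⟩ | ⟨A, B⟩
  · exact Or.inl ⟨h.proj A B, h.semi hk B, h.mul hk A B⟩
  · right
    have H1 : ∀ a : Rᵐᵒᵖ, MulOpposite.op e * a = a → a * MulOpposite.op e = 0 →
        φ e * φ a.unop = φ a.unop ∧ φ a.unop * φ e = 0 := fun a h1 h2 =>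
      B a.unop (congrArg MulOpposite.unop h2) (congrArg MulOpposite.unop h1)
    have H2 : ∀ a : Rᵐᵒᵖ, MulOpposite.op e * a = 0 → a * MulOpposite.op e = a →
        φ e * φ a.unop = 0 ∧ φ a.unop * φ e = φ a.unop := fun a h1 h2 =>
      A a.unop (congrArg MulOpposite.unop h2) (congrArg MulOpposite.unop h1)
    have ho := h.op
    refine ⟨fun r => ho.proj H1 H2 (MulOpposite.op r), fun r hr z => ?_, fun a c hc => ?_⟩
    · exact ho.semi (k := k) hk H2 (MulOpposite.op r) (congrArg MulOpposite.op hr) z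
    · exact ho.mul (k := k) hk H1 H2 (MulOpposite.op a) (MulOpposite.op c) (congrArg MulOpposite.op hc)

end J2

/-- biorthogonal sequences in infinite dimensional normed spaces -/
theorem exists_biorth {X : Type*} [NormedAddCommGroup X] [NormedSpace ℂ X]
    (hX : ¬ FiniteDimensional ℂ X) :
    ∃ p : ℕ → X × (X →L[ℂ] ℂ), (∀ n, (p n).2 (p n).1 = 1) ∧
      ∀ m n, m ≠ n → (p m).2 (p n).1 = 0 := by
  have key : ∀ s : Finset (X × (X →L[ℂ] ℂ)), ∃ y : X × (X →L[ℂ] ℂ), y.2 y.1 = 1 ∧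
      ∀ x ∈ s, x.2 y.1 = 0 ∧ y.2 x.1 = 0 := by
    classical
    intro s
    let W : Submodule ℂ X := Submodule.span ℂ ((s.image Prod.fst : Finset X) : Set X)
    have hWf : FiniteDimensional ℂ W := FiniteDimensional.span_finset ℂ _
    have hWc : IsClosed (W : Set X) := Submodule.closed_of_finiteDimensional W
    let L : X →ₗ[ℂ] (s → ℂ) := LinearMap.pi fun i => (i.1.2 : X →ₗ[ℂ] ℂ)
    have hx : ∃ x, x ∈ LinearMap.ker L ∧ x ∉ W := by
      by_contra! hc
      apply hX
      have hle : LinearMap.ker L ≤ W := hc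
      have h1 : FiniteDimensional ℂ (LinearMap.ker L) := Submodule.finiteDimensional_of_le hle
      have h2 : FiniteDimensional ℂ (X ⧸ LinearMap.ker L) :=
        Module.Finite.equiv L.quotKerEquivRange.symm
      exact Module.Finite.of_submodule_quotient (LinearMap.ker L)
    obtain ⟨x, hxL, hxW⟩ := hx
    have hne : W.mkQ x ≠ 0 := by simpa using hxW
    obtain ⟨f, hf⟩ := SeparatingDual.exists_eq_one (R := ℂ) hne
    refine ⟨(x, f.comp W.mkQL), hf, fun q hq => ⟨?_, ?_⟩⟩
    · have := congrFun (LinearMap.mem_ker.1 hxL) ⟨q, hq⟩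
      simpa [L] using this
    · have hqW : q.1 ∈ W := Submodule.subset_span (by
        simp only [Finset.coe_image]; exact ⟨q, hq, rfl⟩)
      have : W.mkQ q.1 = 0 := by simpa using hqW
      change f (W.mkQ q.1) = 0
      rw [this, map_zero]
  obtain ⟨p, hp1, hp2⟩ := exists_seq_of_forall_finset_exists
    (fun y : X × (X →L[ℂ] ℂ) => y.2 y.1 = 1) (fun x y => x.2 y.1 = 0 ∧ y.2 x.1 = 0)
    (fun s _ => key s)
  refine ⟨p, hp1, fun m n hmn => ?_⟩
  rcases lt_or_gt_of_ne hmn with h | h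
  · exact (hp2 m n h).1
  · exact (hp2 n m h).2

theorem ringHom_cont {E F ι : Type*} [NormedAddCommGroup E] [NormedSpace ℂ E] [CompleteSpace E]
    [NormedAddCommGroup F] [NormedSpace ℂ F] (k : ℂ →+* ℂ) (T : E → F)
    (u : ι → E →L[ℂ] ℂ) (g : ι → F →L[ℂ] ℂ) (hg : ∀ i x, g i (T x) = k (u i x))
    (v : ℕ → E) (j : ℕ → ι) (hv1 : ∀ n, u (j n) (v n) = 1)
    (hv0 : ∀ m n, m ≠ n → u (j m) (v n) = 0) : Continuous k := by
  by_contra hk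
  have hex : ∀ ε > 0, ∀ M : ℝ, ∃ z : ℂ, ‖z‖ < ε ∧ M < ‖k z‖ := by
    intro ε hε M
    by_contra! hc
    apply hk
    refine AddMonoidHom.continuous_of_isBounded_nhds_zero (k : ℂ →+ ℂ)
      (Metric.ball_mem_nhds 0 hε) ?_
    rw [isBounded_iff_forall_norm_le]
    refine ⟨M, ?_⟩
    rintro _ ⟨z, hz, rfl⟩
    exact hc z (by simpa using hz)
  have hpos : ∀ n, 0 < (1/2:ℝ)^n / (1 + ‖v n‖) := fun n => by positivity
  choose z hz1 hz2 using fun n : ℕ => hex _ (hpos n) (n * (1 + ‖g (j n)‖))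
  have hsum : Summable fun n => z n • v n := by
    refine Summable.of_norm_bounded summable_geometric_two fun n => ?_
    rw [norm_smul]
    have := (lt_div_iff₀ (by positivity : 0 < 1 + ‖v n‖)).1 (hz1 n)
    nlinarith [norm_nonneg (z n), norm_nonneg (v n)]
  set x := ∑' n, z n • v n with hx
  have hux : ∀ n, u (j n) x = z n := by
    intro n
    rw [hx, ContinuousLinearMap.map_tsum _ hsum, tsum_eq_single n]
    · simp [hv1]
    · intro m hm
      simp [hv0 n m hm.symm]
  obtain ⟨n, hn⟩ := exists_nat_gt ‖T x‖
  have h1 := hz2 n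
  rw [← hux n, ← hg] at h1
  have h2 := (g (j n)).le_opNorm (T x)
  nlinarith [norm_nonneg (g (j n)), norm_nonneg (T x)]

theorem closed_graph_aux {E F : Type*} [NormedAddCommGroup E] [NormedSpace ℝ E] [CompleteSpace E]
    [NormedAddCommGroup F] [NormedSpace ℝ F] [CompleteSpace F] (f : E →ₗ[ℝ] F) (C : Set (E × F))
    (hC : IsClosed C) (h : ∀ p : E × F, p ∈ C ↔ p.2 = f p.1) : Continuous f := by
  apply LinearMap.continuous_of_isClosed_graph
  convert hC using 1
  ext p
  rw [h]; simp

theorem semilinear_cont {E F ι : Type*} [NormedAddCommGroup E] [NormedSpace ℂ E] [CompleteSpace E]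
    [NormedAddCommGroup F] [NormedSpace ℂ F] [CompleteSpace F] (k : ℂ →+* ℂ) (T : E ≃+ F)
    (hT : ∀ (z : ℂ) x, T (z • x) = k z • T x)
    (u : ι → E →L[ℂ] ℂ) (g : ι → F →L[ℂ] ℂ) (hg : ∀ i x, g i (T x) = k (u i x))
    (hsep : ∀ x, (∀ i, u i x = 0) → x = 0)
    (v : ℕ → E) (j : ℕ → ι) (hv1 : ∀ n, u (j n) (v n) = 1)
    (hv0 : ∀ m n, m ≠ n → u (j m) (v n) = 0) :
    (∃ T' : E ≃L[ℂ] F, ∀ x, T' x = T x) ∨ (∃ T' : E ≃SL[starRingEnd ℂ] F, ∀ x, T' x = T x) := by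
  have hk := ringHom_cont k T u g hg v j hv1 hv0
  have hkk := Complex.ringHom_eq_id_or_conj_of_continuous hk
  have hkr : ∀ r : ℝ, k r = r := by
    intro r
    rcases hkk with h | h <;> simp [h]
  let TR : E ≃ₗ[ℝ] F :=
    { T with
      map_smul' := fun r x => by
        have := hT r x
        rw [hkr] at this
        simpa using this }
  have hTR : ∀ x, TR x = T x := fun _ => rfl
  let C : Set (E × F) := ⋂ i, {p | g i p.2 = k (u i p.1)}
  have hC : IsClosed C := isClosed_iInter fun i => isClosed_eq (by fun_prop) (by fun_prop)
  have hCm : ∀ p : E × F, p ∈ C ↔ p.2 = T p.1 := by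
    rintro ⟨x, y⟩
    simp only [C, Set.mem_iInter, Set.mem_ofPred_eq]
    constructor
    · intro h
      obtain ⟨x', rfl⟩ := T.surjective y
      congr 1
      rw [← sub_eq_zero]
      apply hsep
      intro i
      rw [map_sub, sub_eq_zero]
      apply k.injective
      rw [← hg, h]
    · rintro rfl i
      exact hg i x
  have c1 : Continuous T := closed_graph_aux TR.toLinearMap C hC hCm
  have c2 : Continuous T.symm := by
    refine closed_graph_aux TR.symm.toLinearMap (Prod.swap ⁻¹' C) (hC.preimage continuous_swap) ?_
    rintro ⟨y, x⟩
    change (x, y) ∈ C ↔ x = TR.symm y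
    rw [hCm, ← hTR, LinearEquiv.eq_symm_apply]
    exact eq_comm
  rcases hkk with h | h
  · left
    exact ⟨{ T with
      map_smul' := fun r x => by simpa [h] using hT r x
      continuous_toFun := c1
      continuous_invFun := c2 }, fun _ => rfl⟩
  · right
    exact ⟨{ T with
      map_smul' := fun r x => by simpa [h] using hT r x
      continuous_toFun := c1
      continuous_invFun := c2 }, fun _ => rfl⟩

section std
variable {X : Type*} [NormedAddCommGroup X] [NormedSpace ℂ X]

/-- The property of being a standard operator algebra. -/
def IsStd (𝒜 : NonUnitalSubalgebra ℂ (X →L[ℂ] X)) : Prop :=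
  ∀ T : X →L[ℂ] X, FiniteDimensional ℂ (LinearMap.range (T : X →ₗ[ℂ] X)) → T ∈ 𝒜

theorem IsStd.mem {𝒜 : NonUnitalSubalgebra ℂ (X →L[ℂ] X)} (h : IsStd 𝒜) (x : X) (f : X →L[ℂ] ℂ) :
    f.smulRight x ∈ 𝒜 := by
  apply h
  have : LinearMap.range ((f.smulRight x : X →L[ℂ] X) : X →ₗ[ℂ] X) ≤ Submodule.span ℂ {x} := by
    rintro _ ⟨z, rfl⟩
    exact Submodule.smul_mem _ _ (Submodule.mem_span_singleton_self x)
  exact Submodule.finiteDimensional_of_le this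

/-- rank one operators as elements of a standard operator algebra -/
noncomputable def IsStd.ro {𝒜 : NonUnitalSubalgebra ℂ (X →L[ℂ] X)} (h : IsStd 𝒜) (x : X) (f : X →L[ℂ] ℂ) : 𝒜 :=
  ⟨f.smulRight x, h.mem x f⟩

@[simp] theorem IsStd.ro_apply {𝒜 : NonUnitalSubalgebra ℂ (X →L[ℂ] X)} (h : IsStd 𝒜) (x : X)
    (f : X →L[ℂ] ℂ) (z : X) : (h.ro x f : X →L[ℂ] X) z = f z • x := rfl

theorem ext_std {𝒜 : NonUnitalSubalgebra ℂ (X →L[ℂ] X)} {a b : 𝒜}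
    (h : ∀ z, (a : X →L[ℂ] X) z = (b : X →L[ℂ] X) z) : a = b :=
  Subtype.ext (ContinuousLinearMap.ext h)

theorem app_std {𝒜 : NonUnitalSubalgebra ℂ (X →L[ℂ] X)} {a b : 𝒜}
    (h : a = b) (z : X) : (a : X →L[ℂ] X) z = (b : X →L[ℂ] X) z := by rw [h]

@[simp] theorem mul_std {𝒜 : NonUnitalSubalgebra ℂ (X →L[ℂ] X)} (a b : 𝒜) (z : X) :
    ((a * b : 𝒜) : X →L[ℂ] X) z = (a : X →L[ℂ] X) ((b : X →L[ℂ] X) z) := rfl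

@[simp] theorem smul_std {𝒜 : NonUnitalSubalgebra ℂ (X →L[ℂ] X)} (a : 𝒜) (c : ℂ) (z : X) :
    ((c • a : 𝒜) : X →L[ℂ] X) z = c • (a : X →L[ℂ] X) z := rfl

@[simp] theorem add_std {𝒜 : NonUnitalSubalgebra ℂ (X →L[ℂ] X)} (a b : 𝒜) (z : X) :
    ((a + b : 𝒜) : X →L[ℂ] X) z = (a : X →L[ℂ] X) z + (b : X →L[ℂ] X) z := rfl

@[simp] theorem zero_std {𝒜 : NonUnitalSubalgebra ℂ (X →L[ℂ] X)} (z : X) :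
    ((0 : 𝒜) : X →L[ℂ] X) z = 0 := rfl

theorem IsStd.prime {𝒜 : NonUnitalSubalgebra ℂ (X →L[ℂ] X)} (h : IsStd 𝒜) (a b : 𝒜)
    (hab : ∀ r, a * r * b = 0) : a = 0 ∨ b = 0 := by
  by_contra! hc
  obtain ⟨ha, hb⟩ := hc
  apply ha
  apply ext_std
  intro z
  have : ∃ y, (b : X →L[ℂ] X) y ≠ 0 := by
    by_contra! hc
    exact hb (ext_std hc)
  obtain ⟨y, hy⟩ := this
  obtain ⟨f, hf⟩ := SeparatingDual.exists_eq_one (R := ℂ) hy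
  have := app_std (hab (h.ro z f)) y
  simpa [hf] using this

theorem IsStd.lu12 {𝒜 : NonUnitalSubalgebra ℂ (X →L[ℂ] X)} (h : IsStd 𝒜) (x0 : X) (f0 : X →L[ℂ] ℂ)
    (h0 : f0 x0 = 1) (a : 𝒜) (h1 : h.ro x0 f0 * a = a) (h2 : a * h.ro x0 f0 = 0) :
    ∃ q, h.ro x0 f0 * q = 0 ∧ q * h.ro x0 f0 = 0 ∧ a * q = a := by
  by_cases ha : a = 0
  · exact ⟨0, by simp, by simp, by simp [ha]⟩
  have e1 : ∀ z, (a : X →L[ℂ] X) z = f0 ((a : X →L[ℂ] X) z) • x0 := fun z => (app_std h1 z).symm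
  have e2 : (a : X →L[ℂ] X) x0 = 0 := by
    have := app_std h2 x0
    simpa [h0] using this
  have : ∃ y, f0 ((a : X →L[ℂ] X) y) ≠ 0 := by
    by_contra! hc
    exact ha (ext_std fun z => by rw [e1, hc]; simp)
  obtain ⟨y, hy⟩ := this
  set c := f0 ((a : X →L[ℂ] X) y) with hc
  refine ⟨h.ro (c⁻¹ • (y - f0 y • x0)) (f0.comp (a : X →L[ℂ] X)), ?_, ?_, ?_⟩
  · apply ext_std; intro z; simp [h0]
  · apply ext_std; intro z; simp [e2]
  · apply ext_std; intro z
    have : (a : X →L[ℂ] X) y = c • x0 := e1 y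
    simp only [mul_std, IsStd.ro_apply, map_smul, map_sub, e2, smul_zero, sub_zero, this,
      ContinuousLinearMap.comp_apply]
    rw [inv_smul_smul₀ hy, ← e1]

theorem IsStd.lu21 {𝒜 : NonUnitalSubalgebra ℂ (X →L[ℂ] X)} (h : IsStd 𝒜) (x0 : X) (f0 : X →L[ℂ] ℂ)
    (h0 : f0 x0 = 1) (a : 𝒜) (h1 : h.ro x0 f0 * a = 0) (h2 : a * h.ro x0 f0 = a) :
    ∃ q, h.ro x0 f0 * q = 0 ∧ q * h.ro x0 f0 = 0 ∧ q * a = a := by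
  have e1 : ∀ z, (a : X →L[ℂ] X) z = f0 z • (a : X →L[ℂ] X) x0 := fun z => by
    have := (app_std h2 z).symm
    simpa using this
  set y := (a : X →L[ℂ] X) x0 with hy
  by_cases ha : y = 0
  · refine ⟨0, by simp, by simp, ?_⟩
    apply ext_std; intro z; rw [e1 z, ha]; simp
  have x00 : x0 ≠ 0 := by rintro rfl; simp at h0
  have e2 : f0 y = 0 := by
    have := app_std h1 x0
    simpa [x00] using this
  obtain ⟨w, hw⟩ := SeparatingDual.exists_eq_one (R := ℂ) ha
  refine ⟨h.ro y (w - w x0 • f0), ?_, ?_, ?_⟩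
  · apply ext_std; intro z; simp [e2]
  · apply ext_std; intro z; simp [h0]
  · apply ext_std; intro z
    simp [e1 z, hw, e2]

theorem q11 {S : Type*} [NonUnitalRing S] [Module ℂ S] {q x : S} (hq : q * q = q)
    (hj : x + x = x * q + q * x) : q * x = x ∧ x * q = x := by
  have k1 := congrArg (q * ·) hj
  have k2 := congrArg (· * q) hj
  simp only [mul_add, add_mul, ← mul_assoc, hq] at k1 k2
  rw [mul_assoc x, hq] at k2
  have k1' := add_right_cancel k1
  have k2' := add_left_cancel k2
  have k3 : q * x = x * q := by rw [k1', ← k2']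
  rw [← k3] at hj
  have h4 : x - q * x = 0 := JSetup.two_tf (by rw [sub_add_sub_comm, hj, sub_self])
  have := (sub_eq_zero.1 h4).symm
  exact ⟨this, k3 ▸ this⟩

end std

set_option maxHeartbeats 4000000 in
/-- **Theorem 1 (infinite-dimensional case).** Bijective solutions of the Jordan
equation `φ((1/2)(AB+BA)) = (1/2)(φ(A)φ(B)+φ(B)φ(A))` between standard operator
algebras on complex Banach spaces, `X` infinite dimensional, are implemented by an
invertible bounded linear or conjugate-linear operator, either directly or via the
Banach space adjoint. -/
theorem jordan_maps_standard_operator_algebras_infinite_dim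
    {X Y : Type*} [NormedAddCommGroup X] [NormedSpace ℂ X] [CompleteSpace X]
    [NormedAddCommGroup Y] [NormedSpace ℂ Y] [CompleteSpace Y]
    (hX : ¬ FiniteDimensional ℂ X)
    (𝒜 : NonUnitalSubalgebra ℂ (X →L[ℂ] X)) (ℬ : NonUnitalSubalgebra ℂ (Y →L[ℂ] Y))
    (h𝒜 : ∀ T : X →L[ℂ] X, FiniteDimensional ℂ (LinearMap.range (T : X →ₗ[ℂ] X)) → T ∈ 𝒜)
    (hℬ : ∀ S : Y →L[ℂ] Y, FiniteDimensional ℂ (LinearMap.range (S : Y →ₗ[ℂ] Y)) → S ∈ ℬ)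
    (φ : 𝒜 → ℬ) (hbij : Function.Bijective φ)
    (hJ : ∀ A B : 𝒜, φ (((1:ℂ)/2) • (A * B + B * A))
        = ((1:ℂ)/2) • (φ A * φ B + φ B * φ A)) :
    (∃ T : X ≃L[ℂ] Y, ∀ A : 𝒜, ∀ y : Y,
        (φ A : Y →L[ℂ] Y) y = T ((A : X →L[ℂ] X) (T.symm y))) ∨
    (∃ T : X ≃SL[starRingEnd ℂ] Y, ∀ A : 𝒜, ∀ y : Y,
        (φ A : Y →L[ℂ] Y) y = T ((A : X →L[ℂ] X) (T.symm y))) ∨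
    (∃ T : (X →L[ℂ] ℂ) ≃L[ℂ] Y, ∀ A : 𝒜, ∀ y : Y,
        (φ A : Y →L[ℂ] Y) y = T ((T.symm y).comp (A : X →L[ℂ] X))) ∨
    (∃ T : (X →L[ℂ] ℂ) ≃SL[starRingEnd ℂ] Y, ∀ A : 𝒜, ∀ y : Y,
        (φ A : Y →L[ℂ] Y) y = T ((T.symm y).comp (A : X →L[ℂ] X))) := by
  have sA : IsStd 𝒜 := h𝒜
  have sB : IsStd ℬ := hℬ
  obtain ⟨p, hp1, hp0⟩ := exists_biorth hX
  obtain ⟨x0, f0, hx0, hf0⟩ : ∃ x f, x = (p 0).1 ∧ f = (p 0).2 := ⟨_, _, rfl, rfl⟩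
  obtain ⟨x1, f1, hx1, hf1⟩ : ∃ x f, x = (p 1).1 ∧ f = (p 1).2 := ⟨_, _, rfl, rfl⟩
  have f00 : f0 x0 = 1 := by rw [hf0, hx0]; exact hp1 0
  have f11 : f1 x1 = 1 := by rw [hf1, hx1]; exact hp1 1
  have f01 : f0 x1 = 0 := by rw [hf0, hx1]; exact hp0 0 1 (by simp)
  have f10 : f1 x0 = 0 := by rw [hf1, hx0]; exact hp0 1 0 (by simp)
  have x0ne : x0 ≠ 0 := by rintro rfl; simp at f00
  have x1ne : x1 ≠ 0 := by rintro rfl; simp at f11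
  have f0ne : f0 ≠ 0 := by rintro rfl; simp at f00
  obtain ⟨e, he⟩ : ∃ e, e = sA.ro x0 f0 := ⟨_, rfl⟩
  have eap : ∀ z, (e : X →L[ℂ] X) z = f0 z • x0 := fun z => by rw [he]; rfl
  have hidem : e * e = e := by apply ext_std; intro z; simp [eap, f00]
  have hne : e ≠ 0 := fun h => x0ne (by simpa [eap, f00] using app_std h x0)
  have JS : JSetup φ e :=
    { bij := hbij
      jord := hJ
      idem := hidem
      prime := sA.prime
      ne := hne
      nt := by
        refine ⟨sA.ro x1 f1, fun h => x1ne (by simpa [f11] using app_std h x1), ?_, ?_⟩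
        · apply ext_std; intro z; simp [eap, f01]
        · apply ext_std; intro z; simp [eap, f10]
      lu12 := by rw [he]; exact sA.lu12 x0 f0 f00
      lu21 := by rw [he]; exact sA.lu21 x0 f0 f00 }
  have hadd := JS.additive
  have hz := JS.map_zero'
  have hJ' : ∀ a b, φ (a * b + b * a) = φ a * φ b + φ b * φ a := by
    intro a b
    have h1 := hJ a b
    have h2 : ∀ {S : Type _} [AddCommGroup S] [Module ℂ S] (x : S),
        x = ((1:ℂ)/2) • x + ((1:ℂ)/2) • x := by
      intro S _ _ x
      rw [← add_smul]; norm_num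
    rw [h2 (a * b + b * a), hadd, h1, ← add_smul]
    norm_num
  have hmin : ∀ r : 𝒜, ∃ c : ℂ, e * r * e = c • e := fun r =>
    ⟨f0 ((r : X →L[ℂ] X) x0), by
      apply ext_std; intro z; simp [eap, smul_smul, mul_comm]⟩
  -- the image of `e` has rank one
  have qq : φ e * φ e = φ e := by
    have := hJ' e e
    rw [hidem, hadd] at this
    exact (J2.half this).symm
  have qne : φ e ≠ 0 := fun h => hne (hbij.1 (h.trans hz.symm))
  obtain ⟨y0, g0, gy, hQ⟩ : ∃ (y0 : Y) (g0 : Y →L[ℂ] ℂ), g0 y0 = 1 ∧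
      ∀ y, (φ e : Y →L[ℂ] Y) y = g0 y • y0 := by
    have : ∃ y, (φ e : Y →L[ℂ] Y) y ≠ 0 := by
      by_contra! hc
      exact qne (ext_std hc)
    obtain ⟨y, hy⟩ := this
    obtain ⟨g, hg⟩ := SeparatingDual.exists_eq_one (R := ℂ) hy
    obtain ⟨y0, hy0⟩ : ∃ y0, y0 = (φ e : Y →L[ℂ] Y) y := ⟨_, rfl⟩
    have Qy0 : (φ e : Y →L[ℂ] Y) y0 = y0 := by rw [hy0]; exact app_std qq y
    have QQ : ∀ z, (φ e : Y →L[ℂ] Y) ((φ e : Y →L[ℂ] Y) z) = (φ e : Y →L[ℂ] Y) z :=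
      fun z => app_std qq z
    rw [← hy0] at hg hy
    obtain ⟨Q1, hQ1⟩ : ∃ Q1, Q1 = sB.ro y0 (g.comp (φ e : Y →L[ℂ] Y)) := ⟨_, rfl⟩
    have Q1a : ∀ z, (Q1 : Y →L[ℂ] Y) z = g ((φ e : Y →L[ℂ] Y) z) • y0 := fun z => by rw [hQ1]; rfl
    have a1 : φ e * Q1 = Q1 := by apply ext_std; intro z; simp [Q1a, Qy0]
    have a2 : Q1 * φ e = Q1 := by apply ext_std; intro z; simp [Q1a, QQ]
    have a3 : Q1 * Q1 = Q1 := by apply ext_std; intro z; simp [Q1a, Qy0, hg]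
    obtain ⟨A, hA⟩ := hbij.2 Q1
    have b1 : A + A = A * e + e * A := by
      apply hbij.1
      rw [hJ', hadd, hA, a1, a2]
    have b2 : A * A = A := by
      apply J2.half
      apply hbij.1
      rw [hJ', hadd, hA, a3]
    obtain ⟨c1, c2⟩ := q11 hidem b1
    obtain ⟨c, hc⟩ := hmin A
    rw [c1, c2] at hc
    have hcc : c * c = c := by
      rw [hc] at b2
      simp only [smul_mul_assoc, mul_smul_comm, hidem, smul_smul] at b2
      exact smul_left_injective ℂ hne b2
    have hc1 : c = 1 := by
      have : c * (c - 1) = 0 := by rw [mul_sub, hcc]; ring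
      rcases mul_eq_zero.1 this with h | h
      · exfalso
        rw [h, zero_smul] at hc
        rw [hc, hz] at hA
        have := app_std hA y0
        rw [Q1a, Qy0, hg] at this
        exact hy (by simpa using this.symm)
      · exact sub_eq_zero.1 h
    rw [hc1, one_smul] at hc
    rw [hc] at hA
    refine ⟨y0, g.comp (φ e : Y →L[ℂ] Y), by simp [Qy0, hg], fun z => ?_⟩
    have := app_std hA z
    rw [this, Q1a]; rfl
  have HJ2 : J2 φ e :=
    { inj := hbij.1
      add := hadd
      jord := hJ'
      idem := hidem
      ne := hne
      min := hmin
      qmin := fun s => ⟨g0 ((s : Y →L[ℂ] Y) y0), by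
        apply ext_std; intro z; simp [hQ, smul_smul, mul_comm]⟩ }
  have y0ne : y0 ≠ 0 := by rintro rfl; simp at gy
  have Qy0 : (φ e : Y →L[ℂ] Y) y0 = y0 := by rw [hQ, gy, one_smul]
  obtain ⟨k, H⟩ := HJ2.main sB.prime (by
    refine ⟨sA.ro x0 f1, sA.ro x1 f0, ?_, ?_, ?_, ?_, ?_⟩
    · apply ext_std; intro z; simp [eap, f00]
    · apply ext_std; intro z; simp [eap, f10]
    · apply ext_std; intro z; simp [eap, f01]
    · apply ext_std; intro z; simp [eap, f00]
    · intro h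
      apply x0ne
      simpa [f00, f11] using app_std h x0)
  rcases H with ⟨Hp, Hs, Hm⟩ | ⟨Hp, Hs, Hm⟩
  · have roe : ∀ x, sA.ro x f0 * e = sA.ro x f0 := fun x => by
      apply ext_std; intro z; simp [eap, f00]
    have Aro : ∀ (A : 𝒜) x, A * sA.ro x f0 = sA.ro ((A : X →L[ℂ] X) x) f0 := fun A x => by
      apply ext_std; intro z; simp
    let T0 : X →+ Y :=
      { toFun := fun x => (φ (sA.ro x f0) : Y →L[ℂ] Y) y0
        map_zero' := by
          have : sA.ro (0 : X) f0 = 0 := by apply ext_std; intro z; simp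
          rw [this, hz]; rfl
        map_add' := fun x y => by
          have : sA.ro (x + y) f0 = sA.ro x f0 + sA.ro y f0 := by apply ext_std; intro z; simp
          rw [this, hadd]; rfl }
    have T0d : ∀ x, T0 x = (φ (sA.ro x f0) : Y →L[ℂ] Y) y0 := fun _ => rfl
    have Tinj : Function.Injective T0 := by
      rw [injective_iff_map_eq_zero]
      intro x hx
      rw [T0d] at hx
      have h1 : φ (sA.ro x f0) = φ 0 := by
        rw [← roe x, Hp, hz]
        apply ext_std; intro z; simp [hQ, hx]
      simpa [f00] using app_std (hbij.1 h1) x0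
    have Tsurj : Function.Surjective T0 := by
      intro y
      obtain ⟨A, hA⟩ := hbij.2 (sB.ro y g0)
      refine ⟨(A : X →L[ℂ] X) x0, ?_⟩
      rw [T0d, ← Aro, ← he, Hp, hA]
      simp [Qy0, gy]
    have TA : ∀ (A : 𝒜) x, T0 ((A : X →L[ℂ] X) x) = (φ A : Y →L[ℂ] Y) (T0 x) := by
      intro A x
      rw [T0d, ← Aro, Hm _ _ (roe x)]; rfl
    have Tsm : ∀ (z : ℂ) x, T0 (z • x) = k z • T0 x := by
      intro z x
      have : sA.ro (z • x) f0 = z • sA.ro x f0 := by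
        apply ext_std; intro w; simp [smul_smul, mul_comm]
      rw [T0d, this, Hs _ (roe x)]; rfl
    have Tx0 : T0 x0 ≠ 0 := fun h => x0ne (Tinj (by rw [h, map_zero]))
    obtain ⟨w, hw⟩ := SeparatingDual.exists_eq_one (R := ℂ) Tx0
    have := semilinear_cont k (AddEquiv.ofBijective T0 ⟨Tinj, Tsurj⟩) Tsm
      (fun f : X →L[ℂ] ℂ => f) (fun f => w.comp (φ (sA.ro x0 f) : Y →L[ℂ] Y))
      (by
        intro f x
        change w ((φ (sA.ro x0 f) : Y →L[ℂ] Y) (T0 x)) = k (f x)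
        rw [← TA, sA.ro_apply, Tsm, map_smul, hw, smul_eq_mul, mul_one])
      (fun x hx => SeparatingDual.eq_zero_of_forall_dual_eq_zero (R := ℂ) hx)
      (fun n => (p n).1) (fun n => (p n).2) hp1 hp0
    rcases this with ⟨T', hT'⟩ | ⟨T', hT'⟩
    · left
      refine ⟨T', fun A y => ?_⟩
      have hT : ∀ x, T' x = T0 x := hT'
      rw [hT, TA, ← hT, T'.apply_symm_apply]
    · right; left
      refine ⟨T', fun A y => ?_⟩
      have hT : ∀ x, T' x = T0 x := hT'
      rw [hT, TA, ← hT, T'.apply_symm_apply]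
  · have roe : ∀ f, e * sA.ro x0 f = sA.ro x0 f := fun f => by
      apply ext_std; intro z; simp [eap, f00]
    have Aro : ∀ (A : 𝒜) f, sA.ro x0 f * A = sA.ro x0 (f.comp (A : X →L[ℂ] X)) := fun A x => by
      apply ext_std; intro z; simp
    let T0 : (X →L[ℂ] ℂ) →+ Y :=
      { toFun := fun f => (φ (sA.ro x0 f) : Y →L[ℂ] Y) y0
        map_zero' := by
          have : sA.ro x0 0 = 0 := by apply ext_std; intro z; simp
          rw [this, hz]; rfl
        map_add' := fun x y => by
          have : sA.ro x0 (x + y) = sA.ro x0 x + sA.ro x0 y := by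
            apply ext_std; intro z; simp [add_smul]
          rw [this, hadd]; rfl }
    have T0d : ∀ f, T0 f = (φ (sA.ro x0 f) : Y →L[ℂ] Y) y0 := fun _ => rfl
    have Tinj : Function.Injective T0 := by
      rw [injective_iff_map_eq_zero]
      intro f hf
      rw [T0d] at hf
      have h1 : φ (sA.ro x0 f) = φ 0 := by
        rw [← roe f, Hp, hz]
        apply ext_std; intro z; simp [hQ, hf]
      ext z
      simpa [x0ne] using app_std (hbij.1 h1) z
    have Tsurj : Function.Surjective T0 := by
      intro y
      obtain ⟨A, hA⟩ := hbij.2 (sB.ro y g0)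
      refine ⟨f0.comp (A : X →L[ℂ] X), ?_⟩
      rw [T0d, ← Aro, ← he, Hp, hA]
      simp [Qy0, gy]
    have TA : ∀ (A : 𝒜) f, T0 (f.comp (A : X →L[ℂ] X)) = (φ A : Y →L[ℂ] Y) (T0 f) := by
      intro A f
      rw [T0d, ← Aro, Hm _ _ (roe f)]; rfl
    have Tsm : ∀ (z : ℂ) f, T0 (z • f) = k z • T0 f := by
      intro z f
      have : sA.ro x0 (z • f) = z • sA.ro x0 f := by
        apply ext_std; intro w; simp [smul_smul]
      rw [T0d, this, Hs _ (roe f)]; rfl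
    have Tf0 : T0 f0 ≠ 0 := fun h => f0ne (Tinj (by rw [h, map_zero]))
    obtain ⟨w, hw⟩ := SeparatingDual.exists_eq_one (R := ℂ) Tf0
    have := semilinear_cont k (AddEquiv.ofBijective T0 ⟨Tinj, Tsurj⟩) Tsm
      (fun x : X => ContinuousLinearMap.apply ℂ ℂ x)
      (fun x => w.comp (φ (sA.ro x f0) : Y →L[ℂ] Y))
      (by
        intro x f
        change w ((φ (sA.ro x f0) : Y →L[ℂ] Y) (T0 f)) = k (f x)
        have : f.comp (sA.ro x f0 : X →L[ℂ] X) = f x • f0 := by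
          ext z; simp [mul_comm]
        have h2 : T0 (f x • f0) = (φ (sA.ro x f0) : Y →L[ℂ] Y) (T0 f) := by
          rw [← this]; exact TA _ f
        rw [← h2, Tsm, map_smul, hw, smul_eq_mul, mul_one])
      (fun f hf => by ext z; exact hf z)
      (fun n => (p n).2) (fun n => (p n).1) hp1 (fun m n hmn => hp0 n m hmn.symm)
    rcases this with ⟨T', hT'⟩ | ⟨T', hT'⟩
    · right; right; left
      refine ⟨T', fun A y => ?_⟩
      have hT : ∀ x, T' x = T0 x := hT'
      rw [hT, TA, ← hT, T'.apply_symm_apply]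
    · right; right; right
      refine ⟨T', fun A y => ?_⟩
      have hT : ∀ x, T' x = T0 x := hT'
      rw [hT, TA, ← hT, T'.apply_symm_apply]
end

section
/- Let H and K be complex Hilbert spaces with dim H > 1, and let 𝒜 ⊆ B(H) and ℬ ⊆ B(K) be standard operator algebras which are closed under taking adjoints. Suppose φ : 𝒜 → ℬ is a bijective transformation satisfying φ(A*) = φ(A)* and φ((1/2)(AB+BA)) = (1/2)(φ(A)φ(B)+φ(B)φ(A)) for all A, B ∈ 𝒜. Then one of the following holds: (i) there exists a unitary operator U : H → K such that φ(A) = U A U* for all A ∈ 𝒜; (ii) there exists an antiunitary operator U : H → K such that φ(A) = U A U* for all A ∈ 𝒜; (iii) there exists a unitary operator U : H → K such that φ(A) = U A* U* for all A ∈ 𝒜; (iv) there exists an antiunitary operator U : H → K such that φ(A) = U A* U* for all A ∈ 𝒜. -/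
open scoped ComplexOrder

namespace JordanAux
set_option linter.unusedSectionVars false
set_option linter.unusedSimpArgs false

section basics
variable {E : Type*} [NormedAddCommGroup E] [InnerProductSpace ℂ E] [CompleteSpace E]

/-- rank one operator `z ↦ ⟪y, z⟫ x` -/
noncomputable def ro (x y : E) : E →L[ℂ] E := InnerProductSpace.rankOne ℂ x y

/-- Jordan product -/
noncomputable def jp (A B : E →L[ℂ] E) : E →L[ℂ] E := ((1:ℂ)/2) • (A * B + B * A)

theorem ro_apply (x y z : E) : ro x y z = inner ℂ y z • x := rfl

theorem mul_ro (A : E →L[ℂ] E) (x y : E) : A * ro x y = ro (A x) y := by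
  ext z; simp [ro_apply]

theorem ro_mul (A : E →L[ℂ] E) (x y : E) : ro x y * A = ro x (star A y) := by
  ext z; simp [ro_apply, ContinuousLinearMap.star_eq_adjoint, ContinuousLinearMap.adjoint_inner_left]

theorem star_ro (x y : E) : star (ro x y) = ro y x := by
  simp [ro, ContinuousLinearMap.star_eq_adjoint]

theorem ro_add_left (x x' y : E) : ro (x + x') y = ro x y + ro x' y := by
  ext z; simp [ro_apply]

theorem ro_smul_left (c : ℂ) (x y : E) : ro (c • x) y = c • ro x y := by
  ext z; simp [ro_apply, smul_smul, mul_comm]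

theorem ro_smul_right (c : ℂ) (x y : E) : ro x (c • y) = (starRingEnd ℂ c) • ro x y := by
  ext z; simp [ro_apply, smul_smul, inner_smul_left, mul_comm]

theorem inner_self_one {e : E} (he : ‖e‖ = 1) : inner ℂ e e = (1:ℂ) := by
  rw [inner_self_eq_norm_sq_to_K, he]; simp

theorem ro_idem {e : E} (he : ‖e‖ = 1) : ro e e * ro e e = ro e e := by
  rw [mul_ro, ro_apply, inner_self_one he, one_smul]

theorem ro_ne {e : E} (he : ‖e‖ = 1) : ro e e ≠ 0 := by
  intro h
  have := congrArg (fun T : E →L[ℂ] E => T e) h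
  simp [ro_apply, he] at this
  simp [this] at he

theorem ro_compress (e : E) (T : E →L[ℂ] E) : ro e e * T * ro e e = (inner ℂ e (T e)) • ro e e := by
  rw [mul_assoc, mul_ro, mul_ro, ro_apply, ro_smul_left]

theorem jp_comm (A B : E →L[ℂ] E) : jp A B = jp B A := by
  unfold jp; rw [add_comm]

theorem jp_sub (A B C : E →L[ℂ] E) : jp (A - B) C = jp A C - jp B C := by
  unfold jp; simp only [sub_mul, mul_sub, ← smul_sub]; congr 1; abel

theorem jp_add (A B C : E →L[ℂ] E) : jp (A + B) C = jp A C + jp B C := by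
  unfold jp; simp only [add_mul, mul_add, ← smul_add]; congr 1; abel

theorem jp_smul (c : ℂ) (A C : E →L[ℂ] E) : jp (c • A) C = c • jp A C := by
  unfold jp; simp only [smul_mul_assoc, mul_smul_comm, ← smul_add]; rw [smul_comm]

theorem jp_smul_right (c : ℂ) (A C : E →L[ℂ] E) : jp A (c • C) = c • jp A C := by
  rw [jp_comm, jp_smul, jp_comm]

theorem zero_jp (C : E →L[ℂ] E) : jp 0 C = 0 := by
  unfold jp; simp

theorem jp_self_idem {p : E →L[ℂ] E} (hp : p * p = p) : jp p p = p := by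
  unfold jp; rw [hp, ← two_smul ℂ p, smul_smul]; norm_num

/-- `P ∘ T = T` forces `T = PTP`. -/
theorem jp_eq_self {p T : E →L[ℂ] E} (hp : p * p = p) (h : jp T p = T) : T = p * T * p := by
  have h2 : T * p + p * T = (2:ℂ) • T := by
    conv_rhs => rw [← h]
    unfold jp; rw [smul_smul]; norm_num
  rw [two_smul] at h2
  have h3 : p * T * p + p * T = p * T + p * T := by
    have := congrArg (p * ·) h2
    simp only [mul_add, ← mul_assoc, hp] at this; exact this
  have h4 : T * p + p * T * p = T * p + T * p := by
    have := congrArg (· * p) h2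
    simp only [add_mul, mul_assoc, hp] at this; simpa only [mul_assoc] using this
  have h3' := add_right_cancel h3
  have h4' := add_left_cancel h4
  have h5 : (2:ℂ) • T = (2:ℂ) • (p * T * p) := by
    rw [two_smul, two_smul, ← h2]; exact congrArg₂ (· + ·) h4'.symm h3'.symm
  exact smul_right_injective _ (two_ne_zero) h5

/-- `D ∘ (k ⊗ k) = 0` forces `D k = 0`. -/
theorem apply_eq_zero_of_jp {k : E} (hk : ‖k‖ = 1) {D : E →L[ℂ] E} (h : jp D (ro k k) = 0) :
    D k = 0 := by
  have h1 : D k + inner ℂ k (D k) • k = 0 := by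
    have := congrArg (fun T : E →L[ℂ] E => (2:ℂ) • T k) h
    simpa [jp, ro_apply, hk, smul_smul] using this
  have h2 : (inner ℂ k (D k) : ℂ) = 0 := by
    have := congrArg (fun v => inner ℂ k v) h1
    simp only [inner_add_right, inner_smul_right, inner_self_one hk, inner_zero_right] at this
    linear_combination this / 2
  simpa [h2] using h1

theorem star_jp (A B : E →L[ℂ] E) : star (jp A B) = jp (star A) (star B) := by
  unfold jp
  rw [star_smul, star_add, star_mul, star_mul, add_comm]
  norm_num

theorem exists_unit_smul (v : E) (hv : v ≠ 0) :
    ∃ (c : ℂ) (u : E), ‖u‖ = 1 ∧ v = c • u ∧ c ≠ 0 := by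
  have h : (‖v‖ : ℂ) ≠ 0 := by simpa using hv
  refine ⟨(‖v‖ : ℂ), (‖v‖ : ℂ)⁻¹ • v, ?_, ?_, h⟩
  · rw [norm_smul]; simp [hv]
  · rw [smul_smul, mul_inv_cancel₀ h, one_smul]

theorem eq_zero_of_unit {D : E →L[ℂ] E} (h : ∀ k : E, ‖k‖ = 1 → D k = 0) : D = 0 := by
  ext v
  by_cases hv : v = 0
  · simp [hv]
  · obtain ⟨c, u, hu, rfl, -⟩ := exists_unit_smul v hv
    simp [h u hu]

theorem eq_zero_of_jp {D : E →L[ℂ] E} (h : ∀ k : E, ‖k‖ = 1 → jp D (ro k k) = 0) : D = 0 :=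
  eq_zero_of_unit fun k hk => apply_eq_zero_of_jp hk (h k hk)

theorem eq_zero_of_inner {D : E →L[ℂ] E} (h : ∀ k : E, ‖k‖ = 1 → inner ℂ k (D k) = (0:ℂ)) :
    D = 0 := by
  have : (D : E →ₗ[ℂ] E) = 0 := by
    rw [← inner_map_self_eq_zero]
    intro v
    by_cases hv : v = 0
    · simp [hv]
    · obtain ⟨c, u, hu, rfl, -⟩ := exists_unit_smul v hv
      have := h u hu
      rw [← inner_conj_symm]
      simp [this, inner_smul_left, inner_smul_right]
  ext v
  exact congrArg (fun T : E →ₗ[ℂ] E => T v) this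

/-- decomposition along a unit vector -/
theorem perp_decomp {e : E} (he : ‖e‖ = 1) (v : E) :
    inner ℂ e (v - inner ℂ e v • e) = (0:ℂ) := by
  rw [inner_sub_right, inner_smul_right, inner_self_one he]; ring

/-- If `Z ∘ kk* = 0` for all unit `k ⊥ e`, then `Z` is a multiple of `ee*`. -/
theorem eq_smul_of_perp {e : E} (he : ‖e‖ = 1) {Z : E →L[ℂ] E}
    (h : ∀ k : E, ‖k‖ = 1 → inner ℂ e k = (0:ℂ) → jp Z (ro k k) = 0) :
    ∃ z : ℂ, Z = z • ro e e := by
  have h1 : ∀ k : E, inner ℂ e k = (0:ℂ) → Z k = 0 := by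
    intro k hk
    by_cases hv : k = 0
    · simp [hv]
    · obtain ⟨c, u, hu, rfl, hc⟩ := exists_unit_smul k hv
      rw [inner_smul_right] at hk
      have := apply_eq_zero_of_jp hu (h u hu ((mul_eq_zero.1 hk).resolve_left hc))
      simp [this]
  have h2 : ∀ k : E, inner ℂ e k = (0:ℂ) → star Z k = 0 := by
    intro k hk
    by_cases hv : k = 0
    · simp [hv]
    · obtain ⟨c, u, hu, rfl, hc⟩ := exists_unit_smul k hv
      rw [inner_smul_right] at hk
      have h3 := h u hu ((mul_eq_zero.1 hk).resolve_left hc)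
      have h4 : jp (star Z) (ro u u) = 0 := by
        rw [← star_ro u u, ← star_jp, h3, star_zero]
      have := apply_eq_zero_of_jp hu h4
      simp [this]
  refine ⟨inner ℂ e (Z e), ?_⟩
  have h5 : Z e = inner ℂ e (Z e) • e := by
    have h6 := h2 _ (perp_decomp he (Z e))
    have h7 : inner ℂ (Z e - inner ℂ e (Z e) • e) (Z e) = (0:ℂ) := by
      rw [← ContinuousLinearMap.adjoint_inner_left, ← ContinuousLinearMap.star_eq_adjoint, h6,
        inner_zero_left]
    have h8 : inner ℂ (Z e - inner ℂ e (Z e) • e) (Z e - inner ℂ e (Z e) • e) = (0:ℂ) := by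
      rw [inner_sub_right, h7, inner_smul_right, inner_eq_zero_symm.1 (perp_decomp he (Z e))]; simp
    exact sub_eq_zero.1 (inner_self_eq_zero.1 h8)
  ext v
  have h9 := h1 _ (perp_decomp he v)
  rw [map_sub, map_smul, sub_eq_zero] at h9
  rw [h9, h5]
  simp [ro_apply, smul_smul, inner_smul_right, he, mul_comm]

/-- half Peirce component -/
noncomputable def hc (p T : E →L[ℂ] E) : E →L[ℂ] E := p * T + T * p - (2:ℂ) • (p * T * p)

theorem half_compress {p M : E →L[ℂ] E} (hp : p * p = p) (h : p * M + M * p = M) :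
    p * M * p = 0 := by
  have h1 : p * M * p + p * M * p = p * M * p := by
    have := congrArg (fun T => p * T * p) h
    simp only [mul_add, add_mul, ← mul_assoc, hp] at this
    simpa only [mul_assoc, hp] using this
  simpa using h1

theorem hc_half {p T : E →L[ℂ] E} (hp : p * p = p) : p * hc p T + hc p T * p = hc p T := by
  have h1 : p * hc p T = p * T - p * T * p := by
    unfold hc
    simp only [mul_add, mul_sub, mul_smul_comm, ← mul_assoc, hp]; module
  have h2 : hc p T * p = T * p - p * T * p := by
    unfold hc
    simp only [add_mul, sub_mul, smul_mul_assoc, mul_assoc, hp]; module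
  rw [h1, h2]; unfold hc; module

theorem hc_of_half {p M : E →L[ℂ] E} (hp : p * p = p) (h : p * M + M * p = M) : hc p M = M := by
  unfold hc; rw [half_compress hp h, h]; simp

theorem hc_add (p S T : E →L[ℂ] E) : hc p (S + T) = hc p S + hc p T := by
  unfold hc; simp only [mul_add, add_mul, smul_add]; abel

theorem hc_smul (p : E →L[ℂ] E) (c : ℂ) (T : E →L[ℂ] E) : hc p (c • T) = c • hc p T := by
  unfold hc; simp only [mul_smul_comm, smul_mul_assoc]; module

theorem hc_self {p : E →L[ℂ] E} (hp : p * p = p) : hc p p = 0 := by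
  unfold hc; simp only [hp]; module

theorem hc_jp {p : E →L[ℂ] E} (hp : p * p = p) (T : E →L[ℂ] E) :
    hc p (jp T p) = ((1:ℂ)/2) • hc p T := by
  unfold hc jp
  simp only [mul_smul_comm, smul_mul_assoc, mul_add, add_mul, ← mul_assoc, hp]
  simp only [mul_assoc, hp]; module

theorem jp_decomp {p : E →L[ℂ] E} (T : E →L[ℂ] E) :
    jp T p = p * T * p + ((1:ℂ)/2) • hc p T := by
  unfold hc jp; module

theorem hc_half_half {p M N : E →L[ℂ] E} (hp : p * p = p) (hM : p * M + M * p = M)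
    (hN : p * N + N * p = N) : hc p (jp M N) = 0 := by
  have key : ∀ A B : E →L[ℂ] E, p * A + A * p = A → p * B + B * p = B → hc p (A * B) = 0 := by
    intro A B hA hB
    have h1 : p * (A * B) = A * B * p := by
      have e1 : p * A = A - A * p := eq_sub_of_add_eq hA
      have e2 : p * B = B - B * p := eq_sub_of_add_eq hB
      rw [← mul_assoc, e1, sub_mul, mul_assoc A p B, e2, mul_sub, mul_assoc]; abel
    unfold hc
    rw [h1, mul_assoc (A * B), hp]; module
  unfold jp
  rw [hc_smul, hc_add, key _ _ hM hN, key _ _ hN hM]; simp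

theorem jp_half {p M : E →L[ℂ] E} (h : p * M + M * p = M) : jp p M = ((1:ℂ)/2) • M := by
  unfold jp; rw [h]

end basics
end JordanAux
namespace JordanAux
set_option linter.unusedSectionVars false
set_option linter.unusedSimpArgs false

section maps
variable {H K : Type*} [NormedAddCommGroup H] [InnerProductSpace ℂ H] [CompleteSpace H]
    [NormedAddCommGroup K] [InnerProductSpace ℂ K] [CompleteSpace K]

/-- Jordan multiplicative star preserving bijection -/
structure JM (𝒜 : NonUnitalSubalgebra ℂ (H →L[ℂ] H)) (ℬ : NonUnitalSubalgebra ℂ (K →L[ℂ] K))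
    (Φ : (H →L[ℂ] H) → (K →L[ℂ] K)) : Prop where
  fa : ∀ x y, ro x y ∈ 𝒜
  fb : ∀ x y, ro x y ∈ ℬ
  sa : ∀ T ∈ 𝒜, star T ∈ 𝒜
  sb : ∀ T ∈ ℬ, star T ∈ ℬ
  bij : Set.BijOn Φ 𝒜 ℬ
  st : ∀ A ∈ 𝒜, Φ (star A) = star (Φ A)
  jo : ∀ A ∈ 𝒜, ∀ B ∈ 𝒜, Φ (jp A B) = jp (Φ A) (Φ B)

variable {𝒜 : NonUnitalSubalgebra ℂ (H →L[ℂ] H)} {ℬ : NonUnitalSubalgebra ℂ (K →L[ℂ] K)}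
    {Φ : (H →L[ℂ] H) → (K →L[ℂ] K)}

theorem jp_mem {A B : H →L[ℂ] H} (hA : A ∈ 𝒜) (hB : B ∈ 𝒜) : jp A B ∈ 𝒜 :=
  SMulMemClass.smul_mem _ (add_mem (mul_mem hA hB) (mul_mem hB hA))

theorem JM.inv (h : JM 𝒜 ℬ Φ) : JM ℬ 𝒜 (Function.invFunOn Φ 𝒜) := by
  have hr := h.bij.invOn_invFunOn
  have hb : Set.BijOn (Function.invFunOn Φ 𝒜) ℬ 𝒜 := (hr.symm).bijOn
    (h.bij.surjOn.mapsTo_invFunOn) h.bij.mapsTo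
  refine ⟨h.fb, h.fa, h.sb, h.sa, hb, ?_, ?_⟩
  · intro B hB
    apply h.bij.injOn (hb.mapsTo (h.sb _ hB)) (h.sa _ (hb.mapsTo hB))
    rw [h.st _ (hb.mapsTo hB), hr.2 (h.sb _ hB), hr.2 hB]
  · intro A hA B hB
    apply h.bij.injOn (hb.mapsTo (jp_mem hA hB)) (jp_mem (hb.mapsTo hA) (hb.mapsTo hB))
    rw [h.jo _ (hb.mapsTo hA) _ (hb.mapsTo hB), hr.2 hA, hr.2 hB, hr.2 (jp_mem hA hB)]

theorem JM.zero (h : JM 𝒜 ℬ Φ) : Φ 0 = 0 := by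
  obtain ⟨A, hA, hA0⟩ := h.bij.surjOn (zero_mem ℬ)
  have := h.jo 0 (zero_mem 𝒜) A hA
  rwa [hA0, zero_jp, jp_comm, zero_jp] at this

theorem JM.ne_zero (h : JM 𝒜 ℬ Φ) {A : H →L[ℂ] H} (hA : A ∈ 𝒜) (h0 : A ≠ 0) : Φ A ≠ 0 := by
  intro h1
  rw [← h.zero] at h1
  exact h0 (h.bij.injOn hA (zero_mem 𝒜) h1)

theorem jp_self (A : H →L[ℂ] H) : jp A A = A * A := by
  unfold jp; rw [← two_smul ℂ (A * A), smul_smul]; norm_num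

theorem JM.rankOne (h : JM 𝒜 ℬ Φ) {e : H} (he : ‖e‖ = 1) :
    ∃ u : K, ‖u‖ = 1 ∧ Φ (ro e e) = ro u u := by
  set P := ro e e with hP
  have hPm : P ∈ 𝒜 := h.fa e e
  have hqi : Φ P * Φ P = Φ P := by
    rw [← jp_self, ← h.jo _ hPm _ hPm, jp_self, hP, ro_idem he]
  have hqs : star (Φ P) = Φ P := by rw [← h.st _ hPm, hP, star_ro]
  have hq0 : Φ P ≠ 0 := h.ne_zero hPm (ro_ne he)
  obtain ⟨k, hk⟩ : ∃ k, Φ P k ≠ 0 := by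
    by_contra! hc
    exact hq0 (by ext k; simp [hc k])
  obtain ⟨c, u, hu, huk, hc⟩ := exists_unit_smul _ hk
  have hqu : Φ P u = u := by
    have h1 : Φ P (Φ P k) = Φ P k := congrArg (fun T : K →L[ℂ] K => T k) hqi
    rw [huk, map_smul] at h1
    exact smul_right_injective _ hc h1
  obtain ⟨R, hR, hRu⟩ := h.bij.surjOn (h.fb u u)
  have h2 : jp R P = R := by
    apply h.bij.injOn (jp_mem hR hPm) hR
    rw [h.jo _ hR _ hPm, hRu]
    unfold jp
    rw [ro_mul, mul_ro, hqs, hqu, ← two_smul ℂ (ro u u), smul_smul]; norm_num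
  have h3 : R * R = R := by
    apply h.bij.injOn (mul_mem hR hR) hR
    rw [← jp_self, h.jo _ hR _ hR, jp_self, hRu, ro_idem hu]
  have h4 := jp_eq_self (ro_idem he) h2
  rw [ro_compress] at h4
  set c' := (inner ℂ e (R e) : ℂ) with hc'
  have h5 : c' * c' = c' := by
    rw [h4, smul_mul_smul_comm, ro_idem he] at h3
    exact smul_left_injective ℂ (ro_ne he) h3
  have h6 : c' ≠ 0 := by
    intro h7
    rw [h7, zero_smul] at h4
    rw [h4, h.zero] at hRu
    exact ro_ne hu hRu.symm
  have h7 : c' = 1 := mul_left_cancel₀ h6 (by rw [h5, mul_one])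
  rw [h7, one_smul] at h4
  exact ⟨u, hu, by rw [hP, ← h4, hRu]⟩

theorem JM.rankOne_surj (h : JM 𝒜 ℬ Φ) {u : K} (hu : ‖u‖ = 1) :
    ∃ e : H, ‖e‖ = 1 ∧ Φ (ro e e) = ro u u := by
  obtain ⟨e, he, h1⟩ := h.inv.rankOne hu
  refine ⟨e, he, ?_⟩
  rw [← h1]
  exact h.bij.invOn_invFunOn.2 (h.fb u u)

/-- local homogeneity -/
theorem JM.hom_local (h : JM 𝒜 ℬ Φ) {v : H} (hv : v ≠ 0) (l : ℂ) :
    ∃ c : ℂ, ∀ A ∈ 𝒜, Φ (l • jp A (ro v v)) = c • Φ (jp A (ro v v)) := by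
  obtain ⟨d, e, he, rfl, hd⟩ := exists_unit_smul v hv
  obtain ⟨u, hu, hue⟩ := h.rankOne he
  have hPm := h.fa e e
  have hlm : l • ro e e ∈ 𝒜 := SMulMemClass.smul_mem l hPm
  have h1 : jp (Φ (l • ro e e)) (ro u u) = Φ (l • ro e e) := by
    rw [← hue, ← h.jo _ hlm _ hPm, jp_smul, jp_self_idem (ro_idem he)]
  have h2 := jp_eq_self (ro_idem hu) h1
  rw [ro_compress] at h2
  refine ⟨inner ℂ u (Φ (l • ro e e) u), ?_⟩
  have key : ∀ A ∈ 𝒜, Φ (l • jp A (ro e e)) =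
      (inner ℂ u (Φ (l • ro e e) u) : ℂ) • Φ (jp A (ro e e)) := by
    intro A hA
    rw [← jp_smul_right, h.jo _ hA _ hlm, h.jo _ hA _ hPm, hue, ← jp_smul_right, ← h2]
  intro A hA
  have h3 : jp A (ro (d • e) (d • e)) = jp ((d * starRingEnd ℂ d) • A) (ro e e) := by
    rw [ro_smul_left, ro_smul_right, smul_smul, jp_smul, jp_smul_right]
  rw [h3]
  exact key _ (SMulMemClass.smul_mem _ hA)

theorem jp_ro_ne {v w : H} (hvw : inner ℂ v w ≠ (0:ℂ)) : jp (ro v v) (ro w w) ≠ 0 := by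
  intro h0
  have h1 := congrArg (fun T : H →L[ℂ] H => inner ℂ w (T w)) h0
  have hw : w ≠ 0 := by rintro rfl; simp at hvw
  have hww : (inner ℂ w w : ℂ) ≠ 0 := inner_self_ne_zero.2 hw
  have hwv : (inner ℂ w v : ℂ) ≠ 0 := fun hh => hvw (inner_eq_zero_symm.1 hh)
  have h2 : (inner ℂ w w : ℂ) * (inner ℂ v w * inner ℂ w v) = 0 := by
    simp only [jp, mul_ro, ro_apply, ro_smul_left, smul_apply,
      add_apply, inner_smul_right, inner_add_right, inner_zero_right,
      zero_apply] at h1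
    linear_combination h1
  exact mul_ne_zero hww (mul_ne_zero hvw hwv) h2

theorem JM.hom (h : JM 𝒜 ℬ Φ) [Nontrivial H] (l : ℂ) :
    ∃ c : ℂ, ∀ A ∈ 𝒜, Φ (l • A) = c • Φ A := by
  obtain ⟨e0, he0⟩ := exists_ne (0 : H)
  obtain ⟨c, hc⟩ := h.hom_local he0 l
  refine ⟨c, ?_⟩
  -- if `v` and `w` are not orthogonal, their constants agree
  have key : ∀ v w : H, inner ℂ v w ≠ (0:ℂ) → ∀ a b : ℂ,
      (∀ A ∈ 𝒜, Φ (l • jp A (ro v v)) = a • Φ (jp A (ro v v))) →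
      (∀ A ∈ 𝒜, Φ (l • jp A (ro w w)) = b • Φ (jp A (ro w w))) → a = b := by
    intro v w hvw a b ha hb
    have h1 := ha _ (h.fa w w)
    have h2 := hb _ (h.fa v v)
    rw [jp_comm, h2] at h1
    exact (smul_left_injective ℂ (h.ne_zero (jp_mem (h.fa v v) (h.fa w w)) (jp_ro_ne hvw)) h1).symm
  have key2 : ∀ v : H, v ≠ 0 → ∀ A ∈ 𝒜, Φ (l • jp A (ro v v)) = c • Φ (jp A (ro v v)) := by
    intro v hv
    obtain ⟨a, ha⟩ := h.hom_local hv l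
    have : a = c := by
      by_cases hvo : (inner ℂ v e0 : ℂ) = 0
      · have hvo' : (inner ℂ e0 v : ℂ) = 0 := inner_eq_zero_symm.1 hvo
        have n1 : (inner ℂ v (v + e0) : ℂ) ≠ 0 := by
          rw [inner_add_right, hvo, add_zero]; exact inner_self_ne_zero.2 hv
        have n2 : (inner ℂ e0 (v + e0) : ℂ) ≠ 0 := by
          rw [inner_add_right, hvo', zero_add]; exact inner_self_ne_zero.2 he0
        have n3 : v + e0 ≠ 0 := by
          intro hh; rw [hh, inner_zero_right] at n1; exact n1 rfl
        obtain ⟨b, hb⟩ := h.hom_local n3 l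
        rw [key _ _ n1 _ _ ha hb, key _ _ n2 _ _ hc hb]
      · exact key _ _ hvo _ _ ha hc
    rw [← this]; exact ha
  intro A hA
  rw [← sub_eq_zero]
  apply eq_zero_of_jp
  intro k hk
  obtain ⟨e, he, hek⟩ := h.rankOne_surj hk
  have hen : e ≠ 0 := by rintro rfl; simp at he
  rw [jp_sub, jp_smul, ← hek, ← h.jo _ (SMulMemClass.smul_mem l hA) _ (h.fa e e), jp_smul,
    key2 e hen A hA, h.jo _ hA _ (h.fa e e), sub_self]

end maps
end JordanAux
namespace JordanAux
set_option linter.unusedSectionVars false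
set_option linter.unusedSimpArgs false

section scalars
variable {H K : Type*} [NormedAddCommGroup H] [InnerProductSpace ℂ H] [CompleteSpace H]
    [NormedAddCommGroup K] [InnerProductSpace ℂ K] [CompleteSpace K]
variable {𝒜 : NonUnitalSubalgebra ℂ (H →L[ℂ] H)} {ℬ : NonUnitalSubalgebra ℂ (K →L[ℂ] K)}
    {Φ : (H →L[ℂ] H) → (K →L[ℂ] K)} {f : ℂ → ℂ}

theorem JM.f_mul (h : JM 𝒜 ℬ Φ) (hf : ∀ l, ∀ A ∈ 𝒜, Φ (l • A) = f l • Φ A) {e : H}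
    (he : ‖e‖ = 1) (a b : ℂ) : f (a * b) = f a * f b := by
  have hm := h.fa e e
  apply smul_left_injective ℂ (h.ne_zero hm (ro_ne he))
  simp only
  rw [← hf _ _ hm, mul_smul, mul_smul, hf _ _ (SMulMemClass.smul_mem b hm), hf _ _ hm]

theorem JM.f_one (h : JM 𝒜 ℬ Φ) (hf : ∀ l, ∀ A ∈ 𝒜, Φ (l • A) = f l • Φ A) {e : H}
    (he : ‖e‖ = 1) : f 1 = 1 := by
  have hm := h.fa e e
  apply smul_left_injective ℂ (h.ne_zero hm (ro_ne he))
  simp only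
  rw [← hf _ _ hm, one_smul, one_smul]

theorem JM.f_zero (h : JM 𝒜 ℬ Φ) (hf : ∀ l, ∀ A ∈ 𝒜, Φ (l • A) = f l • Φ A) {e : H}
    (he : ‖e‖ = 1) : f 0 = 0 := by
  have hm := h.fa e e
  apply smul_left_injective ℂ (h.ne_zero hm (ro_ne he))
  simp only
  rw [← hf _ _ hm, zero_smul, zero_smul, h.zero]

theorem JM.f_inj (h : JM 𝒜 ℬ Φ) (hf : ∀ l, ∀ A ∈ 𝒜, Φ (l • A) = f l • Φ A) {e : H}
    (he : ‖e‖ = 1) {a b : ℂ} (hab : f a = f b) : a = b := by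
  have hm := h.fa e e
  apply smul_left_injective ℂ (ro_ne he)
  apply h.bij.injOn (SMulMemClass.smul_mem a hm) (SMulMemClass.smul_mem b hm)
  rw [hf _ _ hm, hf _ _ hm, hab]

theorem JM.f_conj (h : JM 𝒜 ℬ Φ) (hf : ∀ l, ∀ A ∈ 𝒜, Φ (l • A) = f l • Φ A) {e : H}
    (he : ‖e‖ = 1) (a : ℂ) : f (starRingEnd ℂ a) = starRingEnd ℂ (f a) := by
  have hm := h.fa e e
  apply smul_left_injective ℂ (h.ne_zero hm (ro_ne he))
  simp only
  have h1 := h.st _ (SMulMemClass.smul_mem a hm)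
  rw [star_smul, star_ro, hf _ _ hm, hf _ _ hm, star_smul, ← h.st _ hm, star_ro] at h1
  exact h1

/-- off-diagonal element -/
theorem half_elem {e g : H} (he : ‖e‖ = 1) (hg : ‖g‖ = 1) (heg : inner ℂ e g = (0:ℂ)) :
    ro e e * ro g e + ro g e * ro e e = ro g e ∧ ro g e ≠ 0 := by
  constructor
  · rw [mul_ro, mul_ro, ro_apply, ro_apply, heg, inner_self_one he, zero_smul, one_smul]
    ext z; simp [ro_apply]
  · intro h0
    have := congrArg (fun T : H →L[ℂ] H => T e) h0
    simp [ro_apply, he] at this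
    simp [this] at hg

theorem JM.f_half (h : JM 𝒜 ℬ Φ) (hf : ∀ l, ∀ A ∈ 𝒜, Φ (l • A) = f l • Φ A) {e g : H}
    (he : ‖e‖ = 1) (hg : ‖g‖ = 1) (heg : inner ℂ e g = (0:ℂ)) : f (1/2) = 1/2 := by
  obtain ⟨h1, h2⟩ := half_elem he hg heg
  obtain ⟨u, hu, hue⟩ := h.rankOne he
  have hm := h.fa e e
  have hxm := h.fa g e
  have h3 := h.jo _ hm _ hxm
  rw [jp_half h1, hf _ _ hxm, hue] at h3
  set T := Φ (ro g e) with hT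
  have hT0 : T ≠ 0 := h.ne_zero hxm h2
  set c := f (1/2) with hc
  set p := ro u u with hpdef
  have hp : p * p = p := ro_idem hu
  have hc1 : c ≠ 1 := by
    rw [← h.f_one hf he]; intro hh
    have := h.f_inj hf he hh; norm_num at this
  have hc0 : c ≠ 0 := by
    rw [← h.f_zero hf he]; intro hh
    have := h.f_inj hf he hh; norm_num at this
  have h4 : p * T + T * p = (2 * c) • T := by
    rw [mul_smul, h3]; unfold jp; rw [smul_smul]; norm_num
  have h5 : p * T * p = 0 := by
    have h6 : p * T * p + p * T * p = (2 * c) • (p * T * p) := by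
      have := congrArg (fun S => p * S * p) h4
      simp only [mul_add, add_mul, ← mul_assoc, hp, mul_smul_comm, smul_mul_assoc] at this
      simpa only [mul_assoc, hp] using this
    have h7 : (2 * c - 2) • (p * T * p) = 0 := by
      rw [sub_smul, ← h6, two_smul, sub_self]
    refine (smul_eq_zero.1 h7).resolve_left ?_
    intro hh; exact hc1 (by linear_combination hh / 2)
  by_contra hne
  have hne' : 1 - 2 * c ≠ 0 := by
    intro hh; exact hne (by linear_combination -hh / 2)
  have h8 : p * T = 0 := by
    have h6 : p * T + p * T * p = (2 * c) • (p * T) := by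
      have := congrArg (fun S => p * S) h4
      simpa only [mul_add, ← mul_assoc, hp, mul_smul_comm] using this
    rw [h5, add_zero] at h6
    refine (smul_eq_zero.1 (?_ : (1 - 2 * c) • (p * T) = 0)).resolve_left hne'
    rw [sub_smul, ← h6, one_smul, sub_self]
  have h9 : T * p = 0 := by
    have h6 : p * T * p + T * p = (2 * c) • (T * p) := by
      have := congrArg (fun S => S * p) h4
      simp only [add_mul, smul_mul_assoc] at this
      rwa [mul_assoc T p p, hp] at this
    rw [h5, zero_add] at h6
    refine (smul_eq_zero.1 (?_ : (1 - 2 * c) • (T * p) = 0)).resolve_left hne'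
    rw [sub_smul, ← h6, one_smul, sub_self]
  rw [h8, h9, add_zero] at h4
  exact (smul_ne_zero (mul_ne_zero two_ne_zero hc0) hT0) h4.symm

theorem JM.half (h : JM 𝒜 ℬ Φ) (hf : ∀ l, ∀ A ∈ 𝒜, Φ (l • A) = f l • Φ A)
    (h2 : f (1/2) = 1/2) {p : H →L[ℂ] H} (hp : p ∈ 𝒜)
    {N : H →L[ℂ] H} (hN : N ∈ 𝒜) (hh : p * N + N * p = N) :
    Φ p * Φ N + Φ N * Φ p = Φ N := by
  have h3 := h.jo _ hp _ hN
  rw [jp_half hh, hf _ _ hN, h2] at h3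
  unfold jp at h3
  exact (smul_right_injective _ (by norm_num : (1:ℂ)/2 ≠ 0) h3).symm

/-- step (c) -/
theorem JM.step_c (h : JM 𝒜 ℬ Φ) {e : H} {u : K} (he : ‖e‖ = 1) (hu : ‖u‖ = 1)
    (hue : Φ (ro e e) = ro u u) (c : ℂ) {N : H →L[ℂ] H} (hN : N ∈ 𝒜) :
    ∃ z : ℂ, Φ (c • ro e e + N) = Φ N + z • ro u u := by
  have hm := h.fa e e
  have : ∃ z : ℂ, Φ (c • ro e e + N) - Φ N = z • ro u u := by
    apply eq_smul_of_perp hu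
    intro k hk huk
    obtain ⟨r, hr, hrk⟩ := h.rankOne_surj hk
    have hrm := h.fa r r
    have h1 : jp (ro e e) (ro r r) = 0 := by
      apply h.bij.injOn (jp_mem hm hrm) (zero_mem 𝒜)
      rw [h.zero, h.jo _ hm _ hrm, hue, hrk]
      unfold jp
      rw [mul_ro, mul_ro, ro_apply, ro_apply, huk, inner_eq_zero_symm.1 huk]
      ext z; simp [ro_apply]
    rw [jp_sub, ← hrk, ← h.jo _ (add_mem (SMulMemClass.smul_mem c hm) hN) _ hrm,
      ← h.jo _ hN _ hrm, jp_add, jp_smul, h1, smul_zero, zero_add, sub_self]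
  obtain ⟨z, hz⟩ := this
  exact ⟨z, by rw [← hz]; abel⟩

theorem hc_mem {p T : H →L[ℂ] H} (hp : p ∈ 𝒜) (hT : T ∈ 𝒜) : hc p T ∈ 𝒜 :=
  sub_mem (add_mem (mul_mem hp hT) (mul_mem hT hp))
    (SMulMemClass.smul_mem _ (mul_mem (mul_mem hp hT) hp))

/-- step (d) -/
theorem JM.step_d (h : JM 𝒜 ℬ Φ) (hf : ∀ l, ∀ A ∈ 𝒜, Φ (l • A) = f l • Φ A)
    (h2 : f (1/2) = 1/2) {e : H} {u : K} (he : ‖e‖ = 1) (hu : ‖u‖ = 1)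
    (hue : Φ (ro e e) = ro u u) {X : H →L[ℂ] H} (hX : X ∈ 𝒜) :
    hc (ro u u) (Φ X) = Φ (hc (ro e e) X) := by
  have hm := h.fa e e
  have hhm := hc_mem hm hX
  obtain ⟨z, hz⟩ := h.step_c he hu hue (inner ℂ e (X e)) (SMulMemClass.smul_mem ((1:ℂ)/2) hhm)
  rw [← ro_compress, ← jp_decomp, h.jo _ hX _ hm, hue, hf _ _ hhm, h2] at hz
  have h3 := congrArg (hc (ro u u)) hz
  have h4 := h.half hf h2 hm hhm (hc_half (ro_idem he))
  rw [hue] at h4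
  rw [hc_jp (ro_idem hu), hc_add, hc_smul, hc_smul, hc_self (ro_idem hu), smul_zero, add_zero,
    hc_of_half (ro_idem hu) h4] at h3
  exact smul_right_injective _ (by norm_num : (1:ℂ)/2 ≠ 0) h3

/-- step (e) -/
theorem JM.step_e (h : JM 𝒜 ℬ Φ) (hf : ∀ l, ∀ A ∈ 𝒜, Φ (l • A) = f l • Φ A)
    (h2 : f (1/2) = 1/2) {e g : H} {u : K} (he : ‖e‖ = 1) (hu : ‖u‖ = 1)
    (hue : Φ (ro e e) = ro u u) (hg : ‖g‖ = 1) (heg : inner ℂ e g = (0:ℂ))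
    (c : ℂ) {N : H →L[ℂ] H} (hN : N ∈ 𝒜) (hNh : ro e e * N + N * ro e e = N) :
    Φ (c • ro e e + N) = Φ N + f c • ro u u := by
  have hm := h.fa e e
  obtain ⟨z, hz⟩ := h.step_c he hu hue c hN
  obtain ⟨hB, hB0⟩ := half_elem he hg heg
  set B := ro g e with hBdef
  have hBm : B ∈ 𝒜 := h.fa g e
  have hM := h.half hf h2 hm hBm hB
  have hM0 : Φ B ≠ 0 := h.ne_zero hBm hB0
  have hNN := h.half hf h2 hm hN hNh
  rw [hue] at hM hNN
  have hAm : c • ro e e + N ∈ 𝒜 := add_mem (SMulMemClass.smul_mem c hm) hN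
  have h3 := h.step_d hf h2 he hu hue (jp_mem hAm hBm)
  rw [h.jo _ hAm _ hBm, hz, jp_add, jp_add, jp_smul, jp_smul, hc_add, hc_add,
    hc_half_half (ro_idem hu) hNN hM, hc_half_half (ro_idem he) hNh hB, jp_half hB, jp_half hM,
    zero_add, add_zero, smul_smul, smul_smul, hc_smul, hc_smul, hc_of_half (ro_idem hu) hM,
    hc_of_half (ro_idem he) hB, hf _ _ hBm, h.f_mul hf he, h2] at h3
  have h4 := smul_left_injective ℂ hM0 h3
  have h5 : z = f c := mul_right_cancel₀ (by norm_num : (1:ℂ)/2 ≠ 0) h4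
  rw [hz, h5]

/-- key lemma: compressions -/
theorem JM.key (h : JM 𝒜 ℬ Φ) (hf : ∀ l, ∀ A ∈ 𝒜, Φ (l • A) = f l • Φ A)
    (h2 : f (1/2) = 1/2) {e g : H} {u : K} (he : ‖e‖ = 1) (hu : ‖u‖ = 1)
    (hue : Φ (ro e e) = ro u u) (hg : ‖g‖ = 1) (heg : inner ℂ e g = (0:ℂ))
    {X : H →L[ℂ] H} (hX : X ∈ 𝒜) : inner ℂ u (Φ X u) = f (inner ℂ e (X e)) := by
  have hm := h.fa e e
  have hhm := hc_mem hm hX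
  have hhm2 := SMulMemClass.smul_mem ((1:ℂ)/2) hhm
  have hhh : ro e e * (((1:ℂ)/2) • hc (ro e e) X) + (((1:ℂ)/2) • hc (ro e e) X) * ro e e
      = ((1:ℂ)/2) • hc (ro e e) X := by
    rw [mul_smul_comm, smul_mul_assoc, ← smul_add, hc_half (ro_idem he)]
  have h3 := h.step_e hf h2 he hu hue hg heg (inner ℂ e (X e)) hhm2 hhh
  have h4 := h.half hf h2 hm hhm2 hhh
  rw [hue] at h4
  rw [← ro_compress, ← jp_decomp, h.jo _ hX _ hm, hue] at h3
  have h5 := congrArg (fun T => ro u u * T * ro u u) h3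
  simp only [mul_add, add_mul, half_compress (ro_idem hu) h4, zero_add] at h5
  have h6 : ro u u * jp (Φ X) (ro u u) * ro u u = inner ℂ u (Φ X u) • ro u u := by
    rw [← ro_compress]
    unfold jp
    simp only [mul_smul_comm, smul_mul_assoc, mul_add, add_mul, ← mul_assoc, ro_idem hu]
    simp only [mul_assoc, ro_idem hu]; module
  rw [h6, mul_smul_comm, smul_mul_assoc, ro_idem hu, ro_idem hu] at h5
  exact smul_left_injective ℂ (ro_ne hu) h5

theorem jp_ro_perp {a b : K} (hab : inner ℂ a b = (0:ℂ)) : jp (ro a a) (ro b b) = 0 := by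
  unfold jp
  rw [mul_ro, mul_ro, ro_apply, ro_apply, hab, inner_eq_zero_symm.1 hab]
  ext z; simp [ro_apply]

theorem perp_of_jp {a b : K} (ha : ‖a‖ = 1) (hb : ‖b‖ = 1) (h : jp (ro a a) (ro b b) = 0) :
    inner ℂ a b = (0:ℂ) := by
  by_contra hne
  exact jp_ro_ne hne h

/-- block diagonal additivity -/
theorem JM.diag (h : JM 𝒜 ℬ Φ) (hf : ∀ l, ∀ A ∈ 𝒜, Φ (l • A) = f l • Φ A)
    {a b : H} (ha : ‖a‖ = 1) (hb : ‖b‖ = 1) (hab : inner ℂ a b = (0:ℂ)) (α β : ℂ) :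
    Φ (α • ro a a + β • ro b b) = f α • Φ (ro a a) + f β • Φ (ro b b) := by
  obtain ⟨a', ha', haa⟩ := h.rankOne ha
  obtain ⟨b', hb', hbb⟩ := h.rankOne hb
  have hma := h.fa a a
  have hmb := h.fa b b
  have hAm : α • ro a a + β • ro b b ∈ 𝒜 :=
    add_mem (SMulMemClass.smul_mem _ hma) (SMulMemClass.smul_mem _ hmb)
  have h0 : jp (ro a' a') (ro b' b') = 0 := by
    rw [← haa, ← hbb, ← h.jo _ hma _ hmb, jp_ro_perp hab, h.zero]
  have hab' := perp_of_jp ha' hb' h0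
  rw [← sub_eq_zero, haa, hbb]
  set D := Φ (α • ro a a + β • ro b b) - (f α • ro a' a' + f β • ro b' b') with hD
  have hDa : D a' = 0 := by
    apply apply_eq_zero_of_jp ha'
    rw [hD, jp_sub, ← haa, ← h.jo _ hAm _ hma, haa, jp_add, jp_add, jp_smul, jp_smul, jp_smul,
      jp_smul, jp_comm (ro b' b'), h0, jp_comm (ro b b), jp_ro_perp hab, jp_self_idem (ro_idem ha),
      jp_self_idem (ro_idem ha'), smul_zero, smul_zero, add_zero, add_zero, hf _ _ hma, haa,
      sub_self]
  have hDb : D b' = 0 := by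
    apply apply_eq_zero_of_jp hb'
    rw [hD, jp_sub, ← hbb, ← h.jo _ hAm _ hmb, hbb, jp_add, jp_add, jp_smul, jp_smul, jp_smul,
      jp_smul, h0, jp_ro_perp hab, jp_self_idem (ro_idem hb),
      jp_self_idem (ro_idem hb'), smul_zero, smul_zero, zero_add, zero_add, hf _ _ hmb, hbb,
      sub_self]
  have hDk : ∀ k : K, inner ℂ a' k = (0:ℂ) → inner ℂ b' k = (0:ℂ) → D k = 0 := by
    intro k hak hbk
    by_cases hk0 : k = 0
    · simp [hk0]
    obtain ⟨c, k, hk, rfl, hc⟩ := exists_unit_smul k hk0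
    rw [inner_smul_right] at hak hbk
    replace hak := (mul_eq_zero.1 hak).resolve_left hc
    replace hbk := (mul_eq_zero.1 hbk).resolve_left hc
    rw [map_smul]
    obtain ⟨r, hr, hrk⟩ := h.rankOne_surj hk
    have hrm := h.fa r r
    have h1 : jp (ro a a) (ro r r) = 0 := by
      apply h.bij.injOn (jp_mem hma hrm) (zero_mem 𝒜)
      rw [h.zero, h.jo _ hma _ hrm, haa, hrk, jp_ro_perp hak]
    have h1' : jp (ro b b) (ro r r) = 0 := by
      apply h.bij.injOn (jp_mem hmb hrm) (zero_mem 𝒜)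
      rw [h.zero, h.jo _ hmb _ hrm, hbb, hrk, jp_ro_perp hbk]
    rw [apply_eq_zero_of_jp hk, smul_zero]
    rw [hD, jp_sub, ← hrk, ← h.jo _ hAm _ hrm, hrk, jp_add, jp_add, jp_smul, jp_smul, jp_smul,
      jp_smul, h1, h1', jp_ro_perp hak, jp_ro_perp hbk]
    simp [h.zero]
  ext v
  have h5 := hDk (v - inner ℂ a' v • a' - inner ℂ b' v • b')
    (by simp only [inner_sub_right, inner_smul_right, inner_self_one ha', hab']; ring)
    (by simp only [inner_sub_right, inner_smul_right, inner_self_one hb',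
          inner_eq_zero_symm.1 hab']; ring)
  simpa [hDa, hDb] using h5

theorem JM.f_add (h : JM 𝒜 ℬ Φ) (hf : ∀ l, ∀ A ∈ 𝒜, Φ (l • A) = f l • Φ A)
    (h2 : f (1/2) = 1/2) (hd : ∀ e : H, ∃ g : H, ‖g‖ = 1 ∧ inner ℂ e g = (0:ℂ))
    (α β : ℂ) : f (α + β) = f α + f β := by
  obtain ⟨a, ha, -⟩ := hd 0
  obtain ⟨b, hb, hab⟩ := hd a
  set s : ℂ := (((Real.sqrt 2)⁻¹ : ℝ) : ℂ) with hs
  have hss : s * s = 1/2 := by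
    rw [hs, ← Complex.ofReal_mul, ← mul_inv, Real.mul_self_sqrt (by norm_num)]; norm_num
  have hsc : starRingEnd ℂ s = s := Complex.conj_ofReal _
  have hua : inner ℂ a (s • (a + b)) = s := by
    rw [inner_smul_right, inner_add_right, hab, inner_self_one ha]; ring
  have hub : inner ℂ b (s • (a + b)) = s := by
    rw [inner_smul_right, inner_add_right, inner_eq_zero_symm.1 hab, inner_self_one hb]; ring
  set w := s • (a + b) with hw
  have hww : (inner ℂ w w : ℂ) = 1 := by
    conv_lhs => rw [hw]
    rw [inner_smul_left, inner_add_left, hua, hub, hsc]; linear_combination 2 * hss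
  have hwn : ‖w‖ = 1 := by
    rw [inner_self_eq_norm_sq_to_K] at hww
    have h3 := congrArg norm hww
    simp only [norm_pow, RCLike.norm_ofReal, abs_norm, norm_one] at h3
    nlinarith [norm_nonneg w]
  have hwa : inner ℂ w a = s := by rw [← inner_conj_symm, hua, hsc]
  have hwb : inner ℂ w b = s := by rw [← inner_conj_symm, hub, hsc]
  obtain ⟨u, hu, hue⟩ := h.rankOne hwn
  obtain ⟨g, hg, heg⟩ := hd w
  have hma := h.fa a a
  have hmb := h.fa b b
  have hAm : α • ro a a + β • ro b b ∈ 𝒜 :=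
    add_mem (SMulMemClass.smul_mem _ hma) (SMulMemClass.smul_mem _ hmb)
  have k1 := h.key hf h2 hwn hu hue hg heg hAm
  have k2 := h.key hf h2 hwn hu hue hg heg hma
  have k3 := h.key hf h2 hwn hu hue hg heg hmb
  rw [ro_apply, hua, inner_smul_right, hwa, hss, h2] at k2
  rw [ro_apply, hub, inner_smul_right, hwb, hss, h2] at k3
  rw [h.diag hf ha hb hab] at k1
  simp only [add_apply, smul_apply, inner_add_right, inner_smul_right, k2, k3, ro_apply,
    hua, hub, hwa, hwb, hss] at k1
  rw [← add_mul, ← add_mul, h.f_mul hf ha, h2] at k1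
  linear_combination -2 * k1

theorem JM.add (h : JM 𝒜 ℬ Φ) (hf : ∀ l, ∀ A ∈ 𝒜, Φ (l • A) = f l • Φ A)
    (h2 : f (1/2) = 1/2) (hd : ∀ e : H, ∃ g : H, ‖g‖ = 1 ∧ inner ℂ e g = (0:ℂ))
    {A B : H →L[ℂ] H} (hA : A ∈ 𝒜) (hB : B ∈ 𝒜) : Φ (A + B) = Φ A + Φ B := by
  rw [← sub_eq_zero]
  apply eq_zero_of_inner
  intro k hk
  obtain ⟨e, he, hek⟩ := h.rankOne_surj hk
  obtain ⟨g, hg, heg⟩ := hd e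
  rw [sub_apply, add_apply, inner_sub_right, inner_add_right,
    h.key hf h2 he hk hek hg heg (add_mem hA hB), h.key hf h2 he hk hek hg heg hA,
    h.key hf h2 he hk hek hg heg hB, add_apply, inner_add_right, h.f_add hf h2 hd, sub_self]

theorem ringHom_cases (σ : ℂ →+* ℂ) (hσ : ∀ a, σ (starRingEnd ℂ a) = starRingEnd ℂ (σ a)) :
    σ = RingHom.id ℂ ∨ σ = starRingEnd ℂ := by
  have hre : ∀ r : ℝ, ((σ r).re : ℂ) = σ r := by
    intro r
    rw [← Complex.conj_eq_iff_re, ← hσ, Complex.conj_ofReal]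
  let τ : ℝ →+* ℝ :=
    { toFun := fun r => (σ r).re
      map_one' := by simp
      map_zero' := by simp
      map_add' := fun x y => by simp
      map_mul' := fun x y => by
        have hx : (σ x).im = 0 := by rw [← hre x]; simp
        simp [hx] }
  have hτ : ∀ r, τ r = r := fun r => by
    rw [Subsingleton.elim τ (RingHom.id ℝ)]; rfl
  have hr : ∀ r : ℝ, σ r = r := by
    intro r; rw [← hre r]; exact congrArg _ (hτ r)
  have := Complex.real_algHom_eq_id_or_conj (AlgHom.mk σ hr)
  rcases this with h | h
  · left; ext z; exact congrArg (fun F : ℂ →ₐ[ℝ] ℂ => F z) h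
  · right; ext z; exact congrArg (fun F : ℂ →ₐ[ℝ] ℂ => F z) h

end scalars
end JordanAux
namespace JordanAux
set_option linter.unusedSectionVars false
set_option linter.unusedSimpArgs false

section final
variable {H K : Type*} [NormedAddCommGroup H] [InnerProductSpace ℂ H] [CompleteSpace H]
    [NormedAddCommGroup K] [InnerProductSpace ℂ K] [CompleteSpace K]
variable {𝒜 : NonUnitalSubalgebra ℂ (H →L[ℂ] H)} {ℬ : NonUnitalSubalgebra ℂ (K →L[ℂ] K)}
    {Φ : (H →L[ℂ] H) → (K →L[ℂ] K)}

/-- semilinear Jordan star bijection -/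
structure JL (𝒜 : NonUnitalSubalgebra ℂ (H →L[ℂ] H)) (ℬ : NonUnitalSubalgebra ℂ (K →L[ℂ] K))
    (Φ : (H →L[ℂ] H) → (K →L[ℂ] K)) (σ : ℂ →+* ℂ) : Prop where
  jm : JM 𝒜 ℬ Φ
  hom : ∀ l, ∀ A ∈ 𝒜, Φ (l • A) = σ l • Φ A
  add : ∀ A ∈ 𝒜, ∀ B ∈ 𝒜, Φ (A + B) = Φ A + Φ B
  conj : ∀ a, σ (starRingEnd ℂ a) = starRingEnd ℂ (σ a)
  key : ∀ (e : H) (u : K), ‖e‖ = 1 → ‖u‖ = 1 → Φ (ro e e) = ro u u →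
    ∀ X ∈ 𝒜, inner ℂ u (Φ X u) = σ (inner ℂ e (X e))

theorem sigma_half (σ : ℂ →+* ℂ) : σ (1/2) = 1/2 := by
  rw [map_div₀, map_one, map_ofNat]

theorem JM.exists_JL (h : JM 𝒜 ℬ Φ) (hd : ∀ e : H, ∃ g : H, ‖g‖ = 1 ∧ inner ℂ e g = (0:ℂ)) :
    JL 𝒜 ℬ Φ (RingHom.id ℂ) ∨ JL 𝒜 ℬ Φ (starRingEnd ℂ) := by
  obtain ⟨e, he, -⟩ := hd 0
  obtain ⟨g, hg, heg⟩ := hd e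
  have : Nontrivial H := ⟨e, 0, by rintro rfl; simp at he⟩
  choose f hf using h.hom
  have h2 := h.f_half hf he hg heg
  let σ : ℂ →+* ℂ :=
    { toFun := f
      map_one' := h.f_one hf he
      map_zero' := h.f_zero hf he
      map_add' := h.f_add hf h2 hd
      map_mul' := h.f_mul hf he }
  have hJL : JL 𝒜 ℬ Φ σ :=
    { jm := h
      hom := hf
      add := fun A hA B hB => h.add hf h2 hd hA hB
      conj := h.f_conj hf he
      key := fun e u he hu hue X hX => by
        obtain ⟨g, hg, heg⟩ := hd e
        exact h.key hf h2 he hu hue hg heg hX }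
  rcases ringHom_cases σ hJL.conj with h3 | h3
  · left; rwa [h3] at hJL
  · right; rwa [h3] at hJL

theorem JL.star_comp {σ : ℂ →+* ℂ} (h : JL 𝒜 ℬ Φ σ) :
    JL 𝒜 ℬ (fun A => Φ (star A)) (σ.comp (starRingEnd ℂ)) where
  jm :=
    { fa := h.jm.fa
      fb := h.jm.fb
      sa := h.jm.sa
      sb := h.jm.sb
      bij := by
        refine ⟨fun A hA => h.jm.bij.mapsTo (h.jm.sa A hA), ?_, ?_⟩
        · intro A hA B hB hAB
          exact star_injective (h.jm.bij.injOn (h.jm.sa A hA) (h.jm.sa B hB) hAB)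
        · intro B hB
          obtain ⟨A, hA, hAB⟩ := h.jm.bij.surjOn hB
          exact ⟨star A, h.jm.sa A hA, by simpa using hAB⟩
      st := fun A hA => h.jm.st _ (h.jm.sa A hA)
      jo := fun A hA B hB => by
        simp only [star_jp]
        exact h.jm.jo _ (h.jm.sa A hA) _ (h.jm.sa B hB) }
  hom := fun l A hA => by
    simp only [star_smul]
    exact h.hom _ _ (h.jm.sa A hA)
  add := fun A hA B hB => by
    simp only [star_add]
    exact h.add _ (h.jm.sa A hA) _ (h.jm.sa B hB)
  conj := fun a => by simp [h.conj]
  key := fun e u he hu hue X hX => by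
    simp only [star_ro] at hue
    rw [h.key e u he hu hue _ (h.jm.sa X hX), ContinuousLinearMap.star_eq_adjoint,
      ContinuousLinearMap.adjoint_inner_right, RingHom.comp_apply, inner_conj_symm]

theorem JL.implement {σ : ℂ →+* ℂ} [RingHomInvPair σ σ] [RingHomIsometric σ]
    (h : JL 𝒜 ℬ Φ σ) {e : H} {u : K} (he : ‖e‖ = 1) (hu : ‖u‖ = 1)
    (hue : Φ (ro e e) = ro u u)
    (hx : ∀ x : H, inner ℂ e x = (0:ℂ) → Φ (ro x e) = ro (Φ (ro x e) u) u) :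
    ∃ U : H ≃ₛₗᵢ[σ] K, ∀ A ∈ 𝒜, ∀ k : K, Φ A k = U (A (U.symm k)) := by
  have fa := h.jm.fa
  let V : H →ₛₗ[σ] K :=
    { toFun := fun x => Φ (ro x e) u
      map_add' := fun x y => by
        rw [ro_add_left, h.add _ (fa x e) _ (fa y e)]; rfl
      map_smul' := fun c x => by
        rw [ro_smul_left, h.hom _ _ (fa x e)]; rfl }
  have hVdef : ∀ x, V x = Φ (ro x e) u := fun x => rfl
  have hVe : V e = u := by
    rw [hVdef, hue, ro_apply, inner_self_one hu, one_smul]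
  have hV : ∀ x, Φ (ro x e) = ro (V x) u := by
    intro x
    have h1 : x = inner ℂ e x • e + (x - inner ℂ e x • e) := by abel
    have h2 := hx _ (perp_decomp he x)
    rw [← hVdef] at h2
    conv_rhs => rw [h1]
    conv_lhs => rw [h1]
    rw [ro_add_left, ro_smul_left, h.add _ (SMulMemClass.smul_mem _ (fa e e)) _ (fa _ e),
      h.hom _ _ (fa e e), h2, map_add, ro_add_left, map_smulₛₗ, ro_smul_left, hVe, hue]
  have hV' : ∀ x, Φ (ro e x) = ro u (V x) := by
    intro x
    rw [← star_ro, h.jm.st _ (fa x e), hV, star_ro]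
  have hVu : ∀ x, inner ℂ u (V x) = σ (inner ℂ e x) := by
    intro x
    rw [hVdef, h.key e u he hu hue _ (fa x e), ro_apply, inner_self_one he, one_smul]
  -- the basic identity
  have hid : ∀ x y, Φ (ro x y) + σ (inner ℂ y x) • ro u u
      = ro (V x) (V y) + (inner ℂ (V y) (V x) : ℂ) • ro u u := by
    intro x y
    have h1 := h.jm.jo _ (fa x e) _ (fa e y)
    rw [hV, hV'] at h1
    unfold jp at h1
    rw [mul_ro, mul_ro, mul_ro, mul_ro, ro_apply, ro_apply, ro_apply, ro_apply, inner_self_one he,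
      inner_self_one hu, one_smul, one_smul, h.hom _ _ (add_mem (fa x y) (fa _ e)),
      h.add _ (fa x y) _ (fa _ _), ro_smul_left, ro_smul_left, h.hom _ _ (fa e e), hue] at h1
    have h3 : σ (1/2) = 1/2 := sigma_half σ
    rw [h3] at h1
    exact smul_right_injective _ (by norm_num : (1:ℂ)/2 ≠ 0) h1
  have hin : ∀ x y, (inner ℂ (V y) (V x) : ℂ) = σ (inner ℂ y x) := by
    intro x y
    have h1 := congrArg (fun T : K →L[ℂ] K => (inner ℂ u (T u) : ℂ)) (hid x y)
    simp only [add_apply, smul_apply, inner_add_right, inner_smul_right,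
      h.key e u he hu hue _ (fa x y), ro_apply, inner_self_one hu, hVu, map_mul] at h1
    have h2 : (inner ℂ (V y) u : ℂ) = σ (inner ℂ y e) := by
      rw [← inner_conj_symm, hVu, ← h.conj, inner_conj_symm]
    rw [h2] at h1
    linear_combination -h1
  have hro : ∀ x y, Φ (ro x y) = ro (V x) (V y) := by
    intro x y
    have h1 := hid x y
    rw [hin] at h1
    exact add_right_cancel h1
  have hnorm : ∀ x, ‖V x‖ = ‖x‖ := by
    intro x
    have h1 := congrArg norm (hin x x)
    rw [RingHomIsometric.norm_map, inner_self_eq_norm_sq_to_K, inner_self_eq_norm_sq_to_K] at h1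
    simp only [norm_pow, RCLike.norm_ofReal, abs_norm] at h1
    exact (sq_eq_sq₀ (norm_nonneg _) (norm_nonneg _)).1 h1
  have hsurj : Function.Surjective V := by
    intro k
    obtain ⟨A, hA, hAk⟩ := h.jm.bij.surjOn (h.jm.fb k u)
    have h1 := h.jm.jo _ hA _ (fa e e)
    rw [hAk, hue] at h1
    unfold jp at h1
    rw [mul_ro, ro_mul, h.hom _ _ (add_mem (fa _ _) (fa _ _)), h.add _ (fa _ _) _ (fa _ _), hro,
      hro, hVe, mul_ro, ro_mul, star_ro] at h1
    have h3 : σ (1/2) = 1/2 := sigma_half σ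
    rw [h3] at h1
    have h4 := smul_right_injective _ (by norm_num : (1:ℂ)/2 ≠ 0) h1
    have h5 := congrArg (fun T : K →L[ℂ] K => T u) h4
    simp only [add_apply, ro_apply, inner_self_one hu, one_smul] at h5
    have hu' : u ∈ LinearMap.range V := ⟨e, hVe⟩
    have h6 : k ∈ LinearMap.range V := by
      rw [eq_sub_of_add_eq h5.symm]
      exact sub_mem (add_mem ⟨_, rfl⟩ (Submodule.smul_mem _ _ hu')) (Submodule.smul_mem _ _ hu')
    exact h6
  let U : H ≃ₛₗᵢ[σ] K := LinearIsometryEquiv.ofSurjective ⟨V, hnorm⟩ hsurj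
  have hUV : ∀ x, U x = V x := fun x => rfl
  refine ⟨U, fun A hA => ?_⟩
  let T : K →ₗ[ℂ] K :=
    { toFun := fun k => Φ A k - U (A (U.symm k))
      map_add' := fun x y => by simp only [map_add]; abel
      map_smul' := fun c x => by
        simp only [map_smulₛₗ, map_smul, RingHom.id_apply, smul_sub]
        congr 1
        simp [map_smulₛₗ] }
  have hT : T = 0 := by
    rw [← inner_map_self_eq_zero]
    intro k
    by_cases hk0 : k = 0
    · simp [hk0]
    obtain ⟨c, k, hk, rfl, hc⟩ := exists_unit_smul k hk0
    have h1 : inner ℂ k (T k) = (0:ℂ) := by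
      change inner ℂ k (Φ A k - U (A (U.symm k))) = (0:ℂ)
      have h2 : U (U.symm k) = k := U.apply_symm_apply k
      have h3 : ‖U.symm k‖ = 1 := by rw [U.symm.norm_map, hk]
      have h4 := h.key (U.symm k) k h3 hk (by rw [hro, ← hUV, h2]) A hA
      rw [inner_sub_right, h4, ← hin, ← hUV, ← hUV, h2, sub_self]
    rw [← inner_conj_symm]
    simp [h1, inner_smul_left, inner_smul_right]
  intro k
  have := congrArg (fun S : K →ₗ[ℂ] K => S k) hT
  exact sub_eq_zero.1 this

/-- alternative: type one or type two -/
theorem JL.dichotomy {σ : ℂ →+* ℂ} (h : JL 𝒜 ℬ Φ σ) {e : H} {u : K} (he : ‖e‖ = 1) (hu : ‖u‖ = 1)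
    (hue : Φ (ro e e) = ro u u) :
    (∀ x : H, inner ℂ e x = (0:ℂ) → Φ (ro x e) = ro (Φ (ro x e) u) u) ∨
    (∀ x : H, inner ℂ e x = (0:ℂ) → star (Φ (ro x e)) = ro (star (Φ (ro x e)) u) u) := by
  have fa := h.jm.fa
  -- shape
  have shape : ∀ x : H, inner ℂ e x = (0:ℂ) →
      Φ (ro x e) = ro (Φ (ro x e) u) u + ro u (star (Φ (ro x e)) u) := by
    intro x hx
    have h1 : ro e e * ro x e + ro x e * ro e e = ro x e := by
      rw [mul_ro, mul_ro, ro_apply, ro_apply, hx, inner_self_one he, zero_smul, one_smul]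
      ext z; simp [ro_apply]
    have h2 := h.jm.half h.hom (sigma_half σ) (fa e e) (fa x e) h1
    rw [hue, mul_ro, ro_mul, add_comm] at h2
    exact h2.symm
  have alt : ∀ x : H, inner ℂ e x = (0:ℂ) → Φ (ro x e) u = 0 ∨ star (Φ (ro x e)) u = 0 := by
    intro x hx
    have hs := shape x hx
    have h0 : Φ (ro x e) * Φ (ro x e) = 0 := by
      rw [← jp_self, ← h.jm.jo _ (fa x e) _ (fa x e), jp_self, mul_ro, ro_apply, hx, zero_smul,
        ← h.jm.zero]
      congr 1
      ext z; simp [ro_apply]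
    set N := Φ (ro x e) with hN
    have hk : inner ℂ u (N u) = (0:ℂ) := by
      rw [hN, h.key e u he hu hue _ (fa x e), ro_apply, inner_self_one he, one_smul, hx, map_zero]
    have hk' : inner ℂ u (star N u) = (0:ℂ) := by
      rw [ContinuousLinearMap.star_eq_adjoint, ContinuousLinearMap.adjoint_inner_right,
        inner_eq_zero_symm.1 hk]
    set x1 := N u with hx1
    set x2 := star N u with hx2
    have h3 : N x2 = (inner ℂ x2 x2 : ℂ) • u := by
      rw [hs, add_apply, ro_apply, ro_apply, hk', zero_smul, zero_add]
    have h4 : N (N x2) = 0 := congrArg (fun T : K →L[ℂ] K => T x2) h0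
    rw [h3, map_smul, smul_eq_zero, inner_self_eq_zero] at h4
    exact h4.symm
  by_cases hA : ∀ x : H, inner ℂ e x = (0:ℂ) → star (Φ (ro x e)) u = 0
  · left
    intro x hx
    have h1 := shape x hx
    rw [hA x hx] at h1
    conv_lhs => rw [h1]
    ext z; simp [ro_apply]
  · right
    push Not at hA
    obtain ⟨y, hy, hy0⟩ := hA
    have hB : ∀ x : H, inner ℂ e x = (0:ℂ) → Φ (ro x e) u = 0 := by
      intro x hx
      by_contra hne
      have hx2 := (alt x hx).resolve_left hne
      have hy1 := (alt y hy).resolve_right hy0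
      have h5 := alt (x + y) (by rw [inner_add_right, hx, hy, add_zero])
      rw [ro_add_left, h.add _ (fa x e) _ (fa y e), star_add, add_apply, add_apply, hx2, hy1,
        add_zero, zero_add] at h5
      exact h5.elim hne hy0
    intro x hx
    have h1 := shape x hx
    rw [hB x hx] at h1
    have h2 := congrArg star h1
    rw [star_add, star_ro, star_ro] at h2
    conv_lhs => rw [h2]
    ext z; simp [ro_apply]

theorem exists_perp (hH : 1 < Module.rank ℂ H) (e : H) :
    ∃ g : H, ‖g‖ = 1 ∧ inner ℂ e g = (0:ℂ) := by
  by_contra! hc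
  have h0 : ∀ v : H, inner ℂ e v = (0:ℂ) → v = 0 := by
    intro v hv
    by_contra hne
    obtain ⟨c, w, hw, rfl, hc0⟩ := exists_unit_smul v hne
    rw [inner_smul_right] at hv
    exact hc w hw ((mul_eq_zero.1 hv).resolve_left hc0)
  have h1 : Module.rank ℂ H ≤ 1 := by
    have : Function.Injective (innerSL ℂ e : H →ₗ[ℂ] ℂ) := by
      rw [injective_iff_map_eq_zero]
      intro v hv
      exact h0 v hv
    have h2 := LinearMap.lift_rank_le_of_injective _ this
    simpa using h2
  exact absurd hH (not_lt.2 h1)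

end final
end JordanAux
open JordanAux in
/-- **Corollary 3.** A bijective, `*`-preserving solution of the Jordan equation
`φ((1/2)(AB+BA)) = (1/2)(φ(A)φ(B)+φ(B)φ(A))` between standard operator algebras
(closed under taking adjoints) on complex Hilbert spaces with `dim H > 1` is
implemented by a unitary or antiunitary operator, either directly or composed
with the adjoint operation. -/
theorem jordan_star_maps_standard_operator_algebras
    {H K : Type*} [NormedAddCommGroup H] [InnerProductSpace ℂ H] [CompleteSpace H]
    [NormedAddCommGroup K] [InnerProductSpace ℂ K] [CompleteSpace K]
    (hH : 1 < Module.rank ℂ H)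
    (𝒜 : NonUnitalSubalgebra ℂ (H →L[ℂ] H)) (ℬ : NonUnitalSubalgebra ℂ (K →L[ℂ] K))
    (h𝒜 : ∀ T : H →L[ℂ] H, FiniteDimensional ℂ (LinearMap.range (T : H →ₗ[ℂ] H)) → T ∈ 𝒜)
    (hℬ : ∀ S : K →L[ℂ] K, FiniteDimensional ℂ (LinearMap.range (S : K →ₗ[ℂ] K)) → S ∈ ℬ)
    (h𝒜star : ∀ T ∈ 𝒜, ContinuousLinearMap.adjoint T ∈ 𝒜)
    (hℬstar : ∀ S ∈ ℬ, ContinuousLinearMap.adjoint S ∈ ℬ)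
    (φ : 𝒜 → ℬ) (hbij : Function.Bijective φ)
    (hstar : ∀ A : 𝒜,
      φ ⟨ContinuousLinearMap.adjoint (A : H →L[ℂ] H), h𝒜star _ A.2⟩
        = ⟨ContinuousLinearMap.adjoint ((φ A : K →L[ℂ] K)), hℬstar _ (φ A).2⟩)
    (hJ : ∀ A B : 𝒜, φ (((1:ℂ)/2) • (A * B + B * A))
        = ((1:ℂ)/2) • (φ A * φ B + φ B * φ A)) :
    (∃ U : H ≃ₗᵢ[ℂ] K, ∀ A : 𝒜, ∀ k : K,
        (φ A : K →L[ℂ] K) k = U ((A : H →L[ℂ] H) (U.symm k))) ∨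
    (∃ U : H ≃ₛₗᵢ[starRingEnd ℂ] K, ∀ A : 𝒜, ∀ k : K,
        (φ A : K →L[ℂ] K) k = U ((A : H →L[ℂ] H) (U.symm k))) ∨
    (∃ U : H ≃ₗᵢ[ℂ] K, ∀ A : 𝒜, ∀ k : K,
        (φ A : K →L[ℂ] K) k
          = U (ContinuousLinearMap.adjoint (A : H →L[ℂ] H) (U.symm k))) ∨
    (∃ U : H ≃ₛₗᵢ[starRingEnd ℂ] K, ∀ A : 𝒜, ∀ k : K,
        (φ A : K →L[ℂ] K) k
          = U (ContinuousLinearMap.adjoint (A : H →L[ℂ] H) (U.symm k))) := by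
  classical
  obtain ⟨Φ, hΦ⟩ : ∃ Φ : (H →L[ℂ] H) → (K →L[ℂ] K),
      ∀ A : 𝒜, Φ (A : H →L[ℂ] H) = (φ A : K →L[ℂ] K) :=
    ⟨fun T => if hT : T ∈ 𝒜 then (φ ⟨T, hT⟩ : K →L[ℂ] K) else 0, fun A => by
      simp only [dif_pos A.2]⟩
  have hfin : ∀ {E : Type _} [NormedAddCommGroup E] [InnerProductSpace ℂ E] (x y : E),
      FiniteDimensional ℂ (LinearMap.range ((ro x y : E →L[ℂ] E) : E →ₗ[ℂ] E)) := by
    intro E _ _ x y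
    apply Submodule.finiteDimensional_of_le (S₂ := Submodule.span ℂ {x})
    rintro _ ⟨z, rfl⟩
    exact Submodule.smul_mem _ _ (Submodule.mem_span_singleton_self x)
  have hfin' : ∀ (x y : K),
      FiniteDimensional ℂ (LinearMap.range ((ro x y : K →L[ℂ] K) : K →ₗ[ℂ] K)) := by
    intro x y
    apply Submodule.finiteDimensional_of_le (S₂ := Submodule.span ℂ {x})
    rintro _ ⟨z, rfl⟩
    exact Submodule.smul_mem _ _ (Submodule.mem_span_singleton_self x)
  have hM : JM 𝒜 ℬ Φ :=
    { fa := fun x y => h𝒜 _ (hfin x y)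
      fb := fun x y => hℬ _ (hfin' x y)
      sa := h𝒜star
      sb := hℬstar
      bij := by
        refine ⟨?_, ?_, ?_⟩
        · intro A hA
          rw [hΦ ⟨A, hA⟩]; exact (φ ⟨A, hA⟩).2
        · intro A hA B hB hAB
          rw [hΦ ⟨A, hA⟩, hΦ ⟨B, hB⟩] at hAB
          exact congrArg Subtype.val (hbij.1 (Subtype.ext hAB))
        · intro B hB
          obtain ⟨A, hA⟩ := hbij.2 ⟨B, hB⟩
          exact ⟨A, A.2, by rw [hΦ, hA]⟩
      st := fun A hA => by
        rw [hΦ ⟨A, hA⟩]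
        exact (hΦ ⟨_, h𝒜star A hA⟩).trans (congrArg Subtype.val (hstar ⟨A, hA⟩))
      jo := fun A hA B hB => by
        rw [hΦ ⟨A, hA⟩, hΦ ⟨B, hB⟩]
        have h1 := hΦ (((1:ℂ)/2) • ((⟨A, hA⟩ : 𝒜) * ⟨B, hB⟩ + ⟨B, hB⟩ * ⟨A, hA⟩))
        rw [hJ] at h1
        simp only [NonUnitalSubalgebra.coe_smul, NonUnitalSubalgebra.coe_add,
          NonUnitalSubalgebra.coe_mul] at h1
        exact h1 }
  have hd := exists_perp hH
  obtain ⟨e, he, -⟩ := hd 0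
  obtain ⟨u, hu, hue⟩ := hM.rankOne he
  have hue' : Φ (star (ro e e)) = ro u u := by rw [star_ro]; exact hue
  have conv : ∀ A : 𝒜, Φ (star (ContinuousLinearMap.adjoint (A : H →L[ℂ] H))) = φ A := by
    intro A
    rw [← hΦ, ← ContinuousLinearMap.star_eq_adjoint, star_star]
  have tr : (∀ x : H, inner ℂ e x = (0:ℂ) → star (Φ (ro x e)) = ro (star (Φ (ro x e)) u) u) →
      ∀ x : H, inner ℂ e x = (0:ℂ) → (fun A => Φ (star A)) (ro x e)
        = ro ((fun A => Φ (star A)) (ro x e) u) u := by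
    intro h x hx
    have h1 := h x hx
    rw [← hM.st _ (hM.fa x e)] at h1
    exact h1
  rcases hM.exists_JL hd with h | h
  · rcases h.dichotomy he hu hue with h1 | h1
    · left
      obtain ⟨U, hU⟩ := h.implement he hu hue h1
      exact ⟨U, fun A k => by rw [← hΦ]; exact hU A A.2 k⟩
    · right; right; right
      have h2 := h.star_comp
      rw [RingHom.id_comp] at h2
      obtain ⟨U, hU⟩ := h2.implement he hu hue' (tr h1)
      exact ⟨U, fun A k => by rw [← conv]; exact hU _ (h𝒜star _ A.2) k⟩
  · rcases h.dichotomy he hu hue with h1 | h1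
    · right; left
      obtain ⟨U, hU⟩ := h.implement he hu hue h1
      exact ⟨U, fun A k => by rw [← hΦ]; exact hU A A.2 k⟩
    · right; right; left
      have h2 := h.star_comp
      have h3 : (starRingEnd ℂ).comp (starRingEnd ℂ) = RingHom.id ℂ := by ext z; simp
      rw [h3] at h2
      obtain ⟨U, hU⟩ := h2.implement he hu hue' (tr h1)
      exact ⟨U, fun A k => by rw [← conv]; exact hU _ (h𝒜star _ A.2) k⟩
end

section
/- Let H and K be complex Hilbert spaces with dim H > 1, and let 𝒜 ⊆ B(H) and ℬ ⊆ B(K) be standard operator algebras which are closed under taking adjoints. Suppose φ : 𝒜 → ℬ is a bijective transformation satisfying φ(A*) = φ(A)* and φ(AB+BA) = φ(A)φ(B)+φ(B)φ(A) for all A, B ∈ 𝒜. Then one of the following holds: (i) there exists a unitary operator U : H → K such that φ(A) = U A U* for all A ∈ 𝒜; (ii) there exists an antiunitary operator U : H → K such that φ(A) = U A U* for all A ∈ 𝒜; (iii) there exists a unitary operator U : H → K such that φ(A) = U A* U* for all A ∈ 𝒜; (iv) there exists an antiunitary operator U : H → K such that φ(A) = U A* U* for all A ∈ 𝒜. -/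
open scoped ComplexOrder

set_option linter.unusedSimpArgs false

namespace JordanAux

structure JC {R R' : Type*} [Ring R] [Ring R'] (S : NonUnitalSubring R) (e f : R) (φ : R → R') :
    Prop where
  ee : e * e = e
  ff : f * f = f
  ef : e * f = 0
  fe : f * e = 0
  sum : e + f = 1
  mem : e ∈ S
  e0 : e ≠ 0
  f0 : f ≠ 0
  prime : ∀ a b : R, (∀ t ∈ S, a * t * b = 0) → a = 0 ∨ b = 0
  two : ∀ x : R, x + x = 0 → x = 0
  mul : ∀ a ∈ S, ∀ b ∈ S, φ (a * b + b * a) = φ a * φ b + φ b * φ a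
  inj : ∀ a ∈ S, ∀ b ∈ S, φ a = φ b → a = b
  sur : ∀ a ∈ S, ∀ b ∈ S, ∃ s ∈ S, φ s = φ a + φ b
  zero : φ 0 = 0
  c3 : ∀ a ∈ S, ∃ t ∈ S, e * a * f * t * f = e * a * f
  c3' : ∀ a ∈ S, ∃ t ∈ S, f * t * f * a * e = f * a * e

namespace JC
variable {R R' : Type*} [Ring R] [Ring R'] {S : NonUnitalSubring R} {e f : R} {φ : R → R'}

theorem ee' (h : JC S e f φ) (x : R) : e * (e * x) = e * x := by rw [← mul_assoc, h.ee]
theorem ff' (h : JC S e f φ) (x : R) : f * (f * x) = f * x := by rw [← mul_assoc, h.ff]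
theorem ef' (h : JC S e f φ) (x : R) : e * (f * x) = 0 := by rw [← mul_assoc, h.ef, zero_mul]
theorem fe' (h : JC S e f φ) (x : R) : f * (e * x) = 0 := by rw [← mul_assoc, h.fe, zero_mul]

theorem m11 (h : JC S e f φ) {a : R} (ha : a ∈ S) : e * a * e ∈ S :=
  S.mul_mem (S.mul_mem h.mem ha) h.mem
theorem f_eq (h : JC S e f φ) : f = 1 - e := by rw [← h.sum]; abel
theorem m12 (h : JC S e f φ) {a : R} (ha : a ∈ S) : e * a * f ∈ S := by
  have : e * a * f = e * a - e * a * e := by rw [h.f_eq]; noncomm_ring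
  rw [this]; exact S.sub_mem (S.mul_mem h.mem ha) (h.m11 ha)
theorem m21 (h : JC S e f φ) {a : R} (ha : a ∈ S) : f * a * e ∈ S := by
  have : f * a * e = a * e - e * a * e := by rw [h.f_eq]; noncomm_ring
  rw [this]; exact S.sub_mem (S.mul_mem ha h.mem) (h.m11 ha)
theorem m22 (h : JC S e f φ) {a : R} (ha : a ∈ S) : f * a * f ∈ S := by
  have : f * a * f = a - e * a - f * a * e := by rw [h.f_eq]; noncomm_ring
  rw [this]; exact S.sub_mem (S.sub_mem ha (S.mul_mem h.mem ha)) (h.m21 ha)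

theorem mj {a b : R} (ha : a ∈ S) (hb : b ∈ S) : a * b + b * a ∈ S :=
  S.add_mem (S.mul_mem ha hb) (S.mul_mem hb ha)

/-- decomposition -/
theorem dec (h : JC S e f φ) (d : R) :
    d = f * d * f + (e * d * e + (e * d * f + f * d * e)) := by
  rw [h.f_eq]; noncomm_ring

theorem ext4 (h : JC S e f φ) {s a : R} (h1 : e * (s - a) * e = 0) (h2 : e * (s - a) * f = 0)
    (h3 : f * (s - a) * e = 0) (h4 : f * (s - a) * f = 0) : s = a := by
  rw [← sub_eq_zero, h.dec (s - a), h1, h2, h3, h4]; simp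

theorem push (h : JC S e f φ) {s a b t : R} (hs : s ∈ S) (ha : a ∈ S) (hb : b ∈ S) (ht : t ∈ S)
    (he : φ s = φ a + φ b) :
    φ (s * t + t * s) = φ (a * t + t * a) + φ (b * t + t * b) := by
  rw [h.mul _ hs _ ht, h.mul _ ha _ ht, h.mul _ hb _ ht, he]; noncomm_ring

theorem key (h : JC S e f φ) {s a b t : R} (hs : s ∈ S) (ha : a ∈ S) (hb : b ∈ S) (ht : t ∈ S)
    (he : φ s = φ a + φ b)
    (hA : φ ((a * t + t * a) + (b * t + t * b)) = φ (a * t + t * a) + φ (b * t + t * b)) :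
    (s - (a + b)) * t + t * (s - (a + b)) = 0 := by
  have := h.inj _ (mj hs ht) _ (S.add_mem (mj ha ht) (mj hb ht))
    ((h.push hs ha hb ht he).trans hA.symm)
  have h2 : (s - (a + b)) * t + t * (s - (a + b))
    = (s * t + t * s) - ((a * t + t * a) + (b * t + t * b)) := by noncomm_ring
  rw [h2, this, sub_self]

theorem key_l (h : JC S e f φ) {s a b t : R} (hs : s ∈ S) (ha : a ∈ S) (hb : b ∈ S) (ht : t ∈ S)
    (he : φ s = φ a + φ b) (h0 : a * t + t * a = 0) :
    (s - (a + b)) * t + t * (s - (a + b)) = 0 :=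
  h.key hs ha hb ht he (by rw [h0, h.zero, zero_add, zero_add])

theorem key_r (h : JC S e f φ) {s a b t : R} (hs : s ∈ S) (ha : a ∈ S) (hb : b ∈ S) (ht : t ∈ S)
    (he : φ s = φ a + φ b) (h0 : b * t + t * b = 0) :
    (s - (a + b)) * t + t * (s - (a + b)) = 0 :=
  h.key hs ha hb ht he (by rw [h0, h.zero, add_zero, add_zero])

theorem rP (h : JC S e f φ) {d : R} (hd : d * e + e * d = 0) :
    e * d * e = 0 ∧ e * d * f = 0 ∧ f * d * e = 0 := by
  refine ⟨?_, ?_, ?_⟩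
  · apply h.two
    have := congrArg (fun x => e * x * e) hd
    simpa [mul_add, add_mul, mul_assoc, h.ee, h.ee'] using this
  · have := congrArg (fun x => e * x * f) hd
    simpa [mul_add, add_mul, mul_assoc, h.ee, h.ee', h.ef] using this
  · have := congrArg (fun x => f * x * e) hd
    simpa [mul_add, add_mul, mul_assoc, h.ee, h.ee', h.ef, h.fe'] using this

theorem r22 (h : JC S e f φ) {d : R}
    (hd : ∀ t ∈ S, d * (f * t * f) + (f * t * f) * d = 0) :
    e * d * f = 0 ∧ f * d * e = 0 ∧ f * d * f = 0 := by
  refine ⟨?_, ?_, ?_⟩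
  · refine (h.prime (e * d * f) f fun t ht => ?_).resolve_right h.f0
    have := congrArg (fun x => e * x) (hd t ht)
    simpa [mul_add, add_mul, mul_assoc, h.ef'] using this
  · refine (h.prime f (f * d * e) fun t ht => ?_).resolve_left h.f0
    have := congrArg (fun x => x * e) (hd t ht)
    simpa [mul_add, add_mul, mul_assoc, h.fe, h.ff'] using this
  · have hx : ∀ t ∈ S, (f * d * f) * (f * t * f) = - ((f * t * f) * (f * d * f)) := by
      intro t ht
      have := congrArg (fun x => f * x * f) (hd t ht)
      rw [eq_neg_iff_add_eq_zero]
      simpa [mul_add, add_mul, mul_assoc, h.ff, h.ff'] using this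
    have h3 : ∀ t ∈ S, ∀ s ∈ S, (f * t * f) * (f * s * f) * (f * d * f) = 0 := by
      intro t ht s hs
      apply h.two
      have h1 := hx (t * f * s) (by
        have : t * f * s = t * s - t * e * s := by rw [h.f_eq]; noncomm_ring
        rw [this]
        exact S.sub_mem (S.mul_mem ht hs) (S.mul_mem (S.mul_mem ht h.mem) hs))
      have h2 : (f * d * f) * (f * t * f) * (f * s * f) =
          (f * t * f) * (f * s * f) * (f * d * f) := by
        rw [hx t ht, neg_mul, mul_assoc, hx s hs, mul_neg, neg_neg, ← mul_assoc]
      have h4 : (f * t * f) * (f * s * f) = f * (t * f * s) * f := by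
        simp [mul_assoc, h.ff']
      rw [mul_assoc, h4, h1, ← h4] at h2
      nth_rw 1 [← h2]; simp
    have h5 : ∀ t ∈ S, f * t * (f * d * f) = 0 := by
      intro t ht
      refine (h.prime (f * t * f) (f * d * f) fun s hs => ?_).elim (fun h0 => ?_) fun h0 => ?_
      · simpa [mul_assoc, h.ff'] using h3 t ht s hs
      · have := congrArg (fun x => x * (d * f)) h0
        simpa [mul_assoc] using this
      · rw [h0, mul_zero]
    exact (h.prime _ _ h5).resolve_left h.f0

/-- consequences of d ∘ (e t f) = 0 -/
theorem r12a (h : JC S e f φ) {d : R}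
    (hd : ∀ t ∈ S, d * (e * t * f) + (e * t * f) * d = 0) : f * d * e = 0 := by
  refine (h.prime e (f * d * e) fun t ht => ?_).resolve_left h.e0
  have := congrArg (fun x => x * e) (hd t ht)
  simpa [mul_add, add_mul, mul_assoc, h.fe, h.ff'] using this

theorem r21a (h : JC S e f φ) {d : R}
    (hd : ∀ t ∈ S, d * (f * t * e) + (f * t * e) * d = 0) : e * d * f = 0 := by
  refine (h.prime f (e * d * f) fun t ht => ?_).resolve_left h.f0
  have := congrArg (fun x => x * f) (hd t ht)
  simpa [mul_add, add_mul, mul_assoc, h.ef, h.ee'] using this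

theorem r12b (h : JC S e f φ) {d : R}
    (hd : ∀ t ∈ S, d * (e * t * f) + (e * t * f) * d = 0) (h0 : f * d * f = 0) :
    e * d * e = 0 := by
  refine (h.prime (e * d * e) f fun t ht => ?_).resolve_right h.f0
  have := congrArg (fun x => e * x * f) (hd t ht)
  rw [mul_assoc] at h0
  simpa [mul_add, add_mul, mul_assoc, h.ff, h.ee', h0] using this

theorem r12c (h : JC S e f φ) {d : R}
    (hd : ∀ t ∈ S, d * (e * t * f) + (e * t * f) * d = 0) (h0 : e * d * e = 0) :
    f * d * f = 0 := by
  refine (h.prime e (f * d * f) fun t ht => ?_).resolve_left h.e0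
  have := congrArg (fun x => e * x * f) (hd t ht)
  have h1 : ∀ x, e * (d * (e * x)) = 0 := fun x => by
    have := congrArg (fun y => y * x) h0
    simpa [mul_assoc] using this
  simpa [mul_add, add_mul, mul_assoc, h.ff, h.ee', h1] using this

theorem r21b (h : JC S e f φ) {d : R}
    (hd : ∀ t ∈ S, d * (f * t * e) + (f * t * e) * d = 0) (h0 : f * d * f = 0) :
    e * d * e = 0 := by
  refine (h.prime f (e * d * e) fun t ht => ?_).resolve_left h.f0
  have := congrArg (fun x => f * x * e) (hd t ht)
  have h1 : ∀ x, f * (d * (f * x)) = 0 := fun x => by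
    have := congrArg (fun y => y * x) h0
    simpa [mul_assoc] using this
  simpa [mul_add, add_mul, mul_assoc, h.ee, h.ff', h1] using this

theorem r21c (h : JC S e f φ) {d : R}
    (hd : ∀ t ∈ S, d * (f * t * e) + (f * t * e) * d = 0) (h0 : e * d * e = 0) :
    f * d * f = 0 := by
  refine (h.prime (f * d * f) e fun t ht => ?_).resolve_right h.e0
  have := congrArg (fun x => f * x * e) (hd t ht)
  rw [mul_assoc] at h0
  simpa [mul_add, add_mul, mul_assoc, h.ee, h.ff', h0] using this

theorem s11_12 (h : JC S e f φ) {a b : R} (ha : a ∈ S) (hb : b ∈ S) :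
    φ (e * a * e + e * b * f) = φ (e * a * e) + φ (e * b * f) := by
  obtain ⟨s, hs, he⟩ := h.sur _ (h.m11 ha) _ (h.m12 hb)
  rw [← he]; congr 1; symm
  obtain ⟨h1, h2, h3⟩ := h.r22 (d := s - (e * a * e + e * b * f)) fun t ht =>
    h.key_l hs (h.m11 ha) (h.m12 hb) (h.m22 ht) he (by simp [mul_assoc, h.ef', h.fe'])
  refine h.ext4 ?_ h1 h2 h3
  exact h.r12b (fun t ht => h.key_r hs (h.m11 ha) (h.m12 hb) (h.m12 ht) he
    (by simp [mul_assoc, h.fe'])) h3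

theorem s11_21 (h : JC S e f φ) {a b : R} (ha : a ∈ S) (hb : b ∈ S) :
    φ (e * a * e + f * b * e) = φ (e * a * e) + φ (f * b * e) := by
  obtain ⟨s, hs, he⟩ := h.sur _ (h.m11 ha) _ (h.m21 hb)
  rw [← he]; congr 1; symm
  obtain ⟨h1, h2, h3⟩ := h.r22 (d := s - (e * a * e + f * b * e)) fun t ht =>
    h.key_l hs (h.m11 ha) (h.m21 hb) (h.m22 ht) he (by simp [mul_assoc, h.ef', h.fe'])
  refine h.ext4 ?_ h1 h2 h3
  exact h.r21b (fun t ht => h.key_r hs (h.m11 ha) (h.m21 hb) (h.m21 ht) he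
    (by simp [mul_assoc, h.ef'])) h3

theorem s22_12 (h : JC S e f φ) {a b : R} (ha : a ∈ S) (hb : b ∈ S) :
    φ (f * a * f + e * b * f) = φ (f * a * f) + φ (e * b * f) := by
  obtain ⟨s, hs, he⟩ := h.sur _ (h.m22 ha) _ (h.m12 hb)
  rw [← he]; congr 1; symm
  obtain ⟨h1, h2, h3⟩ := h.rP (d := s - (f * a * f + e * b * f)) (
    h.key_l hs (h.m22 ha) (h.m12 hb) h.mem he (by simp [mul_assoc, h.ef', h.fe]))
  refine h.ext4 h1 h2 h3 ?_
  exact h.r12c (fun t ht => h.key_r hs (h.m22 ha) (h.m12 hb) (h.m12 ht) he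
    (by simp [mul_assoc, h.fe'])) h1

theorem s22_21 (h : JC S e f φ) {a b : R} (ha : a ∈ S) (hb : b ∈ S) :
    φ (f * a * f + f * b * e) = φ (f * a * f) + φ (f * b * e) := by
  obtain ⟨s, hs, he⟩ := h.sur _ (h.m22 ha) _ (h.m21 hb)
  rw [← he]; congr 1; symm
  obtain ⟨h1, h2, h3⟩ := h.rP (d := s - (f * a * f + f * b * e)) (
    h.key_l hs (h.m22 ha) (h.m21 hb) h.mem he (by simp [mul_assoc, h.ef', h.fe]))
  refine h.ext4 h1 h2 h3 ?_
  exact h.r21c (fun t ht => h.key_r hs (h.m22 ha) (h.m21 hb) (h.m21 ht) he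
    (by simp [mul_assoc, h.ef'])) h1

theorem quad (h : JC S e f φ) {p q r s : R} (hp : p ∈ S) (hq : q ∈ S) (hr : r ∈ S) (hs : s ∈ S)
    (h1 : φ (p + q) = φ p + φ q) (h2 : φ (r + s) = φ r + φ s) :
    φ ((p + q) * (r + s) + (r + s) * (p + q)) = φ (p * r + r * p) + φ (p * s + s * p) +
      φ (q * r + r * q) + φ (q * s + s * q) := by
  rw [h.mul _ (S.add_mem hp hq) _ (S.add_mem hr hs), h.mul _ hp _ hr, h.mul _ hp _ hs,
    h.mul _ hq _ hr, h.mul _ hq _ hs, h1, h2]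
  noncomm_ring

theorem s12 (h : JC S e f φ) {a b : R} (ha : a ∈ S) (hb : b ∈ S) :
    φ (e * a * f + e * b * f) = φ (e * a * f) + φ (e * b * f) := by
  obtain ⟨t, ht, hat⟩ := h.c3 a ha
  have hat' : e * (a * (f * (t * f))) = e * (a * f) := by simpa [mul_assoc] using hat
  have h1 := h.s11_12 h.mem ha
  have e1 : e * e * e = e := by rw [h.ee, h.ee]
  rw [e1] at h1
  have h3 := h.quad h.mem (h.m12 ha) (h.m22 ht) (h.m12 hb) h1 (h.s22_12 ht hb)
  simp only [mul_add, add_mul, mul_assoc, h.ee, h.ee', h.ff, h.ff', h.ef, h.ef', h.fe, h.fe', hat',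
    mul_zero, add_zero, zero_add, h.zero] at h3 ⊢
  rw [h3, add_comm]

theorem s21 (h : JC S e f φ) {a b : R} (ha : a ∈ S) (hb : b ∈ S) :
    φ (f * a * e + f * b * e) = φ (f * a * e) + φ (f * b * e) := by
  obtain ⟨t, ht, hat⟩ := h.c3' a ha
  have hat' : f * (t * (f * (a * e))) = f * (a * e) := by simpa [mul_assoc] using hat
  have h1 := h.s11_21 h.mem ha
  have e1 : e * e * e = e := by rw [h.ee, h.ee]
  rw [e1] at h1
  have h3 := h.quad h.mem (h.m21 ha) (h.m22 ht) (h.m21 hb) h1 (h.s22_21 ht hb)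
  simp only [mul_add, add_mul, mul_assoc, h.ee, h.ee', h.ff, h.ff', h.ef, h.ef', h.fe, h.fe', hat',
    mul_zero, add_zero, zero_add, h.zero] at h3 ⊢
  rw [add_comm, h3, add_comm]

theorem s11 (h : JC S e f φ) {a b : R} (ha : a ∈ S) (hb : b ∈ S) :
    φ (e * a * e + e * b * e) = φ (e * a * e) + φ (e * b * e) := by
  obtain ⟨s, hs, he⟩ := h.sur _ (h.m11 ha) _ (h.m11 hb)
  rw [← he]; congr 1; symm
  obtain ⟨h1, h2, h3⟩ := h.r22 (d := s - (e * a * e + e * b * e)) fun t ht =>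
    h.key_l hs (h.m11 ha) (h.m11 hb) (h.m22 ht) he (by simp [mul_assoc, h.ef', h.fe'])
  refine h.ext4 ?_ h1 h2 h3
  refine h.r12b (fun t ht => h.key hs (h.m11 ha) (h.m11 hb) (h.m12 ht) he ?_) h3
  have := h.s12 (S.mul_mem (S.mul_mem ha h.mem) ht) (S.mul_mem (S.mul_mem hb h.mem) ht)
  simpa [mul_assoc, h.ee', h.fe'] using this

theorem s22 (h : JC S e f φ) {a b : R} (ha : a ∈ S) (hb : b ∈ S) :
    φ (f * a * f + f * b * f) = φ (f * a * f) + φ (f * b * f) := by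
  obtain ⟨s, hs, he⟩ := h.sur _ (h.m22 ha) _ (h.m22 hb)
  rw [← he]; congr 1; symm
  obtain ⟨h1, h2, h3⟩ := h.rP (d := s - (f * a * f + f * b * f)) (
    h.key_l hs (h.m22 ha) (h.m22 hb) h.mem he (by simp [mul_assoc, h.ef', h.fe]))
  refine h.ext4 h1 h2 h3 ?_
  refine h.r12c (fun t ht => h.key hs (h.m22 ha) (h.m22 hb) (h.m12 ht) he ?_) h1
  have := h.s12 (S.mul_mem ht (h.m22 ha)) (S.mul_mem ht (h.m22 hb))
  simpa [mul_assoc, h.ff, h.ff', h.fe'] using this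

theorem s12_21 (h : JC S e f φ) {a b : R} (ha : a ∈ S) (hb : b ∈ S) :
    φ (e * a * f + f * b * e) = φ (e * a * f) + φ (f * b * e) := by
  obtain ⟨s, hs, he⟩ := h.sur _ (h.m12 ha) _ (h.m21 hb)
  rw [← he]; congr 1; symm
  have h0 := h.push hs (h.m12 ha) (h.m21 hb) h.mem he
  have h00 : s * e + e * s = s := by
    apply h.inj _ (mj hs h.mem) _ hs
    rw [h0, he]
    simp [mul_assoc, h.ee, h.ee', h.fe, h.ef']
  have k1 : e * s * e = 0 := by
    have := congrArg (fun x => e * x * e) h00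
    simpa [mul_assoc, mul_add, add_mul, h.ee, h.ee'] using this
  have k2 : f * s * f = 0 := by
    have := congrArg (fun x => f * x * f) h00
    simpa [mul_assoc, mul_add, add_mul, h.ef, h.fe'] using this.symm
  rw [mul_assoc] at k1 k2
  refine h.ext4 ?_ ?_ ?_ ?_
  · simp [mul_sub, sub_mul, mul_add, add_mul, mul_assoc, k1, h.fe, h.ef']
  · exact h.r21a fun t ht => h.key_r hs (h.m12 ha) (h.m21 hb) (h.m21 ht) he
      (by simp [mul_assoc, h.ef'])
  · exact h.r12a fun t ht => h.key_l hs (h.m12 ha) (h.m21 hb) (h.m12 ht) he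
      (by simp [mul_assoc, h.fe'])
  · simp [mul_sub, sub_mul, mul_add, add_mul, mul_assoc, k2, h.fe', h.ef]

theorem s3 (h : JC S e f φ) {a b c : R} (ha : a ∈ S) (hb : b ∈ S) (hc : c ∈ S) :
    φ (e * a * e + (e * b * f + f * c * e)) = φ (e * a * e) + φ (e * b * f + f * c * e) := by
  have hm := S.add_mem (h.m12 hb) (h.m21 hc)
  obtain ⟨s, hs, he⟩ := h.sur _ (h.m11 ha) _ hm
  rw [← he]; congr 1; symm
  obtain ⟨h1, h2, h3⟩ := h.r22 (d := s - (e * a * e + (e * b * f + f * c * e))) fun t ht =>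
    h.key_l hs (h.m11 ha) hm (h.m22 ht) he (by simp [mul_assoc, h.ef', h.fe'])
  refine h.ext4 ?_ h1 h2 h3
  set d := s - (e * a * e + (e * b * f + f * c * e)) with hd
  have hk : ∀ t ∈ S, (d * (e * t * f) + (e * t * f) * d) * e
      + e * (d * (e * t * f) + (e * t * f) * d) = 0 := by
    intro t ht
    have hT := h.m12 ht
    have h5 := h.push hs (h.m11 ha) hm hT he
    have h6 := h.key (mj hs hT) (mj (h.m11 ha) hT) (mj hm hT) h.mem h5 (by
      have := h.s11_12 (a := t * f * c + t * f * c) (b := a * e * t)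
        (by
          have : t * f * c = t * c - t * e * c := by rw [h.f_eq]; noncomm_ring
          have h2 : t * f * c ∈ S := by
            rw [this]
            exact S.sub_mem (S.mul_mem ht hc) (S.mul_mem (S.mul_mem ht h.mem) hc)
          exact S.add_mem h2 h2)
        (S.mul_mem (S.mul_mem ha h.mem) ht)
      rw [add_comm, add_comm (φ _)] at this
      simpa [mul_add, add_mul, mul_assoc, h.ee, h.ff, h.fe, h.ee', h.ff', h.fe', h.ef'] using this)
    rw [← h6, hd]; noncomm_ring
  refine (h.prime (e * d * e) f fun t ht => ?_).resolve_right h.f0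
  have := congrArg (fun x => e * x * f) (hk t ht)
  rw [mul_assoc] at h3
  simpa [mul_add, add_mul, mul_assoc, h.ff, h.ee', h.ef, h3] using this

theorem s4 (h : JC S e f φ) {a b c g : R} (ha : a ∈ S) (hb : b ∈ S) (hc : c ∈ S) (hg : g ∈ S) :
    φ (f * g * f + (e * a * e + (e * b * f + f * c * e))) =
      φ (f * g * f) + φ (e * a * e + (e * b * f + f * c * e)) := by
  have hm := S.add_mem (h.m11 ha) (S.add_mem (h.m12 hb) (h.m21 hc))
  obtain ⟨s, hs, he⟩ := h.sur _ (h.m22 hg) _ hm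
  rw [← he]; congr 1; symm
  obtain ⟨h1, h2, h3⟩ := h.rP (d := s - (f * g * f + (e * a * e + (e * b * f + f * c * e)))) (
    h.key_l hs (h.m22 hg) hm h.mem he (by simp [mul_assoc, h.ef', h.fe]))
  refine h.ext4 h1 h2 h3 ?_
  set d := s - (f * g * f + (e * a * e + (e * b * f + f * c * e))) with hd
  have hk : ∀ t ∈ S, (d * (e * t * f) + (e * t * f) * d) * e
      + e * (d * (e * t * f) + (e * t * f) * d) = 0 := by
    intro t ht
    have hT := h.m12 ht
    have h5 := h.push hs (h.m22 hg) hm hT he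
    have h6 := h.key (mj hs hT) (mj (h.m22 hg) hT) (mj hm hT) h.mem h5 (by
      have hx : t * f * c + t * f * c ∈ S := by
        have : t * f * c = t * c - t * e * c := by rw [h.f_eq]; noncomm_ring
        have h2 : t * f * c ∈ S := by
          rw [this]
          exact S.sub_mem (S.mul_mem ht hc) (S.mul_mem (S.mul_mem ht h.mem) hc)
        exact S.add_mem h2 h2
      have hy : a * e * t ∈ S := S.mul_mem (S.mul_mem ha h.mem) ht
      have hz : t * (f * g * f) ∈ S := S.mul_mem ht (h.m22 hg)
      have q1 := h.s11_12 hx hy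
      have q2 := h.s11_12 hx (S.add_mem hz hy)
      have q3 := h.s12 hz hy
      have q4 : φ (e * (t * (f * g * f)) * f + (e * (t * f * c + t * f * c) * e
          + e * (a * e * t) * f)) = φ (e * (t * (f * g * f)) * f)
          + φ (e * (t * f * c + t * f * c) * e + e * (a * e * t) * f) := by
        rw [q1, add_left_comm (φ _), ← q3, add_left_comm]
        simpa only [mul_add, add_mul] using q2
      simpa [mul_add, add_mul, mul_assoc, h.ee, h.ff, h.fe, h.ee', h.ff', h.fe', h.ef', add_comm,
        add_left_comm] using q4)
    rw [← h6, hd]; noncomm_ring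
  refine (h.prime e (f * d * f) fun t ht => ?_).resolve_left h.e0
  have := congrArg (fun x => e * x * f) (hk t ht)
  have h1' : ∀ x, e * (d * (e * x)) = 0 := fun x => by
    have := congrArg (fun y => y * x) h1
    simpa [mul_assoc] using this
  simpa [mul_add, add_mul, mul_assoc, h.ff, h.ee', h.ef, h1'] using this

theorem phi_dec (h : JC S e f φ) {d : R} (hd : d ∈ S) :
    φ d = φ (f * d * f) + (φ (e * d * e) + (φ (e * d * f) + φ (f * d * e))) := by
  rw [← h.s12_21 hd hd, ← h.s3 hd hd hd, ← h.s4 hd hd hd hd, ← h.dec]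

theorem add (h : JC S e f φ) {a b : R} (ha : a ∈ S) (hb : b ∈ S) : φ (a + b) = φ a + φ b := by
  rw [h.phi_dec ha, h.phi_dec hb, h.phi_dec (S.add_mem ha hb)]
  simp only [mul_add, add_mul]
  rw [h.s11 ha hb, h.s12 ha hb, h.s21 ha hb, h.s22 ha hb]
  abel

end JC
end JordanAux

set_option linter.unusedSectionVars false

namespace JordanAux
open InnerProductSpace ContinuousLinearMap

theorem ringHom_star {σ : ℂ →+* ℂ} (h : ∀ z, σ (starRingEnd ℂ z) = starRingEnd ℂ (σ z)) :
    (∀ z, σ z = z) ∨ (∀ z, σ z = starRingEnd ℂ z) := by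
  have hre : ∀ r : ℝ, ((σ (r : ℂ)).re : ℂ) = σ r := fun r => by
    rw [← Complex.conj_eq_iff_re, ← h, Complex.conj_ofReal]
  let τ : ℝ →+* ℝ :=
    { toFun := fun r => (σ (r : ℂ)).re
      map_one' := by simp
      map_zero' := by simp
      map_add' := fun a b => by simp
      map_mul' := fun a b => by
        have h1 := hre a
        have h2 := hre b
        have : ((σ ((a * b : ℝ) : ℂ)).re : ℂ) = ((σ (a : ℂ)).re * (σ (b : ℂ)).re : ℝ) := by
          rw [hre, Complex.ofReal_mul, Complex.ofReal_mul, map_mul, h1, h2]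
        exact_mod_cast this }
  have hτ : ∀ r : ℝ, σ (r : ℂ) = r := fun r => by
    rw [← hre]
    have : τ = RingHom.id ℝ := Subsingleton.elim _ _
    have h3 : (σ (r : ℂ)).re = r := congrArg (fun g : ℝ →+* ℝ => g r) this
    rw [h3]
  have hI : σ Complex.I = Complex.I ∨ σ Complex.I = -Complex.I := by
    have : σ Complex.I * σ Complex.I = Complex.I * Complex.I := by
      rw [← map_mul, Complex.I_mul_I]; simp
    exact mul_self_eq_mul_self_iff.mp this
  have hd : ∀ z : ℂ, σ z = z.re + z.im * σ Complex.I := fun z => by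
    conv_lhs => rw [← Complex.re_add_im z]
    rw [map_add, map_mul, hτ, hτ]
  rcases hI with hI | hI
  · left; intro z; rw [hd, hI, Complex.re_add_im]
  · right; intro z; rw [hd, hI]; apply Complex.ext <;> simp

variable {H K : Type*} [NormedAddCommGroup H] [InnerProductSpace ℂ H] [CompleteSpace H]
    [NormedAddCommGroup K] [InnerProductSpace ℂ K] [CompleteSpace K]

theorem rankOne_fin (x y : H) :
    FiniteDimensional ℂ (LinearMap.range (rankOne ℂ x y : H →ₗ[ℂ] H)) := by
  refine Submodule.finiteDimensional_of_le (S₂ := Submodule.span ℂ {x}) ?_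
  rintro _ ⟨v, rfl⟩
  simpa using Submodule.smul_mem _ _ (Submodule.mem_span_singleton_self x)

theorem rr (x y z w : H) : rankOne ℂ x y * rankOne ℂ z w = inner ℂ y z • rankOne ℂ x w := by
  ext v; simp [smul_smul, mul_comm]

theorem compress (x : H) (a : H →L[ℂ] H) :
    rankOne ℂ x x * a * rankOne ℂ x x = inner ℂ x (a x) • rankOne ℂ x x := by
  ext v; simp [smul_smul, mul_comm]

theorem inner_one {x : H} (hx : ‖x‖ = 1) : inner ℂ x x = (1 : ℂ) := by
  rw [inner_self_eq_norm_sq_to_K, hx]; simp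

theorem ne_zero_of_one {x : H} (hx : ‖x‖ = 1) : x ≠ 0 := by
  rintro rfl; simp at hx

theorem exists_unit {v : H} (hv : v ≠ 0) : ∃ c : ℂ, c ≠ 0 ∧ ‖c • v‖ = 1 :=
  ⟨(‖v‖ : ℂ)⁻¹, by simpa using hv, by simp [norm_smul, hv]⟩

theorem form_ext {T S : H →ₗ[ℂ] H} (h : ∀ y : H, ‖y‖ = 1 → inner ℂ y (T y) = inner ℂ y (S y)) :
    T = S := by
  rw [← sub_eq_zero, ← inner_map_self_eq_zero]
  intro x
  by_cases hx : x = 0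
  · simp [hx]
  obtain ⟨c, hc, h1⟩ := exists_unit hx
  have := h _ h1
  simp only [map_smul, inner_smul_left, inner_smul_right] at this
  rw [mul_right_inj' hc, mul_right_inj' (by simpa using hc)] at this
  rw [← inner_conj_symm, LinearMap.sub_apply, inner_sub_right, this]; simp

structure JM_s3 (A : NonUnitalSubalgebra ℂ (H →L[ℂ] H)) (B : NonUnitalSubalgebra ℂ (K →L[ℂ] K))
    (φ : (H →L[ℂ] H) → (K →L[ℂ] K)) : Prop where
  hA : ∀ x y, rankOne ℂ x y ∈ A
  hB : ∀ x y, rankOne ℂ x y ∈ B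
  starA : ∀ a ∈ A, adjoint a ∈ A
  inj : ∀ a ∈ A, ∀ b ∈ A, φ a = φ b → a = b
  surj : ∀ b ∈ B, ∃ a ∈ A, φ a = b
  star : ∀ a ∈ A, φ (adjoint a) = adjoint (φ a)
  add : ∀ a ∈ A, ∀ b ∈ A, φ (a + b) = φ a + φ b
  mul : ∀ a ∈ A, ∀ b ∈ A, φ (a * b + b * a) = φ a * φ b + φ b * φ a

namespace JM_s3
variable {A : NonUnitalSubalgebra ℂ (H →L[ℂ] H)} {B : NonUnitalSubalgebra ℂ (K →L[ℂ] K)}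
    {φ : (H →L[ℂ] H) → (K →L[ℂ] K)}

theorem two_inj {V : Type*} [AddCommGroup V] [Module ℂ V] {x y : V} (h : x + x = y + y) :
    x = y := by
  rw [← two_smul ℂ x, ← two_smul ℂ y] at h
  exact smul_right_injective V (two_ne_zero' ℂ) h

theorem zero_s3 (h : JM_s3 A B φ) : φ 0 = 0 := by
  have := h.add 0 A.zero_mem 0 A.zero_mem
  simpa using this

theorem sq (h : JM_s3 A B φ) {a} (ha : a ∈ A) : φ (a * a) = φ a * φ a := by
  apply two_inj
  rw [← h.add _ (A.mul_mem ha ha) _ (A.mul_mem ha ha), h.mul _ ha _ ha]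

theorem triple (h : JM_s3 A B φ) {a b} (ha : a ∈ A) (hb : b ∈ A) :
    φ (a * b * a) = φ a * φ b * φ a := by
  have haa := A.mul_mem ha ha
  have hab := A.add_mem (A.mul_mem ha hb) (A.mul_mem hb ha)
  have haba := A.mul_mem (A.mul_mem ha hb) ha
  have h1 := h.mul _ ha _ hab
  have h2 := h.mul _ haa _ hb
  have h3 : a * (a * b + b * a) + (a * b + b * a) * a
      = (a * a * b + b * (a * a)) + (a * b * a + a * b * a) := by noncomm_ring
  rw [h3, h.add _ (A.add_mem (A.mul_mem haa hb) (A.mul_mem hb haa)) _ (A.add_mem haba haba),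
    h2, h.add _ haba _ haba, h.sq ha, h.mul _ ha _ hb] at h1
  apply two_inj
  have h4 : ∀ x y : K →L[ℂ] K, x * (x * y + y * x) + (x * y + y * x) * x
      = (x * x * y + y * (x * x)) + (x * y * x + x * y * x) := fun x y => by noncomm_ring
  rw [h4] at h1
  exact add_left_cancel h1

theorem unit_map (h : JM_s3 A B φ) {x : H} (hx : ‖x‖ = 1) :
    ∃ y : K, ‖y‖ = 1 ∧ φ (rankOne ℂ x x) = rankOne ℂ y y := by
  have hp := h.hA x x
  set p := rankOne ℂ x x with hpd
  have hpp : p * p = p := by rw [hpd, rr, inner_one hx, one_smul]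
  have hp0 : p ≠ 0 := rankOne_ne_zero (ne_zero_of_one hx) (ne_zero_of_one hx)
  set q := φ p with hq
  have hqq : q * q = q := by rw [hq, ← h.sq hp, hpp]
  have hqs : adjoint q = q := by rw [hq, ← h.star _ hp, hpd, adjoint_rankOne]
  have hq0 : q ≠ 0 := fun h0 => hp0 (h.inj _ hp _ A.zero_mem (by rw [h.zero_s3]; exact h0))
  obtain ⟨v, hv⟩ : ∃ v, q v ≠ 0 := by
    by_contra! hc; exact hq0 (by ext v; simpa using hc v)
  obtain ⟨c, hc, h1⟩ := exists_unit hv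
  set y := c • q v with hy
  have hqy : q y = y := by
    have : q (q v) = q v := congrArg (fun T => T v) hqq
    rw [hy, map_smul, this]
  refine ⟨y, h1, ?_⟩
  obtain ⟨b, hb, hby⟩ := h.surj _ (h.hB y y)
  have hqyq : q * rankOne ℂ y y * q = rankOne ℂ y y := by
    ext w
    have : inner ℂ y (q w) = inner ℂ y w := by
      rw [← adjoint_inner_left, hqs, hqy]
    simp [hqy, this]
  have hpbp : p * b * p = b := by
    apply h.inj _ (A.mul_mem (A.mul_mem hp hb) hp) _ hb
    rw [h.triple hp hb, hby, ← hq, hqyq]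
  have hbb : b * b = b := by
    apply h.inj _ (A.mul_mem hb hb) _ hb
    rw [h.sq hb, hby, rr, inner_one h1, one_smul]
  rw [hpd, compress, ← hpd] at hpbp
  set d := inner ℂ x (b x)
  have hd : d * d = d := by
    rw [← hpbp] at hbb
    rw [smul_mul_smul_comm, hpp] at hbb
    exact smul_left_injective ℂ hp0 hbb
  have hd' : d = 0 ∨ d = 1 := by
    by_cases h0 : d = 0
    · exact Or.inl h0
    · exact Or.inr (mul_left_cancel₀ h0 (by rw [hd, mul_one]))
  rcases hd' with h0 | h0
  · rw [h0, zero_smul] at hpbp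
    rw [← hpbp, h.zero_s3] at hby
    exact absurd hby.symm (rankOne_ne_zero (ne_zero_of_one h1) (ne_zero_of_one h1))
  · rw [h0, one_smul] at hpbp
    rw [hq, hpbp, hby]

theorem unit_surj (h : JM_s3 A B φ) {y : K} (hy : ‖y‖ = 1) :
    ∃ x : H, ‖x‖ = 1 ∧ φ (rankOne ℂ x x) = rankOne ℂ y y := by
  obtain ⟨b, hb, hby⟩ := h.surj _ (h.hB y y)
  have hbb : b * b = b := by
    apply h.inj _ (A.mul_mem hb hb) _ hb
    rw [h.sq hb, hby, rr, inner_one hy, one_smul]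
  have hbs : adjoint b = b := by
    apply h.inj _ (h.starA _ hb) _ hb
    rw [h.star _ hb, hby, adjoint_rankOne]
  have hy0 := ne_zero_of_one hy
  have hb0 : b ≠ 0 := by
    rintro rfl
    rw [h.zero_s3] at hby
    exact rankOne_ne_zero hy0 hy0 hby.symm
  obtain ⟨v, hv⟩ : ∃ v, b v ≠ 0 := by
    by_contra! hc; exact hb0 (by ext v; simpa using hc v)
  obtain ⟨c, hc, h1⟩ := exists_unit hv
  set x := c • b v with hx
  have hqy : b x = x := by
    have : b (b v) = b v := congrArg (fun T => T v) hbb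
    rw [hx, map_smul, this]
  refine ⟨x, h1, ?_⟩
  have hp := h.hA x x
  have hbpb : b * rankOne ℂ x x * b = rankOne ℂ x x := by
    ext w
    have : inner ℂ x (b w) = inner ℂ x w := by
      rw [← adjoint_inner_left, hbs, hqy]
    simp [hqy, this]
  obtain ⟨z, hz, hz1⟩ := h.unit_map h1
  have := h.triple hb hp
  rw [hbpb, hby, hz1, compress] at this
  have hs := congrArg (fun T => T * T) this
  simp only [smul_mul_smul_comm, rr, inner_one hz, inner_one hy, one_smul] at hs
  set d := inner ℂ y (rankOne ℂ z z y)
  rw [this] at hs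
  have hd : d = d * d := smul_left_injective ℂ (rankOne_ne_zero hy0 hy0) hs
  rw [hz1, this]
  by_cases h0 : d = 0
  · rw [h0, zero_smul] at this
    exact absurd this (rankOne_ne_zero (ne_zero_of_one hz) (ne_zero_of_one hz))
  · have : d = 1 := mul_left_cancel₀ h0 (by rw [← hd, mul_one])
    rw [this, one_smul]

theorem lin_or (h : JM_s3 A B φ) {x : H} (hx : ‖x‖ = 1) :
    (∀ c : ℂ, φ (c • rankOne ℂ x x) = c • φ (rankOne ℂ x x)) ∨
    (∀ c : ℂ, φ (c • rankOne ℂ x x) = starRingEnd ℂ c • φ (rankOne ℂ x x)) := by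
  obtain ⟨y, hy, hxy⟩ := h.unit_map hx
  have hy0 := ne_zero_of_one hy
  have hq0 : rankOne ℂ y y ≠ 0 := rankOne_ne_zero hy0 hy0
  have hp := h.hA x x
  have hm : ∀ c : ℂ, c • rankOne ℂ x x ∈ A := fun c => A.toSubmodule.smul_mem c hp
  have key : ∀ c : ℂ, φ (c • rankOne ℂ x x)
      = inner ℂ y (φ (c • rankOne ℂ x x) y) • rankOne ℂ y y := by
    intro c
    have h1 := h.triple hp (hm c)
    rw [hxy, compress, compress] at h1
    rw [← h1]
    simp [inner_one hx, hx]
  let s : ℂ → ℂ := fun c => inner ℂ y (φ (c • rankOne ℂ x x) y)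
  have key' : ∀ c : ℂ, φ (c • rankOne ℂ x x) = s c • rankOne ℂ y y := key
  have sinj : ∀ a b : ℂ, a • rankOne ℂ y y = b • rankOne ℂ y y → a = b :=
    fun a b hab => smul_left_injective ℂ hq0 hab
  have hs1 : s 1 = 1 := sinj _ _ (by rw [← key', one_smul, one_smul, hxy])
  have hs0 : s 0 = 0 := sinj _ _ (by rw [← key', zero_smul, zero_smul, h.zero_s3])
  have hsa : ∀ a b, s (a + b) = s a + s b := fun a b => sinj _ _ (by
    rw [← key', add_smul, h.add _ (hm a) _ (hm b), key', key', add_smul])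
  have hsm : ∀ a b, s (a * b) = s a * s b := fun a b => by
    have h1 := h.mul _ (hm a) _ (hm b)
    simp only [smul_mul_smul_comm, rr, inner_one hx, one_smul, key', inner_one hy] at h1
    rw [← add_smul, ← add_smul, key'] at h1
    have h2 := sinj _ _ h1
    rw [hsa, mul_comm b a, mul_comm (s b)] at h2
    linear_combination h2 / 2
  let σ : ℂ →+* ℂ :=
    { toFun := s, map_one' := hs1, map_zero' := hs0, map_add' := hsa, map_mul' := hsm }
  have hσ : ∀ z, σ (starRingEnd ℂ z) = starRingEnd ℂ (σ z) := fun z => sinj _ _ (by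
    have h1 := h.star _ (hm z)
    rw [map_smulₛₗ, adjoint_rankOne, key', key', map_smulₛₗ, adjoint_rankOne] at h1
    exact h1)
  rw [hxy]
  rcases ringHom_star hσ with h1 | h1
  · left; intro c; rw [key']; congr 1; exact h1 c
  · right; intro c; rw [key']; congr 1; exact h1 c

/-- not both types for non-orthogonal vectors -/
theorem not_mixed (h : JM_s3 A B φ) {x x' : H} (hi : inner ℂ x x' ≠ (0 : ℂ))
    (h1 : φ (Complex.I • rankOne ℂ x x) = Complex.I • φ (rankOne ℂ x x))
    (h2 : φ (Complex.I • rankOne ℂ x' x') = -Complex.I • φ (rankOne ℂ x' x')) : False := by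
  have hp := h.hA x x
  have hp' := h.hA x' x'
  have e1 := h.mul _ (A.toSubmodule.smul_mem Complex.I hp) _ hp'
  have e2 := h.mul _ hp _ (A.toSubmodule.smul_mem Complex.I hp')
  rw [h1] at e1
  rw [h2] at e2
  simp only [smul_mul_assoc, mul_smul_comm] at e1 e2
  rw [e1, ← smul_add, ← smul_add, ← h.mul _ hp _ hp'] at e2
  have hI : Complex.I ≠ -Complex.I := by
    intro h; have := congrArg Complex.im h; norm_num at this
  have e3 : φ (rankOne ℂ x x * rankOne ℂ x' x' + rankOne ℂ x' x' * rankOne ℂ x x) = 0 := by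
    by_contra h0
    exact hI (smul_left_injective ℂ h0 e2)
  have e4 := h.inj _ (A.add_mem (A.mul_mem hp hp') (A.mul_mem hp' hp)) _ A.zero_mem
    (e3.trans h.zero_s3.symm)
  have e5 := congrArg (fun T => inner ℂ x (T x)) e4
  have hx0 : x ≠ 0 := by rintro rfl; simp at hi
  have hxx : inner ℂ x x ≠ (0 : ℂ) := inner_self_ne_zero.mpr hx0
  have hi' : inner ℂ x' x ≠ (0 : ℂ) := by rwa [Ne, inner_eq_zero_symm]
  simp only [rr, _root_.add_apply, _root_.smul_apply, rankOne_apply,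
    inner_add_right, inner_smul_right, _root_.zero_apply, inner_zero_right] at e5
  have : 2 * (inner ℂ x x' * inner ℂ x' x * inner ℂ x x) = (0 : ℂ) := by linear_combination e5
  simp_all

theorem uniform (h : JM_s3 A B φ) :
    (∀ x : H, ‖x‖ = 1 → ∀ c : ℂ, φ (c • rankOne ℂ x x) = c • φ (rankOne ℂ x x)) ∨
    (∀ x : H, ‖x‖ = 1 → ∀ c : ℂ,
      φ (c • rankOne ℂ x x) = starRingEnd ℂ c • φ (rankOne ℂ x x)) := by
  by_contra! hc
  obtain ⟨⟨x', hx', c', hc'⟩, ⟨x, hx, c, hc⟩⟩ := hc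
  have h1 := (h.lin_or hx).resolve_right (fun h' => hc (h' c))
  have h2 := (h.lin_or hx').resolve_left (fun h' => hc' (h' c'))
  by_cases hi : inner ℂ x x' = (0 : ℂ)
  · have hs : inner ℂ x (x + x') = (1 : ℂ) := by rw [inner_add_right, hi, inner_one hx, add_zero]
    have hi2 : inner ℂ x' x = (0 : ℂ) := inner_eq_zero_symm.mp hi
    have hs' : inner ℂ (x + x') x' = (1 : ℂ) := by
      rw [inner_add_left, hi, inner_one hx', zero_add]
    obtain ⟨d, hd, hu⟩ := exists_unit (v := x + x') (by
      intro h0; rw [h0] at hs; simp at hs)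
    rcases h.lin_or hu with h3 | h3
    · refine h.not_mixed (x := d • (x + x')) (x' := x') ?_ (h3 _) (by simpa using h2 Complex.I)
      rw [inner_smul_left, hs']; simpa using hd
    · refine h.not_mixed (x := x) (x' := d • (x + x')) ?_ (h1 _) (by simpa using h3 Complex.I)
      rw [inner_smul_right, hs]; simpa using hd
  · exact h.not_mixed hi (h1 _) (by simpa using h2 Complex.I)

theorem conj_jm (h : JM_s3 A B φ) : JM_s3 A B (fun a => φ (adjoint a)) where
  hA := h.hA
  hB := h.hB
  starA := h.starA
  inj a ha b hb hab := by
    have := h.inj _ (h.starA _ ha) _ (h.starA _ hb) hab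
    simpa using congrArg adjoint this
  surj b hb := by
    obtain ⟨a, ha, hab⟩ := h.surj b hb
    exact ⟨adjoint a, h.starA _ ha, by simpa using hab⟩
  star a ha := h.star _ (h.starA _ ha)
  add a ha b hb := by
    simp only [map_add]; exact h.add _ (h.starA _ ha) _ (h.starA _ hb)
  mul a ha b hb := by
    have : adjoint (a * b + b * a) = adjoint a * adjoint b + adjoint b * adjoint a := by
      rw [map_add, ContinuousLinearMap.mul_def, ContinuousLinearMap.mul_def, adjoint_comp,
        adjoint_comp, add_comm]; rfl
    rw [this]; exact h.mul _ (h.starA _ ha) _ (h.starA _ hb)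

/-- the linear case -/
theorem form (h : JM_s3 A B φ)
    (hl : ∀ x : H, ‖x‖ = 1 → ∀ c : ℂ, φ (c • rankOne ℂ x x) = c • φ (rankOne ℂ x x))
    {x : H} {y : K} (hx : ‖x‖ = 1) (hy : ‖y‖ = 1) (hxy : φ (rankOne ℂ x x) = rankOne ℂ y y)
    {a} (ha : a ∈ A) : inner ℂ y (φ a y) = inner ℂ x (a x) := by
  have h1 := h.triple (h.hA x x) ha
  rw [compress, hl x hx, hxy, compress] at h1
  have hy0 := ne_zero_of_one hy
  exact (smul_left_injective ℂ (rankOne_ne_zero hy0 hy0) h1).symm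

theorem smul (h : JM_s3 A B φ)
    (hl : ∀ x : H, ‖x‖ = 1 → ∀ c : ℂ, φ (c • rankOne ℂ x x) = c • φ (rankOne ℂ x x))
    {a} (ha : a ∈ A) (c : ℂ) : φ (c • a) = c • φ a := by
  apply ContinuousLinearMap.coe_injective
  apply form_ext
  intro y hy
  obtain ⟨x, hx, hxy⟩ := h.unit_surj hy
  have h1 := h.form hl hx hy hxy (A.toSubmodule.smul_mem c ha)
  have h2 := h.form hl hx hy hxy ha
  simp only [ContinuousLinearMap.coe_coe, _root_.smul_apply,
    inner_smul_right] at h1 ⊢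
  rw [h1, h2]

/-- the dichotomy for one vector -/
theorem dich (h : JM_s3 A B φ) {x0 : H} {y0 : K} (hx0 : ‖x0‖ = 1) (hy0 : ‖y0‖ = 1)
    (hxy : φ (rankOne ℂ x0 x0) = rankOne ℂ y0 y0) {x : H} (hx : inner ℂ x0 x = (0 : ℂ)) :
    (∀ v, φ (rankOne ℂ x x0) v = inner ℂ (adjoint (φ (rankOne ℂ x x0)) y0) v • y0
      + inner ℂ y0 v • φ (rankOne ℂ x x0) y0) ∧
    (φ (rankOne ℂ x x0) y0 = 0 ∨ adjoint (φ (rankOne ℂ x x0)) y0 = 0) := by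
  have hN := h.hA x x0
  have hp := h.hA x0 x0
  have hx' : inner ℂ x x0 = (0 : ℂ) := inner_eq_zero_symm.mp hx
  have e1 := h.mul _ hp _ hN
  rw [rr, rr, inner_one hx0, hx, zero_smul, one_smul, zero_add, hxy] at e1
  have e2 := h.sq hN
  rw [rr, hx, zero_smul, h.zero_s3] at e2
  set M := φ (rankOne ℂ x x0)
  have k1 : ∀ v, M v = inner ℂ (adjoint M y0) v • y0 + inner ℂ y0 v • M y0 := by
    intro v
    have := congrArg (fun T => T v) e1
    rw [adjoint_inner_left]
    simpa using this
  refine ⟨k1, ?_⟩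
  have k2 : ∀ v, M (M v) = 0 := fun v => (congrArg (fun T => T v) e2).symm
  have k3 : inner ℂ (adjoint M y0) y0 = (0 : ℂ) := by
    have := k1 y0
    rw [inner_one hy0, one_smul, right_eq_add, smul_eq_zero] at this
    exact this.resolve_right (ne_zero_of_one hy0)
  have k4 := k2 (adjoint M y0)
  rw [k1 (adjoint M y0), map_add, map_smul, map_smul, k2, smul_zero, add_zero, smul_eq_zero,
    inner_self_eq_zero] at k4
  exact k4.symm

theorem rankOne_iso (h : JM_s3 A B φ)
    (hl : ∀ x : H, ‖x‖ = 1 → ∀ c : ℂ, φ (c • rankOne ℂ x x) = c • φ (rankOne ℂ x x))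
    {x0 : H} {y0 : K} (hx0 : ‖x0‖ = 1) (hy0 : ‖y0‖ = 1)
    (hxy : φ (rankOne ℂ x0 x0) = rankOne ℂ y0 y0) (x : H) (u : K)
    (hu : (φ (rankOne ℂ x x0) = rankOne ℂ u y0 ∧ φ (rankOne ℂ x0 x) = rankOne ℂ y0 u) ∨
      (φ (rankOne ℂ x x0) = rankOne ℂ y0 u ∧ φ (rankOne ℂ x0 x) = rankOne ℂ u y0)) :
    φ (rankOne ℂ x x) = rankOne ℂ u u ∧ ‖u‖ = ‖x‖ := by
  have hm : rankOne ℂ x x0 * rankOne ℂ x0 x + rankOne ℂ x0 x * rankOne ℂ x x0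
      = rankOne ℂ x x + (inner ℂ x x : ℂ) • rankOne ℂ x0 x0 := by
    rw [rr, rr, inner_one hx0, one_smul]
  have e1 := h.mul _ (h.hA x x0) _ (h.hA x0 x)
  have e2 : φ (rankOne ℂ x x0) * φ (rankOne ℂ x0 x) + φ (rankOne ℂ x0 x) * φ (rankOne ℂ x x0)
      = rankOne ℂ u u + (inner ℂ u u : ℂ) • rankOne ℂ y0 y0 := by
    rcases hu with ⟨h1, h2⟩ | ⟨h1, h2⟩
    · rw [h1, h2, rr, rr, inner_one hy0, one_smul]
    · rw [h1, h2, rr, rr, inner_one hy0, one_smul, add_comm]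
  have hmem := A.toSubmodule.smul_mem (inner ℂ x x : ℂ) (h.hA x0 x0)
  rw [hm, e2, h.add _ (h.hA x x) _ hmem, hl x0 hx0, hxy] at e1
  have f1 := h.form hl hx0 hy0 hxy (h.hA x x)
  have f2 := h.form hl hx0 hy0 hxy (h.hA x x0)
  have f3 := h.form hl hx0 hy0 hxy (h.hA x0 x)
  have f4 : inner ℂ y0 u * inner ℂ u y0 = (inner ℂ x0 x * inner ℂ x x0 : ℂ) := by
    rcases hu with ⟨h1, h2⟩ | ⟨h1, h2⟩
    · rw [h1] at f2; rw [h2] at f3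
      simp only [rankOne_apply, inner_smul_right, inner_one hx0, inner_one hy0, one_mul,
        mul_one] at f2 f3
      rw [f2, f3]
    · rw [h1] at f2; rw [h2] at f3
      simp only [rankOne_apply, inner_smul_right, inner_one hx0, inner_one hy0, one_mul,
        mul_one] at f2 f3
      rw [f2, f3, mul_comm]
  have e3 := congrArg (fun T => inner ℂ y0 (T y0)) e1
  simp only [_root_.add_apply, _root_.smul_apply, inner_add_right,
    inner_smul_right, f1, rankOne_apply, inner_one hy0, mul_one] at e3
  have e4 : (inner ℂ u u : ℂ) = inner ℂ x x := by linear_combination -e3 - f4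
  constructor
  · rw [e4] at e1; exact add_right_cancel e1
  · rw [inner_self_eq_norm_sq_to_K, inner_self_eq_norm_sq_to_K] at e4
    have : ‖u‖ ^ 2 = ‖x‖ ^ 2 := by exact_mod_cast e4
    exact (sq_eq_sq₀ (norm_nonneg _) (norm_nonneg _)).mp this

theorem surj_aux (h : JM_s3 A B φ) {u : H → K} (hu : ∀ x, φ (rankOne ℂ x x) = rankOne ℂ (u x) (u x))
    (hs : ∀ (c : ℂ) x, ∃ x', u x' = c • u x) : Function.Surjective u := by
  intro y
  by_cases hy : y = 0
  · obtain ⟨x', hx'⟩ := hs 0 0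
    exact ⟨x', by rw [hx', hy, zero_smul]⟩
  obtain ⟨c, hc, h1⟩ := exists_unit hy
  obtain ⟨x, hx, hxy⟩ := h.unit_surj h1
  rw [hu] at hxy
  have := congrArg (fun T => T (c • y)) hxy
  simp only [rankOne_apply, inner_one h1, one_smul] at this
  obtain ⟨x', hx'⟩ := hs (c⁻¹ * inner ℂ (u x) (c • y)) x
  refine ⟨x', ?_⟩
  rw [hx', mul_smul, this, smul_smul, inv_mul_cancel₀ hc, one_smul]

theorem conj_inner (U : H ≃ₛₗᵢ[starRingEnd ℂ] K) (a b : H) :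
    inner ℂ (U a) (U b) = inner ℂ b a := by
  have hre : ∀ a b : H, (inner ℂ (U a) (U b)).re = (inner ℂ a b).re := by
    intro a b
    have h1 := norm_add_sq (𝕜 := ℂ) a b
    have h2 := norm_add_sq (𝕜 := ℂ) (U a) (U b)
    rw [← map_add, U.norm_map, U.norm_map, U.norm_map, h1] at h2
    simp only [RCLike.re_to_complex] at h2
    linarith
  rw [← inner_conj_symm b a]
  apply Complex.ext
  · rw [Complex.conj_re]; exact hre a b
  · have := hre (Complex.I • a) b
    rw [map_smulₛₗ, inner_smul_left, inner_smul_left] at this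
    simp at this
    rw [Complex.conj_im]; linarith

theorem linear_case (h : JM_s3 A B φ)
    (hl : ∀ x : H, ‖x‖ = 1 → ∀ c : ℂ, φ (c • rankOne ℂ x x) = c • φ (rankOne ℂ x x))
    {x0 : H} (hx0 : ‖x0‖ = 1) :
    (∃ U : H ≃ₗᵢ[ℂ] K, ∀ a ∈ A, ∀ k : K, φ a k = U (a (U.symm k))) ∨
    (∃ U : H ≃ₛₗᵢ[starRingEnd ℂ] K, ∀ a ∈ A, ∀ k : K,
      φ a k = U (adjoint a (U.symm k))) := by
  obtain ⟨y0, hy0, hxy⟩ := h.unit_map hx0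
  have hadd : ∀ x x', φ (rankOne ℂ (x + x') x0) = φ (rankOne ℂ x x0) + φ (rankOne ℂ x' x0) := by
    intro x x'
    rw [← h.add _ (h.hA _ _) _ (h.hA _ _), map_add]; rfl
  have hsm : ∀ (c : ℂ) x, φ (rankOne ℂ (c • x) x0) = c • φ (rankOne ℂ x x0) := by
    intro c x
    rw [← h.smul hl (h.hA _ _), map_smul]; rfl
  have hst : ∀ x, φ (rankOne ℂ x0 x) = adjoint (φ (rankOne ℂ x x0)) := by
    intro x
    rw [← h.star _ (h.hA _ _), adjoint_rankOne]
  have hdec : ∀ x, ∃ (c : ℂ) (z : H), inner ℂ x0 z = (0 : ℂ) ∧ x = c • x0 + z := by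
    intro x
    refine ⟨inner ℂ x0 x, x - (inner ℂ x0 x : ℂ) • x0, ?_, by abel⟩
    rw [inner_sub_right, inner_smul_right, inner_one hx0, mul_one, sub_self]
  have hcase : (∀ x, inner ℂ x0 x = (0 : ℂ) → adjoint (φ (rankOne ℂ x x0)) y0 = 0) ∨
      (∀ x, inner ℂ x0 x = (0 : ℂ) → φ (rankOne ℂ x x0) y0 = 0) := by
    by_contra! hc
    obtain ⟨⟨x, hx, hxn⟩, ⟨x', hx', hxn'⟩⟩ := hc
    have d1 := (h.dich hx0 hy0 hxy hx).2.resolve_right hxn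
    have d2 := (h.dich hx0 hy0 hxy hx').2.resolve_left hxn'
    have d3 := (h.dich hx0 hy0 hxy (x := x + x') (by rw [inner_add_right, hx, hx', add_zero])).2
    rw [hadd, map_add, _root_.add_apply, _root_.add_apply, d1, d2,
      zero_add, add_zero] at d3
    exact d3.elim hxn' hxn
  rcases hcase with hc | hc
  · left
    let L : H →ₗ[ℂ] K :=
      { toFun := fun x => φ (rankOne ℂ x x0) y0
        map_add' := fun x x' => by rw [hadd]; rfl
        map_smul' := fun c x => by rw [hsm]; rfl }
    have hL : ∀ x, φ (rankOne ℂ x x0) = rankOne ℂ (L x) y0 := by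
      intro x
      obtain ⟨c, z, hz, rfl⟩ := hdec x
      have hz1 : φ (rankOne ℂ z x0) = rankOne ℂ (L z) y0 := by
        ext v
        rw [(h.dich hx0 hy0 hxy hz).1 v, hc z hz, inner_zero_left, zero_smul, zero_add]
        rfl
      have hL0 : L x0 = y0 := by
        change φ (rankOne ℂ x0 x0) y0 = y0
        rw [hxy, rankOne_apply, inner_one hy0, one_smul]
      rw [hadd, hsm, hz1, hxy, map_add, map_smul, hL0, map_add, map_smul]; rfl
    have hR : ∀ x, φ (rankOne ℂ x0 x) = rankOne ℂ y0 (L x) := by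
      intro x; rw [hst, hL, adjoint_rankOne]
    have hiso := fun x => h.rankOne_iso hl hx0 hy0 hxy x (L x) (Or.inl ⟨hL x, hR x⟩)
    have hsurj : Function.Surjective L := h.surj_aux (fun x => (hiso x).1)
      fun c x => ⟨c • x, map_smul L c x⟩
    let U : H ≃ₗᵢ[ℂ] K := LinearIsometryEquiv.ofSurjective ⟨L, fun x => (hiso x).2⟩ hsurj
    have hU : ∀ x, U x = L x := fun x => rfl
    refine ⟨U, fun a ha => ?_⟩
    let T : K →ₗ[ℂ] K :=
      { toFun := fun k => U (a (U.symm k))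
        map_add' := fun x x' => by simp
        map_smul' := fun c x => by simp }
    have hT : (φ a : K →ₗ[ℂ] K) = T := by
      apply form_ext
      intro k hk
      have h1 : φ (rankOne ℂ (U.symm k) (U.symm k)) = rankOne ℂ k k := by
        rw [(hiso _).1, ← hU, U.apply_symm_apply]
      have h2 := h.form hl (by rw [U.symm.norm_map, hk]) hk h1 ha
      refine h2.trans ?_
      change _ = inner ℂ k (U (a (U.symm k)))
      rw [← U.inner_map_map, U.apply_symm_apply]
    intro k
    exact congrArg (fun S => S k) hT
  · right
    let L : H →ₛₗ[starRingEnd ℂ] K :=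
      { toFun := fun x => φ (rankOne ℂ x0 x) y0
        map_add' := fun x x' => by rw [hst, hadd, map_add, hst, hst]; rfl
        map_smul' := fun c x => by rw [hst, hsm, map_smulₛₗ, hst]; rfl }
    have hL : ∀ x, φ (rankOne ℂ x x0) = rankOne ℂ y0 (L x) := by
      intro x
      obtain ⟨c, z, hz, rfl⟩ := hdec x
      have hz1 : φ (rankOne ℂ z x0) = rankOne ℂ y0 (L z) := by
        ext v
        rw [(h.dich hx0 hy0 hxy hz).1 v, hc z hz, smul_zero, add_zero, ← hst]
        rfl
      have hL0 : L x0 = y0 := by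
        change φ (rankOne ℂ x0 x0) y0 = y0
        rw [hxy, rankOne_apply, inner_one hy0, one_smul]
      rw [hadd, hsm, hz1, hxy, map_add, map_smulₛₗ, hL0, map_add, map_smulₛₗ]; simp
    have hR : ∀ x, φ (rankOne ℂ x0 x) = rankOne ℂ (L x) y0 := by
      intro x; rw [hst, hL, adjoint_rankOne]
    have hiso := fun x => h.rankOne_iso hl hx0 hy0 hxy x (L x) (Or.inr ⟨hL x, hR x⟩)
    have hsurj : Function.Surjective L := h.surj_aux (fun x => (hiso x).1)
      fun c x => ⟨starRingEnd ℂ c • x, by rw [map_smulₛₗ]; simp⟩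
    let U : H ≃ₛₗᵢ[starRingEnd ℂ] K :=
      LinearIsometryEquiv.ofSurjective ⟨L, fun x => (hiso x).2⟩ hsurj
    have hU : ∀ x, U x = L x := fun x => rfl
    refine ⟨U, fun a ha => ?_⟩
    let T : K →ₗ[ℂ] K :=
      { toFun := fun k => U (adjoint a (U.symm k))
        map_add' := fun x x' => by simp
        map_smul' := fun c x => by simp [map_smulₛₗ] }
    have hT : (φ a : K →ₗ[ℂ] K) = T := by
      apply form_ext
      intro k hk
      have h1 : φ (rankOne ℂ (U.symm k) (U.symm k)) = rankOne ℂ k k := by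
        rw [(hiso _).1, ← hU, U.apply_symm_apply]
      have h2 := h.form hl (by rw [U.symm.norm_map, hk]) hk h1 ha
      refine h2.trans ?_
      change _ = inner ℂ k (U (adjoint a (U.symm k)))
      have h3 := conj_inner U (U.symm k) (adjoint a (U.symm k))
      rw [U.apply_symm_apply] at h3
      rw [h3, adjoint_inner_left]
    intro k
    exact congrArg (fun S => S k) hT

end JM_s3
end JordanAux

namespace JordanAux
open InnerProductSpace ContinuousLinearMap
variable {H K : Type*} [NormedAddCommGroup H] [InnerProductSpace ℂ H] [CompleteSpace H]
    [NormedAddCommGroup K] [InnerProductSpace ℂ K] [CompleteSpace K]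

theorem proj_for (z : H) : ∃ w : H, rankOne ℂ w w z = z := by
  by_cases hz : z = 0
  · exact ⟨0, by simp [hz]⟩
  obtain ⟨c, hc, h1⟩ := exists_unit hz
  refine ⟨c • z, ?_⟩
  have hz' : z = c⁻¹ • (c • z) := by rw [smul_smul, inv_mul_cancel₀ hc, one_smul]
  conv_lhs => rw [hz']
  rw [map_smul, ← hz', rankOne_apply, inner_one h1, one_smul, ← hz']

theorem mkJC (hH : 1 < Module.rank ℂ H)
    (A : NonUnitalSubalgebra ℂ (H →L[ℂ] H)) (hA : ∀ x y, rankOne ℂ x y ∈ A)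
    (φ : (H →L[ℂ] H) → (K →L[ℂ] K))
    (mul : ∀ a ∈ A, ∀ b ∈ A, φ (a * b + b * a) = φ a * φ b + φ b * φ a)
    (inj : ∀ a ∈ A, ∀ b ∈ A, φ a = φ b → a = b)
    (sur : ∀ a ∈ A, ∀ b ∈ A, ∃ s ∈ A, φ s = φ a + φ b)
    (zero_s3 : φ 0 = 0) {x0 : H} (hx0 : ‖x0‖ = 1) :
    JC A.toNonUnitalSubring (rankOne ℂ x0 x0) (1 - rankOne ℂ x0 x0) φ := by
  have hee : rankOne ℂ x0 x0 * rankOne ℂ x0 x0 = rankOne ℂ x0 x0 := by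
    rw [rr, inner_one hx0, one_smul]
  have hn := ne_zero_of_one hx0
  have hes : ∀ v w, inner ℂ (rankOne ℂ x0 x0 v) w = (inner ℂ v (rankOne ℂ x0 x0 w) : ℂ) := by
    intro v w
    rw [← adjoint_inner_right, adjoint_rankOne]
  set e := rankOne ℂ x0 x0 with he
  set f : H →L[ℂ] H := 1 - e with hf
  have hff : f * f = f := by
    rw [hf, mul_sub, sub_mul, sub_mul, hee]; simp
  have hfs : ∀ v w, inner ℂ (f v) w = (inner ℂ v (f w) : ℂ) := by
    intro v w
    simp only [hf, _root_.sub_apply, one_apply, inner_sub_left, inner_sub_right, hes]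
    rfl
  have hffv : ∀ v, f (f v) = f v := fun v => congrArg (fun T => T v) hff
  refine ⟨hee, hff, ?_, ?_, by rw [hf]; abel, hA _ _, rankOne_ne_zero hn hn, ?_, ?_, ?_, mul, inj,
    sur, zero_s3, ?_, ?_⟩
  · rw [hf, mul_sub, hee, mul_one, sub_self]
  · rw [hf, sub_mul, hee, one_mul, sub_self]
  · intro h0
    refine absurd hH (not_lt.mpr ?_)
    rw [rank_le_one_iff]
    refine ⟨x0, fun v => ⟨inner ℂ x0 v, ?_⟩⟩
    have := congrArg (fun T => T v) h0
    simp only [hf, he, _root_.sub_apply, one_apply, rankOne_apply, _root_.zero_apply] at this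
    exact (sub_eq_zero.mp this).symm
  · intro a b hab
    by_cases hb : b = 0
    · exact Or.inr hb
    left
    obtain ⟨v, hv⟩ : ∃ v, b v ≠ 0 := by
      by_contra! hc; exact hb (by ext v; simpa using hc v)
    ext x
    have := congrArg (fun T => T v) (hab _ (hA x (b v)))
    simpa [hv] using this
  · intro x hx
    apply JM_s3.two_inj
    rw [hx, add_zero]
  · intro a ha
    obtain ⟨w, hw⟩ := proj_for (f (adjoint a x0))
    refine ⟨rankOne ℂ w w, hA _ _, ?_⟩
    ext v
    have h1 : ∀ u, e (a (f u)) = (inner ℂ (f (adjoint a x0)) u : ℂ) • x0 := by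
      intro u
      rw [hfs, adjoint_inner_left]; rfl
    change e (a (f (rankOne ℂ w w (f v)))) = e (a (f v))
    rw [h1, h1]
    congr 1
    rw [← adjoint_inner_left, adjoint_rankOne, hw, hfs, hffv, hfs]
  · intro a ha
    obtain ⟨w, hw⟩ := proj_for (f (a x0))
    refine ⟨rankOne ℂ w w, hA _ _, ?_⟩
    ext v
    change f (rankOne ℂ w w (f (a (e v)))) = f (a (e v))
    have h1 : e v = (inner ℂ x0 v : ℂ) • x0 := rfl
    rw [h1]
    simp only [map_smul]
    rw [hw, hffv]

end JordanAux

/-- **Theorem 2.** A bijective, `*`-preserving solution of the Jordan equation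
`φ(AB+BA) = φ(A)φ(B)+φ(B)φ(A)` between standard operator algebras
(closed under taking adjoints) on complex Hilbert spaces with `dim H > 1` is
implemented by a unitary or antiunitary operator, either directly or composed
with the adjoint operation. -/
theorem jordan_star_maps_standard_operator_algebras_no_half
    {H K : Type*} [NormedAddCommGroup H] [InnerProductSpace ℂ H] [CompleteSpace H]
    [NormedAddCommGroup K] [InnerProductSpace ℂ K] [CompleteSpace K]
    (hH : 1 < Module.rank ℂ H)
    (𝒜 : NonUnitalSubalgebra ℂ (H →L[ℂ] H)) (ℬ : NonUnitalSubalgebra ℂ (K →L[ℂ] K))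
    (h𝒜 : ∀ T : H →L[ℂ] H, FiniteDimensional ℂ (LinearMap.range (T : H →ₗ[ℂ] H)) → T ∈ 𝒜)
    (hℬ : ∀ S : K →L[ℂ] K, FiniteDimensional ℂ (LinearMap.range (S : K →ₗ[ℂ] K)) → S ∈ ℬ)
    (h𝒜star : ∀ T ∈ 𝒜, ContinuousLinearMap.adjoint T ∈ 𝒜)
    (hℬstar : ∀ S ∈ ℬ, ContinuousLinearMap.adjoint S ∈ ℬ)
    (φ : 𝒜 → ℬ) (hbij : Function.Bijective φ)
    (hstar : ∀ A : 𝒜,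
      φ ⟨ContinuousLinearMap.adjoint (A : H →L[ℂ] H), h𝒜star _ A.2⟩
        = ⟨ContinuousLinearMap.adjoint ((φ A : K →L[ℂ] K)), hℬstar _ (φ A).2⟩)
    (hJ : ∀ A B : 𝒜, φ (A * B + B * A)
        = φ A * φ B + φ B * φ A) :
    (∃ U : H ≃ₗᵢ[ℂ] K, ∀ A : 𝒜, ∀ k : K,
        (φ A : K →L[ℂ] K) k = U ((A : H →L[ℂ] H) (U.symm k))) ∨
    (∃ U : H ≃ₛₗᵢ[starRingEnd ℂ] K, ∀ A : 𝒜, ∀ k : K,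
        (φ A : K →L[ℂ] K) k = U ((A : H →L[ℂ] H) (U.symm k))) ∨
    (∃ U : H ≃ₗᵢ[ℂ] K, ∀ A : 𝒜, ∀ k : K,
        (φ A : K →L[ℂ] K) k
          = U (ContinuousLinearMap.adjoint (A : H →L[ℂ] H) (U.symm k))) ∨
    (∃ U : H ≃ₛₗᵢ[starRingEnd ℂ] K, ∀ A : 𝒜, ∀ k : K,
        (φ A : K →L[ℂ] K) k
          = U (ContinuousLinearMap.adjoint (A : H →L[ℂ] H) (U.symm k))) := by
  classical
  have hA : ∀ x y, InnerProductSpace.rankOne ℂ x y ∈ 𝒜 := fun x y =>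
    h𝒜 _ (JordanAux.rankOne_fin x y)
  have hB : ∀ x y, InnerProductSpace.rankOne ℂ x y ∈ ℬ := fun x y =>
    hℬ _ (JordanAux.rankOne_fin x y)
  let ψ : (H →L[ℂ] H) → (K →L[ℂ] K) := fun a => if h : a ∈ 𝒜 then (φ ⟨a, h⟩ : K →L[ℂ] K) else 0
  have hψ : ∀ a (h : a ∈ 𝒜), ψ a = φ ⟨a, h⟩ := fun a h => dif_pos h
  have mul : ∀ a ∈ 𝒜, ∀ b ∈ 𝒜, ψ (a * b + b * a) = ψ a * ψ b + ψ b * ψ a := by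
    intro a ha b hb
    rw [hψ a ha, hψ b hb, hψ _ (𝒜.add_mem (𝒜.mul_mem ha hb) (𝒜.mul_mem hb ha))]
    exact congrArg Subtype.val (hJ ⟨a, ha⟩ ⟨b, hb⟩)
  have inj : ∀ a ∈ 𝒜, ∀ b ∈ 𝒜, ψ a = ψ b → a = b := by
    intro a ha b hb hab
    rw [hψ a ha, hψ b hb] at hab
    exact congrArg Subtype.val (hbij.1 (Subtype.ext hab))
  have surj : ∀ b ∈ ℬ, ∃ a ∈ 𝒜, ψ a = b := by
    intro b hb
    obtain ⟨a, ha⟩ := hbij.2 ⟨b, hb⟩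
    exact ⟨a, a.2, by rw [hψ _ a.2]; exact congrArg Subtype.val ha⟩
  have sur : ∀ a ∈ 𝒜, ∀ b ∈ 𝒜, ∃ s ∈ 𝒜, ψ s = ψ a + ψ b := by
    intro a ha b hb
    rw [hψ a ha, hψ b hb]
    exact surj _ (ℬ.add_mem (φ ⟨a, ha⟩).2 (φ ⟨b, hb⟩).2)
  have zero_s3 : ψ 0 = 0 := by
    obtain ⟨z, hz, hz0⟩ := surj 0 ℬ.zero_mem
    have := mul 0 𝒜.zero_mem z hz
    simpa [hz0] using this
  have star : ∀ a ∈ 𝒜, ψ (ContinuousLinearMap.adjoint a) = ContinuousLinearMap.adjoint (ψ a) := by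
    intro a ha
    rw [hψ a ha, hψ _ (h𝒜star a ha)]
    exact congrArg Subtype.val (hstar ⟨a, ha⟩)
  have hnt : ∃ v : H, v ≠ 0 := by
    by_contra! hc
    refine absurd hH (not_lt.mpr ?_)
    rw [rank_le_one_iff]
    exact ⟨0, fun v => ⟨0, by rw [hc v, smul_zero]⟩⟩
  obtain ⟨v, hv⟩ := hnt
  obtain ⟨c, -, hx0⟩ := JordanAux.exists_unit hv
  have hJC := JordanAux.mkJC hH 𝒜 hA ψ mul inj sur zero_s3 hx0
  have hJM : JordanAux.JM_s3 𝒜 ℬ ψ :=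
    ⟨hA, hB, h𝒜star, inj, surj, star, fun a ha b hb => hJC.add ha hb, mul⟩
  rcases hJM.uniform with hl | hl
  · rcases hJM.linear_case hl hx0 with ⟨U, hU⟩ | ⟨U, hU⟩
    · exact Or.inl ⟨U, fun A k => by rw [← hU A A.2, hψ _ A.2]⟩
    · exact Or.inr (Or.inr (Or.inr ⟨U, fun A k => by rw [← hU A A.2, hψ _ A.2]⟩))
  · rcases hJM.conj_jm.linear_case (fun x hx c => by
        simp only [map_smulₛₗ, InnerProductSpace.adjoint_rankOne]
        rw [hl x hx]; simp) hx0 with ⟨U, hU⟩ | ⟨U, hU⟩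
    · refine Or.inr (Or.inr (Or.inl ⟨U, fun A k => ?_⟩))
      rw [← hU _ (h𝒜star _ A.2), ContinuousLinearMap.adjoint_adjoint, hψ _ A.2]
    · refine Or.inr (Or.inl ⟨U, fun A k => ?_⟩)
      have := hU _ (h𝒜star _ A.2) k
      simp only [ContinuousLinearMap.adjoint_adjoint] at this
      rw [← this, hψ _ A.2]
end
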